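/- For every integer n ≥ 2 there is a constant C = C(n) with the following property. Let g be a smooth time-dependent metric on ℝ^n over [0,T] solving the Ricci flow, let x₀ ∈ ℝ^n, r₀ > 0, K ≥ 1, and assume: (a) for every t ∈ [0,T] the closure of the ball B_t(x₀, r₀) is compact; (b) |Rm|(x,0) ≤ r₀^{−2} for every x ∈ B_0(x₀, r₀); (c) |Rm|(x,t) ≤ K/t whenever 0 < t ≤ T and d_t(x₀,x) < r₀. Then |Rm|(x,t) ≤ e^{CK} (r₀ − d_t(x₀,x))^{−2} whenever 0 ≤ t ≤ T and d_t(x₀,x) < r₀. -/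

import Mathlib

open Set MeasureTheory
open scoped BigOperators Matrix

noncomputable section

variable {n : ℕ}

/-- Partial derivative of `f` at `x` in the `i`-th coordinate direction. -/
def pd (f : (Fin n → ℝ) → ℝ) (i : Fin n) (x : Fin n → ℝ) : ℝ :=
  fderiv ℝ f x (Pi.single i 1)

/-- Christoffel symbols `Γ^k_{ij}` of a (time-independent) metric `G`. -/
def christoffel (G : (Fin n → ℝ) → Matrix (Fin n) (Fin n) ℝ)
    (x : Fin n → ℝ) (k i j : Fin n) : ℝ :=
  (1/2) * ∑ l, (G x)⁻¹ k l *
    (pd (fun y => G y j l) i x + pd (fun y => G y i l) j x - pd (fun y => G y i j) l x)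

/-- Ricci tensor `R_{jk}`. -/
def ricci (G : (Fin n → ℝ) → Matrix (Fin n) (Fin n) ℝ)
    (x : Fin n → ℝ) (j k : Fin n) : ℝ :=
  ∑ i, (pd (fun y => christoffel G y i j k) i x
      - pd (fun y => christoffel G y i i k) j x
      + ∑ p, (christoffel G x i i p * christoffel G x p j k
            - christoffel G x i j p * christoffel G x p i k))

/-- Scalar curvature. -/
def scalarCurv (G : (Fin n → ℝ) → Matrix (Fin n) (Fin n) ℝ) (x : Fin n → ℝ) : ℝ :=
  ∑ j, ∑ k, (G x)⁻¹ j k * ricci G x j k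

/-- Riemann tensor `R_{ijkl}`. -/
def riemann (G : (Fin n → ℝ) → Matrix (Fin n) (Fin n) ℝ)
    (x : Fin n → ℝ) (i j k l : Fin n) : ℝ :=
  ∑ m, G x l m *
    (pd (fun y => christoffel G y m j k) i x - pd (fun y => christoffel G y m i k) j x
      + ∑ p, (christoffel G x m i p * christoffel G x p j k
            - christoffel G x m j p * christoffel G x p i k))

/-- Norm of the Riemann tensor. -/
def riemNorm (G : (Fin n → ℝ) → Matrix (Fin n) (Fin n) ℝ) (x : Fin n → ℝ) : ℝ :=
  Real.sqrt (∑ i, ∑ j, ∑ k, ∑ l, ∑ a, ∑ b, ∑ c, ∑ d,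
    (G x)⁻¹ i a * (G x)⁻¹ j b * (G x)⁻¹ k c * (G x)⁻¹ l d *
      riemann G x i j k l * riemann G x a b c d)

/-- Sectional curvature of the plane spanned by `u`, `v`. -/
def sectionalCurv (G : (Fin n → ℝ) → Matrix (Fin n) (Fin n) ℝ)
    (x : Fin n → ℝ) (u v : Fin n → ℝ) : ℝ :=
  (∑ i, ∑ j, ∑ k, ∑ l, riemann G x i j k l * u i * v j * v k * u l) /
    ((∑ i, ∑ j, G x i j * u i * u j) * (∑ i, ∑ j, G x i j * v i * v j)
      - (∑ i, ∑ j, G x i j * u i * v j) ^ 2)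

/-- Length of a path with respect to the metric `G`. -/
def pathLength (G : (Fin n → ℝ) → Matrix (Fin n) (Fin n) ℝ)
    (γ : ℝ → (Fin n → ℝ)) : ℝ :=
  ∫ s in (0:ℝ)..1, Real.sqrt (∑ i, ∑ j, G (γ s) i j * deriv γ s i * deriv γ s j)

/-- Riemannian distance: infimum of lengths of C¹ paths. -/
def riemDist (G : (Fin n → ℝ) → Matrix (Fin n) (Fin n) ℝ)
    (x y : Fin n → ℝ) : ℝ :=
  sInf {L : ℝ | ∃ γ : ℝ → (Fin n → ℝ),
    ContDiffOn ℝ 1 γ (Icc 0 1) ∧ γ 0 = x ∧ γ 1 = y ∧ L = pathLength G γ}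

/-- Metric ball. -/
def rBall (G : (Fin n → ℝ) → Matrix (Fin n) (Fin n) ℝ)
    (x₀ : Fin n → ℝ) (r : ℝ) : Set (Fin n → ℝ) :=
  {x | riemDist G x₀ x < r}

/-- Completeness of `(ℝⁿ, riemDist G)`. -/
def riemComplete (G : (Fin n → ℝ) → Matrix (Fin n) (Fin n) ℝ) : Prop :=
  ∀ u : ℕ → (Fin n → ℝ),
    (∀ ε > (0:ℝ), ∃ N, ∀ p ≥ N, ∀ q ≥ N, riemDist G (u p) (u q) < ε) →
    ∃ x, ∀ ε > (0:ℝ), ∃ N, ∀ p ≥ N, riemDist G (u p) x < ε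

/-- Riemannian volume of a set. -/
def riemVol (G : (Fin n → ℝ) → Matrix (Fin n) (Fin n) ℝ)
    (S : Set (Fin n → ℝ)) : ℝ :=
  ∫ x in S, Real.sqrt ((G x).det)

/-- A smooth (time-independent) Riemannian metric. -/
def SmoothMetric (G : (Fin n → ℝ) → Matrix (Fin n) (Fin n) ℝ) : Prop :=
  (∀ i j, ContDiff ℝ (⊤ : ℕ∞) (fun x => G x i j)) ∧ ∀ x, (G x).IsSymm ∧ (G x).PosDef

/-- A smooth time-dependent metric over the time interval `I`. -/
def SmoothMetricFamily (g : (Fin n → ℝ) → ℝ → Matrix (Fin n) (Fin n) ℝ)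
    (I : Set ℝ) : Prop :=
  (∀ i j, ContDiffOn ℝ (⊤ : ℕ∞) (fun p : (Fin n → ℝ) × ℝ => g p.1 p.2 i j) (univ ×ˢ I)) ∧
  ∀ x : Fin n → ℝ, ∀ t ∈ I, (g x t).IsSymm ∧ (g x t).PosDef

/-- The Ricci flow equation `∂ₜ g = -2 Ric` over the time interval `I`. -/
def IsRicciFlow (g : (Fin n → ℝ) → ℝ → Matrix (Fin n) (Fin n) ℝ)
    (I : Set ℝ) : Prop :=
  ∀ x : Fin n → ℝ, ∀ t ∈ I, ∀ j k,
    derivWithin (fun s => g x s j k) I t = -2 * ricci (fun y => g y t) x j k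

/-- `lam ≥ mu ≥ nu` are the eigenvalues of the 3×3 matrix `M`
(characterized via the characteristic polynomial). -/
def IsEigTriple (M : Matrix (Fin 3) (Fin 3) ℝ) (lam mu nu : ℝ) : Prop :=
  nu ≤ mu ∧ mu ≤ lam ∧
  ∀ z : ℝ, (z • (1 : Matrix (Fin 3) (Fin 3) ℝ) - M).det = (z - lam) * (z - mu) * (z - nu)

/-- Hamilton's curvature operator `g^{il}(R g_{lj} - 2 R_{lj})` in dimension 3. -/
def curvOp (G : (Fin 3 → ℝ) → Matrix (Fin 3) (Fin 3) ℝ) (x : Fin 3 → ℝ) :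
    Matrix (Fin 3) (Fin 3) ℝ :=
  Matrix.of fun i j => ∑ l, (G x)⁻¹ i l * (scalarCurv G x * G x l j - 2 * ricci G x l j)

open scoped ContDiff Topology
set_option linter.unusedSectionVars false
set_option linter.unusedSimpArgs false

section Connection

variable {E W W' : Type*} [NormedAddCommGroup E] [NormedSpace ℝ E]
  [NormedAddCommGroup W] [NormedSpace ℝ W] [NormedAddCommGroup W'] [NormedSpace ℝ W']

/-- Covariant derivative, in a spatial direction, of a section of the tensor bundle on which
endomorphisms act through `ρ`. -/
def cov (Γ : E × ℝ → E →L[ℝ] E →L[ℝ] E) (ρ : (E →L[ℝ] E) →L[ℝ] W →L[ℝ] W) (X : E)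
    (s : E × ℝ → W) (q : E × ℝ) : W :=
  fderiv ℝ s q (X, 0) + ρ (Γ q X) (s q)

/-- Second covariant derivative. -/
def covTwo (Γ : E × ℝ → E →L[ℝ] E →L[ℝ] E) (ρ : (E →L[ℝ] E) →L[ℝ] W →L[ℝ] W) (X Y : E)
    (s : E × ℝ → W) (q : E × ℝ) : W :=
  cov Γ ρ X (cov Γ ρ Y s) q - cov Γ ρ (Γ q X Y) s q

/-- Curvature endomorphism of the connection `Γ`. -/
def curvEnd (Γ : E × ℝ → E →L[ℝ] E →L[ℝ] E) (q : E × ℝ) (X Y : E) : E →L[ℝ] E :=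
  fderiv ℝ Γ q (X, 0) Y - fderiv ℝ Γ q (Y, 0) X + (Γ q X ∘L Γ q Y - Γ q Y ∘L Γ q X)

theorem contDiffAt_fderiv_apply {P : Type*} [NormedAddCommGroup P] [NormedSpace ℝ P]
    {s : P → W} {q : P} (hs : ContDiffAt ℝ ∞ s q) (v : P) :
    ContDiffAt ℝ ∞ (fun z => fderiv ℝ s z v) q :=
  (hs.fderiv_right (m := ∞) (by simp)).clm_apply contDiffAt_const

theorem fderiv_fderiv_comm {P : Type*} [NormedAddCommGroup P] [NormedSpace ℝ P]
    {s : P → W} {q : P} (hs : ContDiffAt ℝ ∞ s q) (v w : P) :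
    fderiv ℝ (fun z => fderiv ℝ s z v) q w = fderiv ℝ (fun z => fderiv ℝ s z w) q v := by
  have h1 : DifferentiableAt ℝ (fderiv ℝ s) q :=
    (hs.fderiv_right (m := ∞) (by simp)).differentiableAt (by simp)
  have h2 : IsSymmSndFDerivAt ℝ s q := hs.isSymmSndFDerivAt
    (by rw [minSmoothness_of_isRCLikeNormedField]; exact WithTop.coe_le_coe.2 le_top)
  rw [fderiv_clm_apply h1 (by fun_prop), fderiv_clm_apply h1 (by fun_prop)]
  simpa using h2 w v

variable {Γ : E × ℝ → E →L[ℝ] E →L[ℝ] E} {ρ : (E →L[ℝ] E) →L[ℝ] W →L[ℝ] W}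
  {ρ' : (E →L[ℝ] E) →L[ℝ] W' →L[ℝ] W'} {q : E × ℝ} {s : E × ℝ → W}

theorem ContDiffAt.cov (hΓ : ContDiffAt ℝ ∞ Γ q) (hs : ContDiffAt ℝ ∞ s q) (X : E) :
    ContDiffAt ℝ ∞ (cov Γ ρ X s) q := by
  unfold _root_.cov
  have h1 := contDiffAt_fderiv_apply hs (X, 0)
  have h2 : ContDiffAt ℝ ∞ (fun z => ρ (Γ z X) (s z)) q :=
    (ρ.contDiff.contDiffAt.comp q (hΓ.clm_apply contDiffAt_const)).clm_apply hs
  exact h1.add h2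

theorem cov_add_dir (X Y : E) :
    cov Γ ρ (X + Y) s q = cov Γ ρ X s q + cov Γ ρ Y s q := by
  unfold cov
  have : ((X + Y, 0) : E × ℝ) = (X, 0) + (Y, 0) := by simp
  rw [this]; simp only [map_add, _root_.add_apply]; abel

theorem cov_smul_dir (c : ℝ) (X : E) : cov Γ ρ (c • X) s q = c • cov Γ ρ X s q := by
  unfold cov
  have : ((c • X, 0) : E × ℝ) = c • (X, 0) := by simp
  rw [this]; simp only [map_smul, _root_.smul_apply, smul_add]

theorem covTwo_comm (hρ : ∀ B C, ρ (B ∘L C - C ∘L B) = ρ B ∘L ρ C - ρ C ∘L ρ B)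
    (hΓ : ContDiffAt ℝ ∞ Γ q) (hsymm : ∀ X Y, Γ q X Y = Γ q Y X)
    (hs : ContDiffAt ℝ ∞ s q) (X Y : E) :
    covTwo Γ ρ X Y s q - covTwo Γ ρ Y X s q = ρ (curvEnd Γ q X Y) (s q) := by
  have key : ∀ X Y : E, cov Γ ρ X (cov Γ ρ Y s) q =
      fderiv ℝ (fun z => fderiv ℝ s z (Y, 0)) q (X, 0)
        + (ρ (fderiv ℝ Γ q (X, 0) Y) (s q) + ρ (Γ q Y) (fderiv ℝ s q (X, 0)))
        + (ρ (Γ q X) (fderiv ℝ s q (Y, 0)) + ρ (Γ q X) (ρ (Γ q Y) (s q))) := by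
    intro X Y
    have hd1 : DifferentiableAt ℝ (fun z => fderiv ℝ s z (Y, 0)) q :=
      (contDiffAt_fderiv_apply hs _).differentiableAt (by simp)
    have hG : HasFDerivAt Γ (fderiv ℝ Γ q) q := (hΓ.differentiableAt (by simp)).hasFDerivAt
    have hS : HasFDerivAt s (fderiv ℝ s q) q := (hs.differentiableAt (by simp)).hasFDerivAt
    have h2 := ((ρ.hasFDerivAt (x := Γ q Y)).comp q
      (hG.clm_apply (hasFDerivAt_const Y q))).clm_apply hS
    have h3 := hd1.hasFDerivAt.add h2
    have h4 : fderiv ℝ (cov Γ ρ Y s) q = _ := h3.fderiv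
    rw [cov, h4]
    simp [cov]
    abel
  rw [covTwo, covTwo, key, key, fderiv_fderiv_comm hs (Y, 0) (X, 0), hsymm X Y]
  have := congrArg (fun L => L (s q)) (hρ (Γ q X) (Γ q Y))
  simp only [_root_.sub_apply, ContinuousLinearMap.comp_apply] at this
  rw [curvEnd, map_add, _root_.add_apply, this]
  simp only [map_sub, _root_.sub_apply]
  abel

theorem cov_intertwine (L : W →L[ℝ] W') (hL : ∀ B w, L (ρ B w) = ρ' B (L w))
    (hs : DifferentiableAt ℝ s q) (X : E) :
    cov Γ ρ' X (fun z => L (s z)) q = L (cov Γ ρ X s q) := by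
  have h := (L.hasFDerivAt (x := s q)).comp q hs.hasFDerivAt
  have h' : fderiv ℝ (fun z => L (s z)) q = _ := h.fderiv
  rw [cov, h', cov, map_add, hL]; simp

theorem cov_congr {s s' : E × ℝ → W} (h : s =ᶠ[nhds q] s') (X : E) :
    cov Γ ρ X s q = cov Γ ρ X s' q := by
  rw [cov, cov, h.fderiv_eq, h.eq_of_nhds]

theorem covTwo_intertwine (L : W →L[ℝ] W') (hL : ∀ B w, L (ρ B w) = ρ' B (L w))
    (hs : ∀ᶠ z in nhds q, DifferentiableAt ℝ s z) (hΓ : ContDiffAt ℝ ∞ Γ q)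
    (hsq : ContDiffAt ℝ ∞ s q) (X Y : E) :
    covTwo Γ ρ' X Y (fun z => L (s z)) q = L (covTwo Γ ρ X Y s q) := by
  have h1 : cov Γ ρ' Y (fun z => L (s z)) =ᶠ[nhds q] fun z => L (cov Γ ρ Y s z) := by
    filter_upwards [hs] with z hz using cov_intertwine L hL hz Y
  rw [covTwo, cov_congr h1, cov_intertwine L hL ((hΓ.cov hsq Y).differentiableAt (by simp)),
    cov_intertwine L hL hs.self_of_nhds, covTwo, map_sub]

end Connection

section Tensors

/-- Continuous linear maps, as a type with its own (fast) instances. -/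
def Hom (E W : Type*) [NormedAddCommGroup E] [NormedSpace ℝ E] [NormedAddCommGroup W]
    [NormedSpace ℝ W] : Type _ := E →L[ℝ] W

namespace Hom

variable {E W W' : Type*} [NormedAddCommGroup E] [NormedSpace ℝ E]
  [NormedAddCommGroup W] [NormedSpace ℝ W] [NormedAddCommGroup W'] [NormedSpace ℝ W']

instance : NormedAddCommGroup (Hom E W) := inferInstanceAs (NormedAddCommGroup (E →L[ℝ] W))
instance : NormedSpace ℝ (Hom E W) := inferInstanceAs (NormedSpace ℝ (E →L[ℝ] W))
instance : FunLike (Hom E W) E W := inferInstanceAs (FunLike (E →L[ℝ] W) E W)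
instance [FiniteDimensional ℝ E] [FiniteDimensional ℝ W] : FiniteDimensional ℝ (Hom E W) :=
  inferInstanceAs (FiniteDimensional ℝ (E →L[ℝ] W))
instance : LinearMapClass (Hom E W) ℝ E W :=
  inferInstanceAs (LinearMapClass (E →L[ℝ] W) ℝ E W)

variable (S T : Hom E W) (c : ℝ) (X X' : E)

@[simp] theorem add_apply : (S + T) X = S X + T X := rfl
@[simp] theorem sub_apply : (S - T) X = S X - T X := rfl
@[simp] theorem neg_apply : (-T) X = - T X := rfl
@[simp] theorem smul_apply : (c • T) X = c • T X := rfl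
@[simp] theorem zero_apply : (0 : Hom E W) X = 0 := rfl
@[simp] theorem sum_apply {ι : Type*} (s : Finset ι) (F : ι → Hom E W) :
    (∑ i ∈ s, F i) X = ∑ i ∈ s, F i X :=
  _root_.sum_apply (F := E →L[ℝ] W) s F X

@[ext] theorem ext {S T : Hom E W} (h : ∀ X, S X = T X) : S = T := DFunLike.ext _ _ h

variable (W) in
/-- Evaluation at a vector. -/
def ev (X : E) : Hom E W →L[ℝ] W := ContinuousLinearMap.apply ℝ W X

@[simp] theorem ev_apply : ev W X T = T X := rfl

/-- The identity, as a map from honest continuous linear maps. -/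
def of : (E →L[ℝ] W) →L[ℝ] Hom E W := ContinuousLinearMap.id ℝ (E →L[ℝ] W)

/-- The identity, as a map to honest continuous linear maps. -/
def clm : Hom E W →L[ℝ] (E →L[ℝ] W) := ContinuousLinearMap.id ℝ (E →L[ℝ] W)

@[simp] theorem of_apply (T : E →L[ℝ] W) : of T X = T X := rfl
@[simp] theorem clm_apply : clm T X = T X := rfl

/-- Derivation action of endomorphisms on homomorphisms. -/
def act (ρ : (E →L[ℝ] E) →L[ℝ] W →L[ℝ] W) : (E →L[ℝ] E) →L[ℝ] Hom E W →L[ℝ] Hom E W :=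
  ContinuousLinearMap.precompR E ρ - (ContinuousLinearMap.compL ℝ E E W).flip

@[simp] theorem act_apply (ρ : (E →L[ℝ] E) →L[ℝ] W →L[ℝ] W) (B : E →L[ℝ] E) :
    act ρ B T X = ρ B (T X) - T (B X) := rfl

theorem act_commutator {ρ : (E →L[ℝ] E) →L[ℝ] W →L[ℝ] W}
    (hρ : ∀ B C, ρ (B ∘L C - C ∘L B) = ρ B ∘L ρ C - ρ C ∘L ρ B) (B C : E →L[ℝ] E) :
    act ρ (B ∘L C - C ∘L B) = act ρ B ∘L act ρ C - act ρ C ∘L act ρ B := by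
  ext T X
  have := congrArg (fun L => L (T X)) (hρ B C)
  simp only [_root_.sub_apply, ContinuousLinearMap.comp_apply] at this
  rw [act_apply, this]
  simp only [_root_.sub_apply, sub_apply, ContinuousLinearMap.comp_apply, act_apply, map_sub]
  abel

variable [FiniteDimensional ℝ E]

/-- Linear maps on a finite-dimensional space. -/
def mk (f : E →ₗ[ℝ] W) : Hom E W := LinearMap.toContinuousLinearMap f

@[simp] theorem mk_apply (f : E →ₗ[ℝ] W) : mk f X = f X := rfl

theorem contDiffAt_iff {P : Type*} [NormedAddCommGroup P] [NormedSpace ℝ P] {m : ℕ∞ω}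
    {F : P → Hom E W} {q : P} :
    ContDiffAt ℝ m F q ↔ ∀ X, ContDiffAt ℝ m (fun z => F z X) q := by
  refine ⟨fun h X => (ev W X).contDiff.contDiffAt.comp q h, fun h => ?_⟩
  let b := Module.finBasis ℝ E
  have hF : F = fun z => ∑ i, of (ContinuousLinearMap.smulRightL ℝ E W
      (LinearMap.toContinuousLinearMap (b.coord i)) (F z (b i))) := by
    funext z; ext X
    rw [sum_apply]
    change _ = ∑ i, b.repr X i • F z (b i)
    simp only [← map_smul, ← map_sum, b.sum_repr]
  rw [hF]
  exact ContDiffAt.sum fun i _ =>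
    (of ∘L ContinuousLinearMap.smulRightL ℝ E W _).contDiff.contDiffAt.comp q (h (b i))

end Hom

variable (E : Type*) [NormedAddCommGroup E] [NormedSpace ℝ E]

/-- Bilinear forms. -/
abbrev Form := Hom E (Hom E ℝ)

/-- Tensors of type `(1,3)`. -/
abbrev Ten := Hom E (Hom E (E →L[ℝ] E))

variable {E}

/-- Commutator of endomorphisms. -/
def actEnd : (E →L[ℝ] E) →L[ℝ] (E →L[ℝ] E) →L[ℝ] (E →L[ℝ] E) :=
  ContinuousLinearMap.compL ℝ E E E - (ContinuousLinearMap.compL ℝ E E E).flip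

@[simp] theorem actEnd_apply (B C : E →L[ℝ] E) : actEnd B C = B ∘L C - C ∘L B := rfl

theorem actEnd_commutator (B C : E →L[ℝ] E) : (actEnd (B ∘L C - C ∘L B)) =
    actEnd B ∘L actEnd C - actEnd C ∘L actEnd B := by
  ext T X; simp; abel

/-- Derivation action of endomorphisms on bilinear forms. -/
def actForm : (E →L[ℝ] E) →L[ℝ] Form E →L[ℝ] Form E := Hom.act (Hom.act 0)

/-- Derivation action of endomorphisms on tensors of type `(1,3)`. -/
def actTen : (E →L[ℝ] E) →L[ℝ] Ten E →L[ℝ] Ten E :=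
  Hom.act (Hom.act actEnd)

theorem actForm_apply (B : E →L[ℝ] E) (S : Form E) (X Y : E) :
    actForm B S X Y = - S X (B Y) - S (B X) Y := by simp [actForm]

theorem actTen_apply (B : E →L[ℝ] E) (T : Ten E) (X Y Z : E) :
    actTen B T X Y Z = B (T X Y Z) - T X Y (B Z) - T X (B Y) Z - T (B X) Y Z := by simp [actTen]

theorem actForm_commutator (B C : E →L[ℝ] E) : (actForm (B ∘L C - C ∘L B)) =
    actForm B ∘L actForm C - actForm C ∘L actForm B :=
  Hom.act_commutator (Hom.act_commutator (by simp)) B C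

theorem actTen_commutator (B C : E →L[ℝ] E) : actTen (B ∘L C - C ∘L B) =
    actTen B ∘L actTen C - actTen C ∘L actTen B := by
  exact Hom.act_commutator (Hom.act_commutator actEnd_commutator) B C

variable [FiniteDimensional ℝ E]

/-- The endomorphism `X ↦ T X Y Z`. -/
def Hom.endo (T : Ten E) (Y Z : E) : E →ₗ[ℝ] E where
  toFun X := T X Y Z
  map_add' := by simp
  map_smul' := by simp

/-- Contraction of the first argument of a `(1,3)` tensor with its value. -/
def traceTen : Ten E →L[ℝ] Form E :=
  LinearMap.toContinuousLinearMap
    { toFun := fun T => Hom.mk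
        { toFun := fun Y => Hom.mk
            { toFun := fun Z => LinearMap.trace ℝ E (Hom.endo T Y Z)
              map_add' := fun Z Z' => by rw [← map_add]; congr 1; ext; simp [Hom.endo]
              map_smul' := fun c Z => by rw [← map_smul]; congr 1; ext; simp [Hom.endo] }
          map_add' := fun Y Y' => by
            ext Z; simp only [Hom.mk_apply, LinearMap.coe_mk, AddHom.coe_mk, Hom.add_apply]
            rw [← map_add]; congr 1; ext; simp [Hom.endo]
          map_smul' := fun c Y => by
            ext Z; simp only [Hom.mk_apply, LinearMap.coe_mk, AddHom.coe_mk, Hom.smul_apply]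
            rw [← map_smul]; congr 1; ext; simp [Hom.endo] }
      map_add' := fun T T' => by
        ext Y Z; simp only [Hom.mk_apply, LinearMap.coe_mk, AddHom.coe_mk, Hom.add_apply]
        rw [← map_add]; congr 1
      map_smul' := fun c T => by
        ext Y Z; simp only [Hom.mk_apply, LinearMap.coe_mk, AddHom.coe_mk, Hom.smul_apply]
        rw [← map_smul]; congr 1 }

theorem traceTen_apply (T : Ten E) (Y Z : E) :
    traceTen T Y Z = LinearMap.trace ℝ E (Hom.endo T Y Z) := rfl

theorem traceTen_act (B : E →L[ℝ] E) (T : Ten E) :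
    traceTen (actTen B T) = actForm B (traceTen T) := by
  ext Y Z
  rw [actForm_apply, traceTen_apply, traceTen_apply, traceTen_apply]
  have h1 : Hom.endo (actTen B T) Y Z = B.toLinearMap * Hom.endo T Y Z
      - Hom.endo T Y (B Z) - Hom.endo T (B Y) Z - Hom.endo T Y Z * B.toLinearMap := by
    ext X; simp [Hom.endo, actTen_apply]
  rw [h1]
  simp only [map_sub]
  rw [LinearMap.trace_mul_comm]; ring

end Tensors

section Leibniz

variable {P E W : Type*} [NormedAddCommGroup P] [NormedSpace ℝ P]
  [NormedAddCommGroup E] [NormedSpace ℝ E] [NormedAddCommGroup W] [NormedSpace ℝ W]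

theorem Hom.hasFDerivAt_apply {T : P → Hom E W} {u : P → E} {q : P}
    (hT : DifferentiableAt ℝ T q) (hu : DifferentiableAt ℝ u q) :
    HasFDerivAt (fun z => T z (u z))
      ((fderiv ℝ (fun z => Hom.clm (T z)) q).flip (u q) + Hom.clm (T q) ∘L fderiv ℝ u q) q := by
  have h1 : DifferentiableAt ℝ (fun z => Hom.clm (T z)) q :=
    (Hom.clm (E := E) (W := W)).differentiableAt.comp q hT
  have := h1.hasFDerivAt.clm_apply hu.hasFDerivAt
  rw [add_comm]
  exact this

theorem Hom.fderiv_apply {T : P → Hom E W} {u : P → E} {q : P}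
    (hT : DifferentiableAt ℝ T q) (hu : DifferentiableAt ℝ u q) (v : P) :
    fderiv ℝ (fun z => T z (u z)) q v = fderiv ℝ T q v (u q) + T q (fderiv ℝ u q v) := by
  rw [(Hom.hasFDerivAt_apply hT hu).fderiv]
  have h1 : fderiv ℝ (fun z => Hom.clm (T z)) q = Hom.clm ∘L fderiv ℝ T q :=
    ((Hom.clm (E := E) (W := W)).hasFDerivAt.comp q hT.hasFDerivAt).fderiv
  rw [h1]; rfl

theorem Hom.differentiableAt_apply {T : P → Hom E W} {u : P → E} {q : P}
    (hT : DifferentiableAt ℝ T q) (hu : DifferentiableAt ℝ u q) :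
    DifferentiableAt ℝ (fun z => T z (u z)) q := (Hom.hasFDerivAt_apply hT hu).differentiableAt

theorem Hom.fderiv_eval {T : P → Hom E W} {q : P} (hT : DifferentiableAt ℝ T q) (X : E) (v : P) :
    fderiv ℝ (fun z => T z X) q v = fderiv ℝ T q v X := by
  rw [Hom.fderiv_apply hT (differentiableAt_const X)]; simp

variable {Γ : E × ℝ → E →L[ℝ] E →L[ℝ] E} {ρ : (E →L[ℝ] E) →L[ℝ] W →L[ℝ] W} {q : E × ℝ}

theorem cov_act_apply {T : E × ℝ → Hom E W} (hT : DifferentiableAt ℝ T q) (X Y : E) :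
    cov Γ (Hom.act ρ) X T q Y = cov Γ ρ X (fun z => T z Y) q - T q (Γ q X Y) := by
  rw [cov, cov, Hom.fderiv_eval hT]; simp; abel

/-- The curvature tensor. -/
def curv [FiniteDimensional ℝ E] (Γ : E × ℝ → E →L[ℝ] E →L[ℝ] E) (q : E × ℝ) : Ten E :=
  Hom.mk
    { toFun := fun X => Hom.mk
        { toFun := fun Y => curvEnd Γ q X Y
          map_add' := fun Y Y' => by
            have : ((Y + Y', 0) : E × ℝ) = (Y, 0) + (Y', 0) := by simp
            simp only [curvEnd, this, map_add, _root_.add_apply, ContinuousLinearMap.comp_add,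
              ContinuousLinearMap.add_comp]; abel
          map_smul' := fun c Y => by
            have : ((c • Y, 0) : E × ℝ) = c • (Y, 0) := by simp
            simp only [curvEnd, this, map_smul, _root_.smul_apply, ContinuousLinearMap.comp_smul,
              ContinuousLinearMap.smul_comp, smul_add, smul_sub, RingHom.id_apply] }
      map_add' := fun Y Y' => by
        ext1 X
        have : ((Y + Y', 0) : E × ℝ) = (Y, 0) + (Y', 0) := by simp
        simp only [curvEnd, this, map_add, _root_.add_apply, ContinuousLinearMap.comp_add,
          ContinuousLinearMap.add_comp, Hom.add_apply, Hom.mk_apply, LinearMap.coe_mk,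
          AddHom.coe_mk]; abel
      map_smul' := fun c Y => by
        ext1 X
        have : ((c • Y, 0) : E × ℝ) = c • (Y, 0) := by simp
        simp only [curvEnd, this, map_smul, _root_.smul_apply, ContinuousLinearMap.comp_smul,
          ContinuousLinearMap.smul_comp, smul_add, smul_sub, RingHom.id_apply,
          Hom.smul_apply, Hom.mk_apply, LinearMap.coe_mk, AddHom.coe_mk] }

variable [FiniteDimensional ℝ E]

theorem curv_apply (X Y : E) : curv Γ q X Y = curvEnd Γ q X Y := rfl

theorem contDiffAt_curvEnd (hΓ : ContDiffAt ℝ ∞ Γ q) (X Y : E) :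
    ContDiffAt ℝ ∞ (fun z => curvEnd Γ z X Y) q := by
  have h1 := fun v : E × ℝ => contDiffAt_fderiv_apply hΓ v
  have h2 := fun v : E => hΓ.clm_apply (contDiffAt_const (c := v))
  exact (((h1 _).clm_apply contDiffAt_const).sub ((h1 _).clm_apply contDiffAt_const)).add
    (((h2 X).clm_comp (h2 Y)).sub ((h2 Y).clm_comp (h2 X)))

theorem contDiffAt_curv (hΓ : ContDiffAt ℝ ∞ Γ q) : ContDiffAt ℝ ∞ (curv Γ) q :=
  Hom.contDiffAt_iff.2 fun X => Hom.contDiffAt_iff.2 fun Y => contDiffAt_curvEnd hΓ X Y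

end Leibniz

section Curvature

variable {E : Type*} [NormedAddCommGroup E] [NormedSpace ℝ E]  [FiniteDimensional ℝ E]

/-- Smooth metric with its Levi-Civita connection near every point of `Ω`. -/
structure MetricOn (Ω : Set (E × ℝ)) (g : E × ℝ → Form E) (Γ : E × ℝ → E →L[ℝ] E →L[ℝ] E) :
    Prop where
  isOpen : IsOpen Ω
  smooth_metric : ∀ z ∈ Ω, ContDiffAt ℝ ∞ g z
  smooth_conn : ∀ z ∈ Ω, ContDiffAt ℝ ∞ Γ z
  symm : ∀ z ∈ Ω, ∀ X Y, g z X Y = g z Y X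
  pos : ∀ z ∈ Ω, ∀ X, X ≠ 0 → 0 < g z X X
  torsion : ∀ z ∈ Ω, ∀ X Y, Γ z X Y = Γ z Y X
  compat : ∀ z ∈ Ω, ∀ X Y Z, fderiv ℝ g z (X, 0) Y Z = g z (Γ z X Y) Z + g z Y (Γ z X Z)

/-- Algebraic symmetries of a curvature tensor. -/
structure IsCurvLike (G : Form E) (T : Ten E) : Prop where
  anti : ∀ X Y Z, T X Y Z = - T Y X Z
  bianchi : ∀ X Y Z, T X Y Z + T Y Z X + T Z X Y = 0
  skew : ∀ X Y Z W, G (T X Y Z) W = - G Z (T X Y W)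

theorem IsCurvLike.pair {G : Form E} {T : Ten E} (h : IsCurvLike G T)
    (hG : ∀ X Y, G X Y = G Y X) (X Y Z W : E) : G (T X Y Z) W = G (T Z W X) Y := by
  have b : ∀ X Y Z W, G (T X Y Z) W + G (T Y Z X) W + G (T Z X Y) W = 0 := fun X Y Z W => by
    have := congrArg (fun v => G v W) (h.bianchi X Y Z)
    simpa using this
  have a : ∀ X Y Z W, G (T X Y Z) W = - G (T Y X Z) W := fun X Y Z W => by
    rw [h.anti X Y Z]; simp
  have s : ∀ X Y Z W, G (T X Y Z) W = - G (T X Y W) Z := fun X Y Z W => by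
    rw [h.skew, hG]
  linarith [b X Y Z W, b Y Z W X, b Z W X Y, b W X Y Z, a X Y Z W, a X Y W Z, a Z W X Y, s X Y Z W,
    s Z W X Y, s Y Z X W, s Y Z W X, s Z X Y W, s Z X W Y, s X Y W Z, s W X Y Z, s W X Z Y, a W X Y Z, a Z X Y W,a Y Z X W,
    s Y W Z X, s Y W X Z, a Y W Z X, a W Y Z X, a X Z W Y, a X Z Y W, s X Z W Y, s Z W Y X, a X W Y Z, a W Y X Z]

variable {Ω : Set (E × ℝ)} {g : E × ℝ → Form E} {Γ : E × ℝ → E →L[ℝ] E →L[ℝ] E}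

namespace MetricOn
variable (M : MetricOn Ω g Γ)
include M

theorem nhds_mem {q : E × ℝ} (hq : q ∈ Ω) : ∀ᶠ z in 𝓝 q, z ∈ Ω := M.isOpen.mem_nhds hq

theorem cov_metric {q : E × ℝ} (hq : q ∈ Ω) (X : E) : cov Γ actForm X g q = 0 := by
  ext Y Z
  simp only [cov, Hom.add_apply, M.compat q hq, actForm_apply, Hom.zero_apply]; ring

theorem fderiv_eq_zero {W : Type*} [NormedAddCommGroup W] [NormedSpace ℝ W] {f : E × ℝ → W}
    (hf : ∀ z ∈ Ω, f z = 0) {q : E × ℝ} (hq : q ∈ Ω) : fderiv ℝ f q = 0 := by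
  have : f =ᶠ[𝓝 q] fun _ => 0 := by
    filter_upwards [M.nhds_mem hq] with z hz using hf z hz
  rw [this.fderiv_eq]; simp

theorem fderiv_conn_symm {q : E × ℝ} (hq : q ∈ Ω) (v : E × ℝ) (X Y : E) :
    fderiv ℝ Γ q v X Y = fderiv ℝ Γ q v Y X := by
  have hd := (M.smooth_conn q hq).differentiableAt (by simp)
  have e : ∀ X Y, fderiv ℝ (fun z => Γ z X Y) q v = fderiv ℝ Γ q v X Y := fun X Y => by
    have h1 : DifferentiableAt ℝ (fun z => Γ z X) q := hd.clm_apply (by fun_prop)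
    rw [fderiv_clm_apply h1 (by fun_prop)]
    rw [fderiv_clm_apply hd (by fun_prop)]; simp
  have h0 : (fun z => Γ z X Y) =ᶠ[𝓝 q] fun z => Γ z Y X := by
    filter_upwards [M.nhds_mem hq] with z hz using M.torsion z hz X Y
  rw [← e, ← e, h0.fderiv_eq]

theorem isCurvLike_curv {q : E × ℝ} (hq : q ∈ Ω) : IsCurvLike (g q) (curv Γ q) where
  anti X Y Z := by simp [curv_apply, curvEnd]; abel
  bianchi X Y Z := by
    simp only [curv_apply, curvEnd, _root_.add_apply, _root_.sub_apply,
      ContinuousLinearMap.comp_apply]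
    rw [M.fderiv_conn_symm hq (X, 0) Z Y, M.fderiv_conn_symm hq (Y, 0) Z X,
      M.fderiv_conn_symm hq (Z, 0) Y X, M.torsion q hq Y Z, M.torsion q hq X Z, M.torsion q hq X Y]
    abel
  skew X Y Z W := by
    have h := covTwo_comm (Γ := Γ) (ρ := actForm) actForm_commutator (M.smooth_conn q hq)
      (M.torsion q hq) (M.smooth_metric q hq) X Y
    have h0 : ∀ X Y, covTwo Γ actForm X Y g q = 0 := fun X Y => by
      have h1 : cov Γ actForm Y g =ᶠ[𝓝 q] fun _ => 0 := by
        filter_upwards [M.nhds_mem hq] with z hz using M.cov_metric hz Y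
      rw [covTwo, M.cov_metric hq, cov_congr h1]; simp [cov]
    rw [h0, h0] at h
    have h2 := congrArg (fun S : Form E => S Z W) h
    simp only [actForm_apply, sub_self, Hom.zero_apply, ← curv_apply] at h2
    linarith


theorem differentiableAt_curv {q : E × ℝ} (hq : q ∈ Ω) : DifferentiableAt ℝ (curv Γ) q :=
  (contDiffAt_curv (M.smooth_conn q hq)).differentiableAt (by simp)

theorem isCurvLike_cov {T : E × ℝ → Ten E} (hT : ∀ z ∈ Ω, DifferentiableAt ℝ T z)
    (h : ∀ z ∈ Ω, IsCurvLike (g z) (T z)) {q : E × ℝ} (hq : q ∈ Ω) (V : E) :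
    IsCurvLike (g q) (cov Γ actTen V T q) := by
  have hd := hT q hq
  have hd2 : ∀ X Y, DifferentiableAt ℝ (fun z => T z X Y) q := fun X Y =>
    (Hom.differentiableAt_apply (Hom.differentiableAt_apply hd (by fun_prop)) (by fun_prop))
  have hd3 : ∀ X Y Z, DifferentiableAt ℝ (fun z => T z X Y Z) q := fun X Y Z =>
    (hd2 X Y).clm_apply (by fun_prop)
  have e : ∀ X Y Z, fderiv ℝ (fun z => T z X Y Z) q (V, 0) = fderiv ℝ T q (V, 0) X Y Z := by
    intro X Y Z
    rw [fderiv_clm_apply (hd2 X Y) (by fun_prop)]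
    have h1 : DifferentiableAt ℝ (fun z => T z X) q := Hom.differentiableAt_apply hd (by fun_prop)
    have := Hom.fderiv_eval h1 Y (V, 0)
    simp [this, Hom.fderiv_eval hd]
  have ga : ∀ X Y Z, fderiv ℝ T q (V, 0) X Y Z = - fderiv ℝ T q (V, 0) Y X Z := by
    intro X Y Z
    have := M.fderiv_eq_zero (f := fun z => T z X Y Z + T z Y X Z)
      (fun z hz => by rw [(h z hz).anti X Y Z]; simp) hq
    rw [fderiv_fun_add (hd3 _ _ _) (hd3 _ _ _)] at this
    have := congrArg (fun L => L (V, 0)) this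
    simp only [_root_.add_apply, e, _root_.zero_apply] at this
    exact eq_neg_of_add_eq_zero_left this
  refine ⟨fun X Y Z => ?_, fun X Y Z => ?_, fun X Y Z W => ?_⟩
  · simp only [cov, Hom.add_apply, _root_.add_apply, actTen_apply, ga X Y Z]
    rw [(h q hq).anti X Y Z, (h q hq).anti X Y, (h q hq).anti X (Γ q V Y),
      (h q hq).anti (Γ q V X) Y]
    simp only [map_neg]; abel
  · have := M.fderiv_eq_zero (f := fun z => T z X Y Z + T z Y Z X + T z Z X Y)
      (fun z hz => (h z hz).bianchi X Y Z) hq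
    rw [fderiv_fun_add ((hd3 _ _ _).fun_add (hd3 _ _ _)) (hd3 _ _ _),
      fderiv_fun_add (hd3 _ _ _) (hd3 _ _ _)] at this
    have := congrArg (fun L => L (V, 0)) this
    simp only [_root_.add_apply, e, _root_.zero_apply] at this
    have b0 := congrArg (Γ q V) ((h q hq).bianchi X Y Z)
    have b1 := (h q hq).bianchi (Γ q V X) Y Z
    have b2 := (h q hq).bianchi X (Γ q V Y) Z
    have b3 := (h q hq).bianchi X Y (Γ q V Z)
    simp only [map_add, map_zero] at b0
    simp only [cov, Hom.add_apply, _root_.add_apply, actTen_apply]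
    have := congr($this + $b0 - $b1 - $b2 - $b3)
    simp only [sub_zero, add_zero] at this
    rw [← this]; abel
  · have hg : DifferentiableAt ℝ g q := (M.smooth_metric q hq).differentiableAt (by simp)
    have := M.fderiv_eq_zero (f := fun z => g z (T z X Y Z) W + g z Z (T z X Y W))
      (fun z hz => by rw [(h z hz).skew X Y Z W]; simp) hq
    have d1 : DifferentiableAt ℝ (fun z => g z (T z X Y Z)) q :=
      Hom.differentiableAt_apply hg (hd3 _ _ _)
    have d2 : DifferentiableAt ℝ (fun z => g z Z) q :=
      Hom.differentiableAt_apply hg (by fun_prop)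
    rw [fderiv_fun_add (Hom.differentiableAt_apply d1 (by fun_prop))
      (Hom.differentiableAt_apply d2 (hd3 _ _ _))] at this
    have := congrArg (fun L => L (V, 0)) this
    simp only [_root_.add_apply, Hom.fderiv_eval d1, Hom.fderiv_apply hg (hd3 X Y Z),
      Hom.fderiv_apply d2 (hd3 X Y W), Hom.fderiv_eval hg, e, _root_.zero_apply,
      Hom.add_apply, M.compat q hq] at this
    have s0 := (h q hq).skew X Y Z (Γ q V W)
    have s1 := (h q hq).skew (Γ q V X) Y Z W
    have s2 := (h q hq).skew X (Γ q V Y) Z W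
    have s3 := (h q hq).skew X Y (Γ q V Z) W
    simp only [cov, Hom.add_apply, _root_.add_apply, actTen_apply, map_add, map_sub, Hom.sub_apply]
    linarith

end MetricOn
end Curvature

section Bianchi
variable {E : Type*} [NormedAddCommGroup E] [NormedSpace ℝ E]  [FiniteDimensional ℝ E]
variable {Ω : Set (E × ℝ)} {g : E × ℝ → Form E} {Γ : E × ℝ → E →L[ℝ] E →L[ℝ] E}

theorem cov_ten_apply {T : E × ℝ → Ten E} {q : E × ℝ} (hT : DifferentiableAt ℝ T q) (V X Y : E) :
    cov Γ actTen V T q X Y =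
      cov Γ actEnd V (fun z => T z X Y) q - T q (Γ q V X) Y - T q X (Γ q V Y) := by
  have h1 : DifferentiableAt ℝ (fun z => T z X) q := Hom.differentiableAt_apply hT (by fun_prop)
  rw [actTen, cov_act_apply hT, Hom.sub_apply, cov_act_apply h1]
  abel

theorem fderiv_curvEnd {q : E × ℝ} (hΓ : ContDiffAt ℝ ∞ Γ q) (X Y : E) (v : E × ℝ) :
    fderiv ℝ (fun z => curvEnd Γ z X Y) q v =
      fderiv ℝ (fun z => fderiv ℝ Γ z (X, 0)) q v Y - fderiv ℝ (fun z => fderiv ℝ Γ z (Y, 0)) q v X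
      + (Γ q X ∘L fderiv ℝ Γ q v Y + fderiv ℝ Γ q v X ∘L Γ q Y
        - (Γ q Y ∘L fderiv ℝ Γ q v X + fderiv ℝ Γ q v Y ∘L Γ q X)) := by
  have h1 : ∀ w : E × ℝ, HasFDerivAt (fun z => fderiv ℝ Γ z w) _ q := fun w =>
    ((contDiffAt_fderiv_apply hΓ w).differentiableAt (by simp)).hasFDerivAt
  have h0 : HasFDerivAt Γ _ q := (hΓ.differentiableAt (by simp)).hasFDerivAt
  have h2 := fun X : E => h0.clm_apply (hasFDerivAt_const X q)
  have h3 := fun (w : E × ℝ) (X : E) => (h1 w).clm_apply (hasFDerivAt_const X q)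
  have h4 := ((h3 (X, 0) Y).sub (h3 (Y, 0) X)).add
    (((h2 X).clm_comp (h2 Y)).sub ((h2 Y).clm_comp (h2 X)))
  have h5 : fderiv ℝ (fun z => curvEnd Γ z X Y) q = _ := h4.fderiv
  rw [h5]
  simp

namespace MetricOn
variable (M : MetricOn Ω g Γ)
include M

theorem cov_curv_bianchi {q : E × ℝ} (hq : q ∈ Ω) (X Y Z : E) :
    cov Γ actTen X (curv Γ) q Y Z + cov Γ actTen Y (curv Γ) q Z X
      + cov Γ actTen Z (curv Γ) q X Y = 0 := by
  have hc := M.smooth_conn q hq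
  have c1 : ∀ X Y Z : E, fderiv ℝ (fun z => fderiv ℝ Γ z (X, 0)) q (Y, 0) Z =
      fderiv ℝ (fun z => fderiv ℝ Γ z (Y, 0)) q (X, 0) Z := fun X Y Z => by
    rw [fderiv_fderiv_comm hc]
  have d := M.differentiableAt_curv hq
  rw [cov_ten_apply d, cov_ten_apply d, cov_ten_apply d]
  simp only [curv_apply, cov, fderiv_curvEnd hc, actEnd_apply]
  have a : ∀ X Y, curvEnd Γ q X Y = - curvEnd Γ q Y X := fun X Y => by
    rw [curvEnd, curvEnd]; abel
  rw [M.torsion q hq Y X, M.torsion q hq Z X, M.torsion q hq Z Y, a X (Γ q Y Z), a Y (Γ q X Z),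
    a Z (Γ q X Y), c1 Y X Z, c1 Z X Y, c1 Z Y X]
  simp only [curvEnd, ContinuousLinearMap.comp_add, ContinuousLinearMap.comp_sub,
    ContinuousLinearMap.add_comp, ContinuousLinearMap.sub_comp, ← ContinuousLinearMap.comp_assoc]
  abel

theorem differentiableAt_cov_curv {q : E × ℝ} (hq : q ∈ Ω) (X : E) :
    DifferentiableAt ℝ (cov Γ actTen X (curv Γ)) q :=
  ((M.smooth_conn q hq).cov (contDiffAt_curv (M.smooth_conn q hq)) X).differentiableAt (by simp)

theorem covTwo_curv_bianchi {q : E × ℝ} (hq : q ∈ Ω) (V X Y Z : E) :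
    covTwo Γ actTen V X (curv Γ) q Y Z + covTwo Γ actTen V Y (curv Γ) q Z X
      + covTwo Γ actTen V Z (curv Γ) q X Y = 0 := by
  have hd := fun X => M.differentiableAt_cov_curv hq X
  have hd2 : ∀ X Y Z, DifferentiableAt ℝ (fun z => cov Γ actTen X (curv Γ) z Y Z) q := fun X Y Z =>
    (Hom.differentiableAt_apply (Hom.differentiableAt_apply (hd X) (by fun_prop)) (by fun_prop))
  have h0 := M.fderiv_eq_zero (fun z hz => M.cov_curv_bianchi hz X Y Z) hq
  rw [fderiv_fun_add ((hd2 _ _ _).fun_add (hd2 _ _ _)) (hd2 _ _ _),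
      fderiv_fun_add (hd2 _ _ _) (hd2 _ _ _)] at h0
  have h0 := congrArg (fun L => L (V, 0)) h0
  have h1 := congrArg (actEnd (Γ q V)) (M.cov_curv_bianchi hq X Y Z)
  have b1 := M.cov_curv_bianchi hq (Γ q V X) Y Z
  have b2 := M.cov_curv_bianchi hq X (Γ q V Y) Z
  have b3 := M.cov_curv_bianchi hq X Y (Γ q V Z)
  simp only [_root_.add_apply, _root_.zero_apply] at h0
  simp only [map_add, map_zero] at h1
  simp only [covTwo, Hom.sub_apply, cov_ten_apply (hd _)]
  have e : ∀ f, cov Γ actEnd V f q = fderiv ℝ f q (V, 0) + actEnd (Γ q V) (f q) := fun _ => rfl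
  simp only [e]
  have := congr($h0 + $h1 - $b1 - $b2 - $b3)
  simp only [sub_zero, add_zero] at this
  rw [← this]; abel

theorem isCurvLike_covTwo {q : E × ℝ} (hq : q ∈ Ω) (V W : E) :
    IsCurvLike (g q) (covTwo Γ actTen V W (curv Γ) q) := by
  have h1 : ∀ W, ∀ z ∈ Ω, IsCurvLike (g z) (cov Γ actTen W (curv Γ) z) := fun W z hz =>
    M.isCurvLike_cov (fun z hz => M.differentiableAt_curv hz) (fun z hz => M.isCurvLike_curv hz) hz W
  have h2 := M.isCurvLike_cov (fun z hz => M.differentiableAt_cov_curv hz W) (h1 W) hq V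
  have h3 := h1 (Γ q V W) q hq
  refine ⟨fun X Y Z => ?_, fun X Y Z => ?_, fun X Y Z W => ?_⟩
  · simp only [covTwo, Hom.sub_apply, _root_.sub_apply, h2.anti X Y Z, h3.anti X Y Z]; abel
  · have := congr($(h2.bianchi X Y Z) - $(h3.bianchi X Y Z))
    rw [sub_zero] at this
    simp only [covTwo, Hom.sub_apply, _root_.sub_apply]; rw [← this]; abel
  · simp only [covTwo, Hom.sub_apply, _root_.sub_apply, map_sub, h2.skew X Y Z W,
      h3.skew X Y Z W]; abel

theorem covTwo_curv_comm {q : E × ℝ} (hq : q ∈ Ω) (V W : E) :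
    covTwo Γ actTen V W (curv Γ) q = covTwo Γ actTen W V (curv Γ) q
      + actTen (curv Γ q V W) (curv Γ q) := by
  rw [curv_apply, ← covTwo_comm actTen_commutator (M.smooth_conn q hq) (M.torsion q hq)
    (contDiffAt_curv (M.smooth_conn q hq))]; abel

end MetricOn
end Bianchi

section Evolution
variable {E : Type*} [NormedAddCommGroup E] [NormedSpace ℝ E] [FiniteDimensional ℝ E]
variable {Ω : Set (E × ℝ)} {g : E × ℝ → Form E} {Γ : E × ℝ → E →L[ℝ] E →L[ℝ] E}

theorem covTwo_congr {W : Type*} [NormedAddCommGroup W] [NormedSpace ℝ W]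
    {ρ : (E →L[ℝ] E) →L[ℝ] W →L[ℝ] W} {s s' : E × ℝ → W} {q : E × ℝ} (h : s =ᶠ[𝓝 q] s') (X Y : E) :
    covTwo Γ ρ X Y s q = covTwo Γ ρ X Y s' q := by
  have h1 : cov Γ ρ Y s =ᶠ[𝓝 q] cov Γ ρ Y s' := by
    filter_upwards [h.eventuallyEq_nhds] with z hz using cov_congr hz Y
  rw [covTwo, covTwo, cov_congr h1, cov_congr h]

/-- Covariant derivative of the time derivative of the connection. -/
def covDot (Γ : E × ℝ → E →L[ℝ] E →L[ℝ] E) (q : E × ℝ) (V X Y : E) : E :=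
  fderiv ℝ (fun z => fderiv ℝ Γ z (0, 1)) q (V, 0) X Y + Γ q V (fderiv ℝ Γ q (0, 1) X Y)
    - fderiv ℝ Γ q (0, 1) X (Γ q V Y) - fderiv ℝ Γ q (0, 1) (Γ q V X) Y

namespace MetricOn
variable (M : MetricOn Ω g Γ)
include M

theorem cov_dot_metric {q : E × ℝ} (hq : q ∈ Ω) (X Y Z : E) :
    cov Γ actForm X (fun z => fderiv ℝ g z (0, 1)) q Y Z =
      g q (fderiv ℝ Γ q (0, 1) X Y) Z + g q Y (fderiv ℝ Γ q (0, 1) X Z) := by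
  have hg := M.smooth_metric q hq
  have hΓ := M.smooth_conn q hq
  have dg : DifferentiableAt ℝ g q := hg.differentiableAt (by simp)
  have dΓ : DifferentiableAt ℝ Γ q := hΓ.differentiableAt (by simp)
  have dX := (contDiffAt_fderiv_apply hg (X, 0)).differentiableAt (by simp)
  have dXY := Hom.differentiableAt_apply dX (differentiableAt_const Y)
  have dΓX : DifferentiableAt ℝ (fun z => Γ z X) q := dΓ.clm_apply (by fun_prop)
  have dΓXY : ∀ Y, DifferentiableAt ℝ (fun z => Γ z X Y) q := fun Y => dΓX.clm_apply (by fun_prop)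
  have e1 : ∀ Y v, fderiv ℝ (fun z => Γ z X Y) q v = fderiv ℝ Γ q v X Y := fun Y v => by
    rw [fderiv_clm_apply dΓX (by fun_prop), fderiv_clm_apply dΓ (by fun_prop)]; simp
  have d1 := Hom.differentiableAt_apply dg (dΓXY Y)
  have d2 := Hom.differentiableAt_apply dg (differentiableAt_const Y)
  have h0 := M.fderiv_eq_zero (f := fun z => (fderiv ℝ g z (X, 0) Y Z - g z (Γ z X Y) Z)
      - g z Y (Γ z X Z)) (fun z hz => by rw [M.compat z hz]; ring) hq
  have d3 := Hom.differentiableAt_apply dXY (differentiableAt_const Z)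
  have d4 := Hom.differentiableAt_apply d1 (differentiableAt_const Z)
  have d5 := Hom.differentiableAt_apply d2 (dΓXY Z)
  rw [fderiv_fun_sub (d3.fun_sub d4) d5, fderiv_fun_sub d3 d4] at h0
  have h0 := congrArg (fun L => L (0, 1)) h0
  simp only [_root_.sub_apply, _root_.zero_apply, Hom.fderiv_eval dXY, Hom.fderiv_eval dX,
    Hom.fderiv_eval d1, Hom.fderiv_apply dg (dΓXY Y), Hom.fderiv_apply d2 (dΓXY Z), e1,
    Hom.fderiv_eval dg, Hom.add_apply, fderiv_fderiv_comm hg (X, 0) (0, 1)] at h0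
  simp only [cov, Hom.add_apply, actForm_apply]
  linarith

theorem covTwo_dot_metric {q : E × ℝ} (hq : q ∈ Ω) (V X Y Z : E) :
    covTwo Γ actForm V X (fun z => fderiv ℝ g z (0, 1)) q Y Z =
      g q (covDot Γ q V X Y) Z + g q Y (covDot Γ q V X Z) := by
  have hg := M.smooth_metric q hq
  have hΓ := M.smooth_conn q hq
  have dg : DifferentiableAt ℝ g q := hg.differentiableAt (by simp)
  have dA := (contDiffAt_fderiv_apply hΓ (0, 1)).differentiableAt (by simp)
  have dF : DifferentiableAt ℝ (cov Γ actForm X (fun z => fderiv ℝ g z (0, 1))) q :=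
    (hΓ.cov (contDiffAt_fderiv_apply hg (0, 1)) X).differentiableAt (by simp)
  have dFY := Hom.differentiableAt_apply dF (differentiableAt_const Y)
  have dAX : DifferentiableAt ℝ (fun z => fderiv ℝ Γ z (0, 1) X) q := dA.clm_apply (by fun_prop)
  have dAXY : ∀ Y, DifferentiableAt ℝ (fun z => fderiv ℝ Γ z (0, 1) X Y) q :=
    fun Y => dAX.clm_apply (by fun_prop)
  have e1 : ∀ Y v, fderiv ℝ (fun z => fderiv ℝ Γ z (0, 1) X Y) q v =
      fderiv ℝ (fun z => fderiv ℝ Γ z (0, 1)) q v X Y := fun Y v => by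
    rw [fderiv_clm_apply dAX (by fun_prop), fderiv_clm_apply dA (by fun_prop)]; simp
  have d1 := Hom.differentiableAt_apply dg (dAXY Y)
  have d2 := Hom.differentiableAt_apply dg (differentiableAt_const Y)
  have h0 := M.fderiv_eq_zero (f := fun z => (cov Γ actForm X (fun z => fderiv ℝ g z (0, 1)) z Y Z
      - g z (fderiv ℝ Γ z (0, 1) X Y) Z) - g z Y (fderiv ℝ Γ z (0, 1) X Z))
      (fun z hz => by rw [M.cov_dot_metric hz]; ring) hq
  have d3 := Hom.differentiableAt_apply dFY (differentiableAt_const Z)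
  have d4 := Hom.differentiableAt_apply d1 (differentiableAt_const Z)
  have d5 := Hom.differentiableAt_apply d2 (dAXY Z)
  rw [fderiv_fun_sub (d3.fun_sub d4) d5, fderiv_fun_sub d3 d4] at h0
  have h0 := congrArg (fun L => L (V, 0)) h0
  simp only [_root_.sub_apply, _root_.zero_apply, Hom.fderiv_eval dFY, Hom.fderiv_eval dF,
    Hom.fderiv_eval d1, Hom.fderiv_apply dg (dAXY Y), Hom.fderiv_apply d2 (dAXY Z), e1,
    Hom.fderiv_eval dg, Hom.add_apply, M.compat q hq] at h0
  have e : ∀ f : E × ℝ → Form E, cov Γ actForm V f q =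
    fderiv ℝ f q (V, 0) + actForm (Γ q V) (f q) := fun _ => rfl
  simp only [covTwo, Hom.sub_apply, M.cov_dot_metric hq, e, Hom.add_apply, actForm_apply, covDot,
    map_add, map_sub]
  linarith

theorem covDot_symm {q : E × ℝ} (hq : q ∈ Ω) (V X Y : E) : covDot Γ q V X Y = covDot Γ q V Y X := by
  have hΓ := M.smooth_conn q hq
  have dA := (contDiffAt_fderiv_apply hΓ ((0, 1) : E × ℝ)).differentiableAt (by simp)
  have dAX : ∀ X : E, DifferentiableAt ℝ (fun z => fderiv ℝ Γ z (0, 1) X) q :=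
    fun X => dA.clm_apply (by fun_prop)
  have e1 : ∀ (X Y : E) (v : E × ℝ), fderiv ℝ (fun z => fderiv ℝ Γ z (0, 1) X Y) q v =
      fderiv ℝ (fun z => fderiv ℝ Γ z (0, 1)) q v X Y := fun X Y v => by
    rw [fderiv_clm_apply (dAX X) (by fun_prop), fderiv_clm_apply dA (by fun_prop)]; simp
  have h0 : (fun z => fderiv ℝ Γ z (0, 1) X Y) =ᶠ[𝓝 q] fun z => fderiv ℝ Γ z (0, 1) Y X := by
    filter_upwards [M.nhds_mem hq] with z hz using M.fderiv_conn_symm hz (0, 1) X Y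
  have h1 := congrArg (fun L : E × ℝ →L[ℝ] E => L (V, 0)) (h0.fderiv_eq (𝕜 := ℝ))
  simp only [e1] at h1
  rw [covDot, covDot, h1, M.fderiv_conn_symm hq (0, 1) X Y, M.fderiv_conn_symm hq (0, 1) X (Γ q V Y),
    M.fderiv_conn_symm hq (0, 1) (Γ q V X) Y]
  abel

theorem koszul_covDot {q : E × ℝ} (hq : q ∈ Ω) (V X Y Z : E) :
    2 * g q (covDot Γ q V X Y) Z = covTwo Γ actForm V X (fun z => fderiv ℝ g z (0, 1)) q Y Z
      + covTwo Γ actForm V Y (fun z => fderiv ℝ g z (0, 1)) q X Z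
      - covTwo Γ actForm V Z (fun z => fderiv ℝ g z (0, 1)) q X Y := by
  simp only [M.covTwo_dot_metric hq]
  rw [M.covDot_symm hq V Z X, M.covDot_symm hq V Z Y, M.covDot_symm hq V Y X,
    M.symm q hq X (covDot Γ q V Y Z), M.symm q hq Y (covDot Γ q V X Z)]
  ring

theorem dot_curv {q : E × ℝ} (hq : q ∈ Ω) (X Y Z : E) :
    fderiv ℝ (curv Γ) q (0, 1) X Y Z = covDot Γ q X Y Z - covDot Γ q Y X Z := by
  have hΓ := M.smooth_conn q hq
  have d := M.differentiableAt_curv hq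
  have d1 := Hom.differentiableAt_apply d (differentiableAt_const X)
  have h := fderiv_curvEnd hΓ X Y (0, 1)
  have h1 : fderiv ℝ (fun z => curvEnd Γ z X Y) q (0, 1) = fderiv ℝ (curv Γ) q (0, 1) X Y := by
    rw [← Hom.fderiv_eval d, ← Hom.fderiv_eval d1]; rfl
  rw [← h1, h, fderiv_fderiv_comm hΓ (X, 0) (0, 1), fderiv_fderiv_comm hΓ (Y, 0) (0, 1)]
  simp only [_root_.add_apply, _root_.sub_apply, ContinuousLinearMap.comp_apply, covDot,
    M.torsion q hq Y X]
  abel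

end MetricOn

/-- Orthonormal basis for a symmetric bilinear form. -/
def IsONB {ι : Type*} [DecidableEq ι] (G : Form E) (e : Module.Basis ι ℝ E) : Prop :=
  ∀ a b, G (e a) (e b) = if a = b then 1 else 0

section Frame
variable {ι : Type*} [Fintype ι] [DecidableEq ι] {G : Form E} {e : Module.Basis ι ℝ E}

theorem IsONB.repr_eq (h : IsONB G e) (v : E) (b : ι) : e.repr v b = G v (e b) := by
  conv_rhs => rw [← e.sum_repr v]
  have h' : ∀ a b, G (e a) (e b) = if a = b then 1 else 0 := h
  simp only [map_sum, map_smul, Hom.sum_apply, Hom.smul_apply, h']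
  simp

theorem IsONB.sum_eq (h : IsONB G e) (v : E) : ∑ b, G v (e b) • e b = v := by
  simp only [← h.repr_eq]; exact e.sum_repr v

theorem IsONB.trace_eq (h : IsONB G e) (L : E →ₗ[ℝ] E) :
    LinearMap.trace ℝ E L = ∑ a, G (L (e a)) (e a) := by
  rw [LinearMap.trace_eq_matrix_trace ℝ e, Matrix.trace]
  exact Finset.sum_congr rfl fun a _ => by
    rw [Matrix.diag_apply, LinearMap.toMatrix_apply, h.repr_eq]

theorem IsONB.traceTen_eq (h : IsONB G e) (T : Ten E) (Y Z : E) :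
    traceTen T Y Z = ∑ a, G (T (e a) Y Z) (e a) := by rw [traceTen_apply, h.trace_eq]; rfl

theorem IsCurvLike.trace_symm {T : Ten E} (hT : IsCurvLike G T) (hG : ∀ X Y, G X Y = G Y X)
    (h : IsONB G e) (Y Z : E) : traceTen T Y Z = traceTen T Z Y := by
  rw [h.traceTen_eq, h.traceTen_eq]
  refine Finset.sum_congr rfl fun a _ => ?_
  rw [hT.pair hG, hT.anti Z, map_neg, Hom.neg_apply, hT.skew, hG (e a), neg_neg]

theorem IsONB.abs_actTen_le (h : IsONB G e) {T : Ten E} {u : ℝ}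
    (hu : ∀ a b c d, |G (T (e a) (e b) (e c)) (e d)| ≤ u) (a b c d i j : ι) :
    |G (actTen (T (e a) (e b)) T (e c) (e d) (e i)) (e j)| ≤ 4 * (Fintype.card ι * u ^ 2) := by
  have u0 : 0 ≤ u := (abs_nonneg _).trans (hu a a a a)
  have key : ∀ f f' : ι → ℝ, (∀ k, |f k| ≤ u) → (∀ k, |f' k| ≤ u) →
      |∑ k, f k * f' k| ≤ Fintype.card ι * u ^ 2 := fun f f' hf hf' => by
    refine (Finset.abs_sum_le_sum_abs _ _).trans ?_
    rw [← nsmul_eq_mul, ← Finset.card_univ]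
    refine Finset.sum_le_card_nsmul _ _ _ fun k _ => ?_
    rw [abs_mul, pow_two]; exact mul_le_mul (hf k) (hf' k) (abs_nonneg _) u0
  have k1 := key (fun k => G (T (e c) (e d) (e i)) (e k)) (fun k => G (T (e a) (e b) (e k)) (e j))
    (fun k => hu ..) (fun k => hu ..)
  have k2 := key (fun k => G (T (e a) (e b) (e i)) (e k)) (fun k => G (T (e c) (e d) (e k)) (e j))
    (fun k => hu ..) (fun k => hu ..)
  have k3 := key (fun k => G (T (e a) (e b) (e d)) (e k)) (fun k => G (T (e c) (e k) (e i)) (e j))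
    (fun k => hu ..) (fun k => hu ..)
  have k4 := key (fun k => G (T (e a) (e b) (e c)) (e k)) (fun k => G (T (e k) (e d) (e i)) (e j))
    (fun k => hu ..) (fun k => hu ..)
  have x1 : G (T (e a) (e b) (T (e c) (e d) (e i))) (e j) =
      ∑ k, G (T (e c) (e d) (e i)) (e k) * G (T (e a) (e b) (e k)) (e j) := by
    conv_lhs => rw [← h.sum_eq (T (e c) (e d) (e i))]
    simp only [map_sum, map_smul, Hom.sum_apply, Hom.smul_apply, smul_eq_mul]
  have x2 : G (T (e c) (e d) (T (e a) (e b) (e i))) (e j) =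
      ∑ k, G (T (e a) (e b) (e i)) (e k) * G (T (e c) (e d) (e k)) (e j) := by
    conv_lhs => rw [← h.sum_eq (T (e a) (e b) (e i))]
    simp only [map_sum, map_smul, Hom.sum_apply, Hom.smul_apply, smul_eq_mul]
  have x3 : G (T (e c) (T (e a) (e b) (e d)) (e i)) (e j) =
      ∑ k, G (T (e a) (e b) (e d)) (e k) * G (T (e c) (e k) (e i)) (e j) := by
    conv_lhs => rw [← h.sum_eq (T (e a) (e b) (e d))]
    simp only [map_sum, map_smul, Hom.sum_apply, Hom.smul_apply, _root_.sum_apply,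
      _root_.smul_apply, smul_eq_mul]
  have x4 : G (T (T (e a) (e b) (e c)) (e d) (e i)) (e j) =
      ∑ k, G (T (e a) (e b) (e c)) (e k) * G (T (e k) (e d) (e i)) (e j) := by
    conv_lhs => rw [← h.sum_eq (T (e a) (e b) (e c))]
    simp only [map_sum, map_smul, Hom.sum_apply, Hom.smul_apply, _root_.sum_apply,
      _root_.smul_apply, smul_eq_mul]
  rw [actTen_apply]
  simp only [map_sub, Hom.sub_apply, x1, x2, x3, x4]
  rw [abs_le] at *
  constructor <;> linarith [k1.1, k1.2, k2.1, k2.2, k3.1, k3.2, k4.1, k4.2]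

end Frame

namespace MetricOn
variable (M : MetricOn Ω g Γ)
include M

theorem abs_evolution_le (hfl : ∀ z ∈ Ω, fderiv ℝ g z (0, 1) = (-2 : ℝ) • traceTen (curv Γ z))
    {ι : Type*} [Fintype ι] [DecidableEq ι] {e : Module.Basis ι ℝ E} {q : E × ℝ} (hq : q ∈ Ω)
    (h : IsONB (g q) e) {u : ℝ}
    (hu : ∀ a b c d, |g q (curv Γ q (e a) (e b) (e c)) (e d)| ≤ u) (i j k l : ι) :
    |g q (fderiv ℝ (curv Γ) q (0, 1) (e i) (e j) (e k)) (e l)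
      - ∑ a, g q (covTwo Γ actTen (e a) (e a) (curv Γ) q (e i) (e j) (e k)) (e l)|
      ≤ 12 * (Fintype.card ι) ^ 2 * u ^ 2 := by
  set c : E → E → Form E := fun V W => traceTen (covTwo Γ actTen V W (curv Γ) q) with hc
  have hsymm := M.symm q hq
  have hcT := fun V W => M.isCurvLike_covTwo hq V W
  have cs : ∀ V W Y Z, c V W Y Z = c V W Z Y := fun V W Y Z => (hcT V W).trace_symm hsymm h Y Z
  have hh : ∀ V W, covTwo Γ actForm V W (fun z => fderiv ℝ g z (0, 1)) q = (-2 : ℝ) • c V W := by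
    intro V W
    have h1 : (fun z => fderiv ℝ g z (0, 1)) =ᶠ[𝓝 q]
        fun z => ((-2 : ℝ) • traceTen (E := E)) (curv Γ z) := by
      filter_upwards [M.nhds_mem hq] with z hz using hfl z hz
    rw [covTwo_congr h1, covTwo_intertwine ((-2 : ℝ) • traceTen (E := E)) (ρ := actTen) _ _
      (M.smooth_conn q hq) (contDiffAt_curv (M.smooth_conn q hq))]
    · rfl
    · intro B w; simp [traceTen_act]
    · filter_upwards [M.nhds_mem hq] with z hz using M.differentiableAt_curv hz
  have h1 : g q (fderiv ℝ (curv Γ) q (0, 1) (e i) (e j) (e k)) (e l) =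
      - (c (e i) (e j) (e k) (e l) - c (e j) (e i) (e k) (e l) + c (e i) (e k) (e j) (e l)
        - c (e i) (e l) (e j) (e k) - c (e j) (e k) (e i) (e l) + c (e j) (e l) (e i) (e k)) := by
    have a1 := M.koszul_covDot hq (e i) (e j) (e k) (e l)
    have a2 := M.koszul_covDot hq (e j) (e i) (e k) (e l)
    simp only [hh, Hom.smul_apply, smul_eq_mul] at a1 a2
    rw [M.dot_curv hq, map_sub, Hom.sub_apply]
    linarith
  -- commutator of the Ricci tensor
  have h2 : c (e i) (e j) (e k) (e l) - c (e j) (e i) (e k) (e l) =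
      ∑ a, g q (actTen (curv Γ q (e i) (e j)) (curv Γ q) (e a) (e k) (e l)) (e a) := by
    rw [← h.traceTen_eq, hc]; simp only
    rw [M.covTwo_curv_comm hq (e i) (e j), map_add]; simp
  have hl : ∀ X Y Z W, ∑ a, g q (covTwo Γ actTen X (e a) (curv Γ) q Y (e a) Z) W =
      c X Z W Y - c X W Z Y := by
    intro X Y Z W
    rw [hc]; simp only [h.traceTen_eq, ← Finset.sum_sub_distrib]
    refine Finset.sum_congr rfl fun a _ => ?_
    have b := M.covTwo_curv_bianchi hq X (e a) Z W
    have b1 := congrArg (fun L : E →L[ℝ] E => g q (L Y) (e a)) b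
    simp only [_root_.add_apply, map_add, Hom.add_apply, _root_.zero_apply, map_zero,
      Hom.zero_apply] at b1
    have b2 := congrArg (fun v => g q v (e a)) ((hcT X Z).anti W (e a) Y)
    simp only [map_neg, Hom.neg_apply] at b2
    rw [(hcT X (e a)).pair hsymm]
    linarith
  have ht : ∀ a, g q (covTwo Γ actTen (e a) (e a) (curv Γ) q (e i) (e j) (e k)) (e l) =
      - g q (covTwo Γ actTen (e i) (e a) (curv Γ) q (e j) (e a) (e k)) (e l)
      - g q (actTen (curv Γ q (e a) (e i)) (curv Γ q) (e j) (e a) (e k)) (e l)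
      + g q (covTwo Γ actTen (e j) (e a) (curv Γ) q (e i) (e a) (e k)) (e l)
      - g q (actTen (curv Γ q (e a) (e j)) (curv Γ q) (e a) (e i) (e k)) (e l) := by
    intro a
    have b := M.covTwo_curv_bianchi hq (e a) (e a) (e i) (e j)
    have b1 := congrArg (fun L : E →L[ℝ] E => g q (L (e k)) (e l)) b
    rw [M.covTwo_curv_comm hq (e a) (e i), M.covTwo_curv_comm hq (e a) (e j)] at b1
    have b2 := congrArg (fun v => g q v (e l)) ((hcT (e j) (e a)).anti (e i) (e a) (e k))
    simp only [_root_.add_apply, map_add, Hom.add_apply, _root_.zero_apply, map_zero,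
      Hom.zero_apply, map_neg, Hom.neg_apply] at b1 b2
    linarith
  have h3 : g q (fderiv ℝ (curv Γ) q (0, 1) (e i) (e j) (e k)) (e l)
      - ∑ a, g q (covTwo Γ actTen (e a) (e a) (curv Γ) q (e i) (e j) (e k)) (e l) =
      ∑ a, (g q (actTen (curv Γ q (e a) (e i)) (curv Γ q) (e j) (e a) (e k)) (e l)
        + g q (actTen (curv Γ q (e a) (e j)) (curv Γ q) (e a) (e i) (e k)) (e l)
        - g q (actTen (curv Γ q (e i) (e j)) (curv Γ q) (e a) (e k) (e l)) (e a)) := by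
    simp only [ht, Finset.sum_add_distrib, Finset.sum_sub_distrib, hl, Finset.sum_neg_distrib]
    rw [h1, ← h2, cs (e i) (e k) (e l) (e j), cs (e j) (e l) (e k), cs (e i) (e l) (e k) (e j),
      cs (e j) (e k) (e l) (e i)]
    ring
  rw [h3]
  refine (Finset.abs_sum_le_sum_abs _ _).trans ?_
  have : ∀ a ∈ Finset.univ, |g q (actTen (curv Γ q (e a) (e i)) (curv Γ q) (e j) (e a) (e k)) (e l)
        + g q (actTen (curv Γ q (e a) (e j)) (curv Γ q) (e a) (e i) (e k)) (e l)
        - g q (actTen (curv Γ q (e i) (e j)) (curv Γ q) (e a) (e k) (e l)) (e a)|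
      ≤ 3 * (4 * (Fintype.card ι * u ^ 2)) := fun a _ => by
    have k1 := h.abs_actTen_le hu a i j a k l
    have k2 := h.abs_actTen_le hu a j a i k l
    have k3 := h.abs_actTen_le hu i j a k l a
    rw [abs_le] at *
    constructor <;> linarith [k1.1, k1.2, k2.1, k2.2, k3.1, k3.2]
  refine (Finset.sum_le_card_nsmul _ _ _ this).trans_eq ?_
  rw [nsmul_eq_mul, Finset.card_univ]; ring

end MetricOn
end Evolution

section LinearODE
variable {ι : Type*} [Fintype ι]

/-- Coordinatewise truncation. -/
def clamp (R : ℝ) (x : ι → ℝ) : ι → ℝ := fun i => max (-R) (min R (x i))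

theorem lipschitz_clamp (R : ℝ) : LipschitzWith 1 (clamp (ι := ι) R) := by
  refine LipschitzWith.of_dist_le_mul fun x y => ?_
  rw [NNReal.coe_one, one_mul]
  refine (dist_pi_le_iff dist_nonneg).2 fun i => ?_
  refine le_trans ?_ (dist_le_pi_dist x y i)
  have := (LipschitzWith.id.const_min R).const_max (-R)
  simpa [clamp] using this.dist_le_mul (x i) (y i)

theorem clamp_eq {R : ℝ} {x : ι → ℝ} (h : ‖x‖ ≤ R) : clamp R x = x := by
  funext i
  have := abs_le.1 ((norm_le_pi_norm x i).trans h)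
  rw [clamp, min_eq_right this.2, max_eq_right this.1]

theorem norm_clamp_le {R : ℝ} (hR : 0 ≤ R) (x : ι → ℝ) : ‖clamp R x‖ ≤ R := by
  refine (pi_norm_le_iff_of_nonneg hR).2 fun i => ?_
  rw [Real.norm_eq_abs, abs_le, clamp]
  exact ⟨le_max_left _ _, max_le (by linarith) (min_le_left _ _)⟩

theorem norm_clamp_le_norm {R : ℝ} (hR : 0 ≤ R) (x : ι → ℝ) : ‖clamp R x‖ ≤ ‖x‖ := by
  have h0 : clamp R (0 : ι → ℝ) = 0 := clamp_eq (by simpa using hR)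
  have := (lipschitz_clamp R).dist_le_mul x 0
  simpa [h0] using this

/-- Linear initial value problems are solvable on any interval of continuity. -/
theorem exists_linear_ode {A : ℝ → (ι → ℝ) →L[ℝ] (ι → ℝ)} {t₀ r : ℝ} (hr : 0 < r)
    (hA : ContinuousOn A (Icc (t₀ - r) (t₀ + r))) (y₀ : ι → ℝ) :
    ∃ y : ℝ → ι → ℝ, y t₀ = y₀ ∧ ∀ t ∈ Ioo (t₀ - r) (t₀ + r), HasDerivAt y (A t (y t)) t := by
  obtain ⟨a, ha⟩ := isCompact_Icc.exists_bound_of_continuousOn hA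
  have ha0 : 0 ≤ a := (norm_nonneg _).trans (ha t₀ (by constructor <;> linarith))
  set R := ‖y₀‖ * Real.exp (a * r) with hR
  have hR0 : 0 ≤ R := by positivity
  have hP : IsPicardLindelof (fun t x => A t (clamp R x))
      (⟨t₀, by constructor <;> linarith⟩ : Icc (t₀ - r) (t₀ + r)) y₀
      ⟨a * R * r, by positivity⟩ 0 ⟨a * R, by positivity⟩ ⟨a, ha0⟩ := by
    constructor
    · intro t ht
      refine LipschitzWith.lipschitzOnWith ?_
      refine LipschitzWith.of_dist_le_mul fun x y => ?_
      rw [dist_eq_norm, ← map_sub]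
      refine ((A t).le_opNorm _).trans ?_
      refine mul_le_mul (ha t ht) ?_ (norm_nonneg _) ha0
      have := (lipschitz_clamp R).dist_le_mul x y
      rwa [NNReal.coe_one, one_mul, dist_eq_norm] at this
    · intro x _
      exact hA.clm_apply continuousOn_const
    · intro t ht x _
      refine ((A t).le_opNorm _).trans ?_
      exact mul_le_mul (ha t ht) (norm_clamp_le hR0 x) (norm_nonneg _) ha0
    · simp only [add_sub_cancel_left, sub_sub_cancel, max_self, NNReal.coe_zero, sub_zero]
      exact le_rfl
  obtain ⟨y, hy0, hy⟩ := hP.exists_eq_forall_mem_Icc_hasDerivWithinAt₀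
  simp only at hy0
  have hyc : ContinuousOn y (Icc (t₀ - r) (t₀ + r)) := fun t ht => (hy t ht).continuousWithinAt
  have hd : ∀ t ∈ Ioo (t₀ - r) (t₀ + r), HasDerivAt y (A t (clamp R (y t))) t := fun t ht =>
    (hy t (Ioo_subset_Icc_self ht)).hasDerivAt (Icc_mem_nhds ht.1 ht.2)
  have hb : ∀ t ∈ Icc (t₀ - r) (t₀ + r), ‖A t (clamp R (y t))‖ ≤ a * ‖y t‖ + 0 := fun t ht => by
    rw [add_zero]
    exact ((A t).le_opNorm _).trans
      (mul_le_mul (ha t ht) (norm_clamp_le_norm hR0 _) (norm_nonneg _) ha0)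
  have hexp : ∀ s, s ≤ r → gronwallBound ‖y₀‖ a 0 s ≤ R := fun s hs => by
    rw [gronwallBound_ε0, hR]
    gcongr
  have hbd : ∀ t ∈ Ioo (t₀ - r) (t₀ + r), ‖y t‖ ≤ R := by
    intro t ht
    rcases le_total t₀ t with h | h
    · refine (norm_le_gronwallBound_of_norm_deriv_right_le (δ := ‖y₀‖) (a := t₀) (b := t)
        (hyc.mono (Icc_subset_Icc (by linarith) ht.2.le))
        (fun x hx => (hd x ⟨by linarith [hx.1], by linarith [hx.2, ht.2]⟩).hasDerivWithinAt)
        (by rw [hy0]) (fun x hx => hb x ⟨by linarith [hx.1], by linarith [hx.2, ht.2]⟩)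
        t ⟨h, le_rfl⟩).trans (hexp _ (by linarith [ht.2]))
    · have hz : ∀ x ∈ Icc (-t₀) (-t), -x ∈ Ioo (t₀ - r) (t₀ + r) := fun x hx =>
        ⟨by linarith [hx.2, ht.1], by linarith [hx.1]⟩
      have hd' : ∀ x ∈ Icc (-t₀) (-t), HasDerivAt (fun s => y (-s)) (-A (-x) (clamp R (y (-x)))) x :=
        fun x hx => by
          have := HasDerivAt.scomp x (hd (-x) (hz x hx)) (hasDerivAt_neg x)
          rw [neg_one_smul] at this; exact this
      have := norm_le_gronwallBound_of_norm_deriv_right_le (f := fun s => y (-s)) (δ := ‖y₀‖)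
        (a := -t₀) (b := -t)
        (fun x hx => (hd' x hx).continuousAt.continuousWithinAt)
        (fun x hx => (hd' x (Ico_subset_Icc_self hx)).hasDerivWithinAt)
        (by simp [hy0])
        (fun x hx => by
          rw [norm_neg]; exact hb _ (Ioo_subset_Icc_self (hz x (Ico_subset_Icc_self hx))))
        (-t) ⟨by linarith, le_rfl⟩
      rw [neg_neg] at this
      exact this.trans (hexp _ (by linarith [ht.1]))
  exact ⟨y, hy0, fun t ht => by simpa only [clamp_eq (hbd t ht)] using hd t ht⟩

end LinearODE

section AlongCurves

variable {E W : Type*} [NormedAddCommGroup E] [NormedSpace ℝ E] [NormedAddCommGroup W]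
  [NormedSpace ℝ W]

theorem Hom.hasDerivAt_apply {T : ℝ → Hom E W} {T' : Hom E W} {u : ℝ → E} {u' : E} {s : ℝ}
    (hT : HasDerivAt T T' s) (hu : HasDerivAt u u' s) :
    HasDerivAt (fun s => T s (u s)) (T' (u s) + T s u') s :=
  HasDerivAt.clm_apply (c := fun s => (Hom.clm (E := E) (W := W)) (T s))
    (((Hom.clm (E := E) (W := W)).hasFDerivAt.comp_hasDerivAt s hT)) hu

variable [FiniteDimensional ℝ E]

theorem IsONB.exists_of_family {ι : Type*} [Fintype ι] [DecidableEq ι] {G : Form E} {v : ι → E}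
    (hv : ∀ a b, G (v a) (v b) = if a = b then 1 else 0)
    (hc : Fintype.card ι = Module.finrank ℝ E) :
    ∃ e : Module.Basis ι ℝ E, (∀ a, e a = v a) ∧ IsONB G e := by
  have hli : LinearIndependent ℝ v := by
    rw [Fintype.linearIndependent_iff]
    intro c hc b
    have h := congrArg (fun x => G x (v b)) hc
    simp only [map_sum, map_smul, Hom.sum_apply, Hom.smul_apply, hv] at h
    simpa using h
  rcases isEmpty_or_nonempty ι with hι | hι
  · have : Module.finrank ℝ E = 0 := by rw [← hc]; simp
    have := Module.finrank_zero_iff.1 this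
    exact ⟨Module.Basis.empty E, fun a => isEmptyElim a, fun a => isEmptyElim a⟩
  · refine ⟨basisOfLinearIndependentOfCardEqFinrank hli hc, fun a => ?_, fun a b => ?_⟩
    · simp
    · simp [hv]

theorem IsONB.exists {G : Form E} (hs : ∀ X Y, G X Y = G Y X) (hp : ∀ X, X ≠ 0 → 0 < G X X)
    {ι : Type*} [Fintype ι] [DecidableEq ι] (hc : Fintype.card ι = Module.finrank ℝ E) :
    ∃ e : Module.Basis ι ℝ E, IsONB G e := by
  let B : LinearMap.BilinForm ℝ E := LinearMap.mk₂ ℝ (fun X Y => G X Y) (by simp) (by simp)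
    (by simp) (by simp)
  obtain ⟨v, hv⟩ := LinearMap.BilinForm.exists_orthogonal_basis (B := B) ⟨fun X Y => hs X Y⟩
  let σ : ι ≃ Fin (Module.finrank ℝ E) := Fintype.equivFinOfCardEq hc
  have hpos : ∀ a, 0 < G (v a) (v a) := fun a => hp _ (v.ne_zero a)
  obtain ⟨e, -, he⟩ := IsONB.exists_of_family (G := G)
    (v := fun a => (Real.sqrt (G (v (σ a)) (v (σ a))))⁻¹ • v (σ a)) (fun a b => by
      simp only [map_smul, Hom.smul_apply, smul_eq_mul]
      split_ifs with h
      · subst h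
        have := Real.mul_self_sqrt (hpos (σ a)).le
        have h0 : Real.sqrt (G (v (σ a)) (v (σ a))) ≠ 0 := (Real.sqrt_pos.2 (hpos _)).ne'
        field_simp
        rw [pow_two, this]
      · have : G (v (σ a)) (v (σ b)) = 0 := hv (fun h' => h (σ.injective h'))
        rw [this]; simp) hc
  exact ⟨e, he⟩

variable {Ω : Set (E × ℝ)} {g : E × ℝ → Form E} {Γ : E × ℝ → E →L[ℝ] E →L[ℝ] E}
  {c : ℝ → E × ℝ} {s : ℝ}

namespace MetricOn
variable (M : MetricOn Ω g Γ)
include M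

theorem hasDerivAt_metric {w : E × ℝ} (hc : HasDerivAt c w s) (hs : c s ∈ Ω) {X Y : ℝ → E}
    {X' Y' : E} (hX : HasDerivAt X X' s) (hY : HasDerivAt Y Y' s) :
    HasDerivAt (fun s => g (c s) (X s) (Y s))
      (fderiv ℝ g (c s) w (X s) (Y s) + g (c s) X' (Y s) + g (c s) (X s) Y') s := by
  have hg : HasDerivAt (fun s => g (c s)) (fderiv ℝ g (c s) w) s :=
    ((M.smooth_metric _ hs).differentiableAt (by simp)).hasFDerivAt.comp_hasDerivAt s hc
  exact Hom.hasDerivAt_apply (Hom.hasDerivAt_apply hg hX) hY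

theorem hasDerivAt_metric_space {v : E} (hc : HasDerivAt c (v, 0) s) (hs : c s ∈ Ω) {X Y : ℝ → E}
    {X' Y' : E} (hX : HasDerivAt X X' s) (hY : HasDerivAt Y Y' s) :
    HasDerivAt (fun s => g (c s) (X s) (Y s))
      (g (c s) (X' + Γ (c s) v (X s)) (Y s) + g (c s) (X s) (Y' + Γ (c s) v (Y s))) s := by
  convert M.hasDerivAt_metric hc hs hX hY using 1
  rw [M.compat _ hs]; simp only [map_add, Hom.add_apply]; ring

end MetricOn
end AlongCurves

section Frames
variable {ι : Type*} [Fintype ι] [DecidableEq ι]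
variable {Ω : Set ((ι → ℝ) × ℝ)} {g : (ι → ℝ) × ℝ → Form (ι → ℝ)}
  {Γ : (ι → ℝ) × ℝ → (ι → ℝ) →L[ℝ] (ι → ℝ) →L[ℝ] (ι → ℝ)}

theorem eq_of_hasDerivAt_zero {f : ℝ → ℝ} {a b : ℝ} (h : ∀ s ∈ Ioo a b, HasDerivAt f 0 s)
    {s s' : ℝ} (hs : s ∈ Ioo a b) (hs' : s' ∈ Ioo a b) : f s = f s' :=
  (convex_Ioo a b).is_const_of_fderivWithin_eq_zero (𝕜 := ℝ)
    (fun x hx => (h x hx).differentiableAt.differentiableWithinAt)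
    (fun x hx => by
      rw [fderivWithin_of_isOpen isOpen_Ioo hx, (h x hx).hasFDerivAt.fderiv]; ext; simp) hs hs'

/-- Parallel orthonormal frames along a curve at fixed time. -/
theorem MetricOn.exists_parallel (M : MetricOn Ω g Γ) {c v : ℝ → ι → ℝ} {t s₀ r : ℝ} (hr : 0 < r)
    (hc : ∀ s, HasDerivAt c (v s) s) (hv : Continuous v) (hΩ : ∀ s, (c s, t) ∈ Ω)
    {e : Module.Basis ι ℝ (ι → ℝ)} (he : IsONB (g (c s₀, t)) e) :
    ∃ X : ι → ℝ → ι → ℝ, (∀ a, X a s₀ = e a) ∧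
      (∀ a, ∀ s ∈ Ioo (s₀ - r) (s₀ + r), HasDerivAt (X a) (-Γ (c s, t) (v s) (X a s)) s) ∧
      ∀ s ∈ Ioo (s₀ - r) (s₀ + r), ∀ a b, g (c s, t) (X a s) (X b s) = if a = b then 1 else 0 := by
  have hcc : Continuous c := continuous_iff_continuousAt.2 fun s => (hc s).continuousAt
  have hA : Continuous fun s => -Γ (c s, t) (v s) := by
    have : Continuous fun s => Γ (c s, t) := continuous_iff_continuousAt.2 fun s =>
      ContinuousAt.comp (f := fun s => (c s, t)) (M.smooth_conn _ (hΩ s)).continuousAt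
        (hcc.prodMk continuous_const).continuousAt
    exact (this.clm_apply hv).neg
  choose X hX0 hX using fun a => exists_linear_ode hr (t₀ := s₀) hA.continuousOn (e a)
  refine ⟨X, hX0, fun a s hs => by simpa using hX a s hs, fun s hs a b => ?_⟩
  have hd : ∀ s ∈ Ioo (s₀ - r) (s₀ + r),
      HasDerivAt (fun s => g (c s, t) (X a s) (X b s)) 0 s := fun s hs => by
    have := M.hasDerivAt_metric_space (c := fun s => (c s, t)) (v := v s)
      ((hc s).prodMk (hasDerivAt_const s t)) (hΩ s) (hX a s hs) (hX b s hs)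
    simpa using this
  rw [eq_of_hasDerivAt_zero hd hs (s' := s₀) ⟨by linarith, by linarith⟩, hX0, hX0]
  exact he a b

end Frames

section SecondDerivative
variable {E : Type*} [NormedAddCommGroup E] [NormedSpace ℝ E] [FiniteDimensional ℝ E]
variable {Ω : Set (E × ℝ)} {g : E × ℝ → Form E} {Γ : E × ℝ → E →L[ℝ] E →L[ℝ] E}
  {c : ℝ → E × ℝ} {s : ℝ}

theorem hasDerivAt_ten_apply {T : E × ℝ → Ten E} {w : E × ℝ} (hc : HasDerivAt c w s)
    (hT : DifferentiableAt ℝ T (c s)) {X Y Z : ℝ → E} {X' Y' Z' : E} (hX : HasDerivAt X X' s)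
    (hY : HasDerivAt Y Y' s) (hZ : HasDerivAt Z Z' s) :
    HasDerivAt (fun s => T (c s) (X s) (Y s) (Z s))
      (fderiv ℝ T (c s) w (X s) (Y s) (Z s) + T (c s) X' (Y s) (Z s) + T (c s) (X s) Y' (Z s)
        + T (c s) (X s) (Y s) Z') s := by
  have h := Hom.hasDerivAt_apply (Hom.hasDerivAt_apply (hT.hasFDerivAt.comp_hasDerivAt s hc) hX) hY
  have := h.clm_apply hZ
  simp only [Hom.add_apply, _root_.add_apply] at this
  exact this

namespace MetricOn
variable (M : MetricOn Ω g Γ)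
include M

theorem hasDerivAt_ten_parallel {T : E × ℝ → Ten E} {v : E} (hc : HasDerivAt c (v, 0) s)
    (hs : c s ∈ Ω) (hT : DifferentiableAt ℝ T (c s)) {X Y Z V : ℝ → E}
    (hX : HasDerivAt X (-Γ (c s) v (X s)) s) (hY : HasDerivAt Y (-Γ (c s) v (Y s)) s)
    (hZ : HasDerivAt Z (-Γ (c s) v (Z s)) s) (hV : HasDerivAt V (-Γ (c s) v (V s)) s) :
    HasDerivAt (fun s => g (c s) (T (c s) (X s) (Y s) (Z s)) (V s))
      (g (c s) (cov Γ actTen v T (c s) (X s) (Y s) (Z s)) (V s)) s := by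
  convert M.hasDerivAt_metric_space hc hs (hasDerivAt_ten_apply hc hT hX hY hZ) hV using 1
  rw [neg_add_cancel, map_zero, add_zero]
  simp only [cov, Hom.add_apply, _root_.add_apply, actTen_apply, map_neg, Hom.neg_apply,
    _root_.neg_apply, map_add, map_sub, Hom.sub_apply]
  ring

end MetricOn
end SecondDerivative

section Laplacian
variable {ι : Type*} [Fintype ι] [DecidableEq ι]
variable {Ω : Set ((ι → ℝ) × ℝ)} {g : (ι → ℝ) × ℝ → Form (ι → ℝ)}
  {Γ : (ι → ℝ) × ℝ → (ι → ℝ) →L[ℝ] (ι → ℝ) →L[ℝ] (ι → ℝ)}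

/-- The curve with initial velocity `V` that is geodesic to second order. -/
def geo (Γ : (ι → ℝ) × ℝ → (ι → ℝ) →L[ℝ] (ι → ℝ) →L[ℝ] (ι → ℝ)) (x : ι → ℝ) (t : ℝ)
    (V : ι → ℝ) (h : ℝ) : ι → ℝ := x + h • V - (h ^ 2 / 2) • Γ (x, t) V V

theorem hasDerivAt_geo (x : ι → ℝ) (t : ℝ) (V : ι → ℝ) (h : ℝ) :
    HasDerivAt (geo Γ x t V) (V - h • Γ (x, t) V V) h := by
  have h1 := ((hasDerivAt_id h).smul_const V).const_add x
  have h2 := (((hasDerivAt_id h).pow 2).div_const 2).smul_const (Γ (x, t) V V)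
  refine (h1.sub h2).congr_deriv ?_
  simp

/-- Squared norm of a `(1,3)` tensor. -/
def IsCurvNormSq (g : (ι → ℝ) × ℝ → Form (ι → ℝ))
    (Γ : (ι → ℝ) × ℝ → (ι → ℝ) →L[ℝ] (ι → ℝ) →L[ℝ] (ι → ℝ)) (Ω : Set ((ι → ℝ) × ℝ))
    (U : (ι → ℝ) × ℝ → ℝ) : Prop :=
  ∀ z ∈ Ω, ∀ e : Module.Basis ι ℝ (ι → ℝ), IsONB (g z) e →
    U z = ∑ I : ι × ι × ι × ι, g z (curv Γ z (e I.1) (e I.2.1) (e I.2.2.1)) (e I.2.2.2) ^ 2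

theorem IsCurvNormSq.eq_family {U : (ι → ℝ) × ℝ → ℝ} (hU : IsCurvNormSq g Γ Ω U)
    {z : (ι → ℝ) × ℝ} (hz : z ∈ Ω) {v : ι → ι → ℝ}
    (hv : ∀ a b, g z (v a) (v b) = if a = b then 1 else 0) :
    U z = ∑ I : ι × ι × ι × ι, g z (curv Γ z (v I.1) (v I.2.1) (v I.2.2.1)) (v I.2.2.2) ^ 2 := by
  obtain ⟨e, h, he⟩ := IsONB.exists_of_family hv (by simp)
  rw [hU z hz e he]; simp only [h]

theorem MetricOn.le_deriv_deriv (M : MetricOn Ω g Γ) {U : (ι → ℝ) × ℝ → ℝ}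
    (hU : IsCurvNormSq g Γ Ω U) {x : ι → ℝ} {t : ℝ} (hΩ : ∀ y, (y, t) ∈ Ω)
    {e : Module.Basis ι ℝ (ι → ℝ)} (he : IsONB (g (x, t)) e) (V : ι → ℝ) :
    ∑ I : ι × ι × ι × ι,
      2 * (g (x, t) (curv Γ (x, t) (e I.1) (e I.2.1) (e I.2.2.1)) (e I.2.2.2)
        * g (x, t) (covTwo Γ actTen V V (curv Γ) (x, t) (e I.1) (e I.2.1) (e I.2.2.1))
          (e I.2.2.2)) ≤ deriv (deriv fun h => U (geo Γ x t V h, t)) 0 := by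
  set c : ℝ → ι → ℝ := geo Γ x t V with hc
  set N := Γ (x, t) V V with hN
  have c0 : c 0 = x := by simp [hc, geo]
  have hcd : ∀ h, HasDerivAt (fun h => (c h, t)) (V - h • N, 0) h := fun h =>
    (hasDerivAt_geo x t V h).prodMk (hasDerivAt_const h t)
  obtain ⟨X, hX0, hX, hXo⟩ := M.exists_parallel (c := c) (s₀ := 0) one_pos (hasDerivAt_geo x t V)
    (by fun_prop) (fun s => hΩ _) (e := e) (by rwa [c0])
  rw [zero_sub, zero_add] at hX hXo
  have dR := fun y => M.differentiableAt_curv (hΩ y)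
  have hU' : (fun h => U (c h, t)) =ᶠ[𝓝 0] fun h => ∑ I : ι × ι × ι × ι,
      g (c h, t) (curv Γ (c h, t) (X I.1 h) (X I.2.1 h) (X I.2.2.1 h)) (X I.2.2.2 h) ^ 2 := by
    filter_upwards [Ioo_mem_nhds (show (-1 : ℝ) < 0 by norm_num) one_pos] with h hh
    exact hU.eq_family (z := (c h, t)) (v := fun a => X a h) (hΩ _) (hXo h hh)
  set f : (E : (ι → ℝ) × ℝ → Ten (ι → ℝ)) → ι × ι × ι × ι → ℝ → ℝ := fun T I h =>
    g (c h, t) (T (c h, t) (X I.1 h) (X I.2.1 h) (X I.2.2.1 h)) (X I.2.2.2 h) with hf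
  have hfd : ∀ T : (ι → ℝ) × ℝ → Ten (ι → ℝ), (∀ y, DifferentiableAt ℝ T (y, t)) →
      ∀ I, ∀ h ∈ Ioo (-1 : ℝ) 1, HasDerivAt (f T I)
        (f (cov Γ actTen V T) I h - h * f (cov Γ actTen N T) I h) h := by
    intro T hT I h hh
    have := M.hasDerivAt_ten_parallel (hcd h) (hΩ _) (hT _) (hX I.1 h hh) (hX I.2.1 h hh)
      (hX I.2.2.1 h hh) (hX I.2.2.2 h hh)
    convert this using 1
    rw [sub_eq_add_neg V, cov_add_dir, ← neg_smul, cov_smul_dir]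
    simp only [hf, Hom.add_apply, Hom.smul_apply, _root_.add_apply, _root_.smul_apply, map_add,
      map_smul, smul_eq_mul]
    ring
  have h1 : deriv (fun h => U (c h, t)) =ᶠ[𝓝 0] fun h => ∑ I : ι × ι × ι × ι,
      2 * (f (curv Γ) I h * (f (cov Γ actTen V (curv Γ)) I h
        - h * f (cov Γ actTen N (curv Γ)) I h)) := by
    filter_upwards [hU'.eventuallyEq_nhds, Ioo_mem_nhds (show (-1 : ℝ) < 0 by norm_num) one_pos]
      with h hh hh'
    rw [hh.deriv_eq]
    have := HasDerivAt.fun_sum (u := Finset.univ) fun I _ => (hfd (curv Γ) dR I h hh').pow 2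
    refine this.deriv.trans ?_
    exact Finset.sum_congr rfl fun I _ => by push_cast; ring
  rw [h1.deriv_eq]
  have z0 : (0 : ℝ) ∈ Ioo (-1 : ℝ) 1 := by constructor <;> norm_num
  have hd2 : ∀ I ∈ Finset.univ, HasDerivAt (fun h => 2 * (f (curv Γ) I h * (f (cov Γ actTen V (curv Γ)) I h
        - h * f (cov Γ actTen N (curv Γ)) I h))) _ 0 := fun I _ =>
    ((hfd (curv Γ) dR I 0 z0).mul ((hfd _ (fun y => M.differentiableAt_cov_curv (hΩ y) V) I 0 z0).sub
      ((hasDerivAt_id 0).mul (hfd _ (fun y => M.differentiableAt_cov_curv (hΩ y) N) I 0 z0)))).const_mul 2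
  rw [(HasDerivAt.fun_sum hd2).deriv]
  refine Finset.sum_le_sum fun I _ => ?_
  simp only [Pi.sub_apply, Pi.mul_apply, zero_mul, sub_zero, add_zero, one_mul, hf, hX0, c0, hN, covTwo, Hom.sub_apply,
    _root_.sub_apply, map_sub]
  nlinarith [sq_nonneg (g (x, t) (cov Γ actTen V (curv Γ) (x, t) (e I.1) (e I.2.1) (e I.2.2.1))
          (e I.2.2.2))]

end Laplacian

section Sharp
variable {E : Type*} [NormedAddCommGroup E] [NormedSpace ℝ E] [FiniteDimensional ℝ E]
variable {Ω : Set (E × ℝ)} {g : E × ℝ → Form E} {Γ : E × ℝ → E →L[ℝ] E →L[ℝ] E}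

theorem MetricOn.exists_sharp (M : MetricOn Ω g Γ) (ρ : E × ℝ → Form E) :
    ∃ B : E × ℝ → E →L[ℝ] E, (∀ z ∈ Ω, ∀ X Y, g z (B z X) Y = ρ z X Y) ∧
      ∀ z ∈ Ω, ContinuousAt ρ z → ContinuousAt B z := by
  have : CompleteSpace E := FiniteDimensional.complete ℝ E
  have key : ∀ z ∈ Ω, ∃ L : E ≃L[ℝ] Hom E ℝ, ∀ X, L X = g z X := by
    intro z hz
    let f : E →ₗ[ℝ] Hom E ℝ := ((Hom.clm (g z) : E →L[ℝ] Hom E ℝ) : E →ₗ[ℝ] Hom E ℝ)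
    have hf : ∀ X, f X = g z X := fun _ => rfl
    have hi : Function.Injective f := by
      rw [← LinearMap.ker_eq_bot, LinearMap.ker_eq_bot']
      intro X hX
      by_contra h
      have := M.pos z hz X h
      rw [← hf, hX] at this
      simp at this
    have hr : Module.finrank ℝ E = Module.finrank ℝ (Hom E ℝ) := by
      have e : (E →ₗ[ℝ] ℝ) ≃ₗ[ℝ] (Hom E ℝ) :=
        (LinearMap.toContinuousLinearMap : (E →ₗ[ℝ] ℝ) ≃ₗ[ℝ] (E →L[ℝ] ℝ))
      rw [← e.finrank_eq]
      exact (Subspace.dual_finrank_eq (K := ℝ) (V := E)).symm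
    exact ⟨(LinearEquiv.ofInjectiveOfFinrankEq f hi hr).toContinuousLinearEquiv, hf⟩
  refine ⟨fun z => (ContinuousLinearMap.inverse (Hom.clm (g z))) ∘L Hom.clm (ρ z), fun z hz X Y => ?_,
    fun z hz hρ => ?_⟩
  · obtain ⟨L, hL⟩ := key z hz
    have h1 : (Hom.clm (g z) : E →L[ℝ] Hom E ℝ) = L := by ext1 X; exact (hL X).symm
    change g z ((ContinuousLinearMap.inverse (Hom.clm (g z)) ∘L Hom.clm (ρ z)) X) Y = _
    rw [h1, ContinuousLinearMap.inverse_equiv, ← hL]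
    simp
  · obtain ⟨L, hL⟩ := key z hz
    have h1 : (Hom.clm (g z) : E →L[ℝ] Hom E ℝ) = L := by ext1 X; exact (hL X).symm
    have h2 : ContinuousAt ContinuousLinearMap.inverse (Hom.clm (g z) : E →L[ℝ] Hom E ℝ) := by
      rw [h1]; exact (contDiffAt_map_inverse (n := 1) L).continuousAt
    have h3 : ContinuousAt (fun z => (Hom.clm (g z) : E →L[ℝ] Hom E ℝ)) z :=
      ContinuousAt.comp (g := (Hom.clm (E := E) (W := Hom E ℝ)))
        (Hom.clm (E := E) (W := Hom E ℝ)).continuous.continuousAt (M.smooth_metric z hz).continuousAt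
    have h4 : ContinuousAt (fun z => (Hom.clm (ρ z) : E →L[ℝ] Hom E ℝ)) z :=
      ContinuousAt.comp (g := (Hom.clm (E := E) (W := Hom E ℝ)))
        (Hom.clm (E := E) (W := Hom E ℝ)).continuous.continuousAt hρ
    exact (ContinuousAt.comp (f := fun z => (Hom.clm (g z) : E →L[ℝ] Hom E ℝ)) h2 h3).clm_comp h4

end Sharp

theorem abs_le_sqrt_sum_sq {κ : Type*} [Fintype κ] (f : κ → ℝ) {y : ℝ}
    (hy : y = ∑ i, f i ^ 2) (i : κ) : |f i| ≤ √y := by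
  rw [hy]
  exact Real.abs_le_sqrt
    (Finset.single_le_sum (f := fun i => f i ^ 2) (fun j _ => sq_nonneg (f j)) (Finset.mem_univ i))

section Evolution
variable {ι : Type*} [Fintype ι] [DecidableEq ι]
variable {Ω : Set ((ι → ℝ) × ℝ)} {g : (ι → ℝ) × ℝ → Form (ι → ℝ)}
  {Γ : (ι → ℝ) × ℝ → (ι → ℝ) →L[ℝ] (ι → ℝ) →L[ℝ] (ι → ℝ)}

namespace MetricOn
variable (M : MetricOn Ω g Γ)
include M

theorem trace_curv_symm {z : (ι → ℝ) × ℝ} (hz : z ∈ Ω) (Y Z : ι → ℝ) :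
    traceTen (curv Γ z) Y Z = traceTen (curv Γ z) Z Y := by
  obtain ⟨e, he⟩ := IsONB.exists (ι := ι) (M.symm z hz) (M.pos z hz) (by simp)
  exact (M.isCurvLike_curv hz).trace_symm (M.symm z hz) he Y Z

/-- Uhlenbeck's trick: frames moving in time so as to stay orthonormal. -/
theorem exists_time_frame
    (hfl : ∀ z ∈ Ω, fderiv ℝ g z (0, 1) = (-2 : ℝ) • traceTen (curv Γ z))
    {B : (ι → ℝ) × ℝ → (ι → ℝ) →L[ℝ] (ι → ℝ)}
    (hB : ∀ z ∈ Ω, ∀ X Y, g z (B z X) Y = traceTen (curv Γ z) X Y)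
    (hBc : ∀ z ∈ Ω, ContinuousAt B z) {x : ι → ℝ} {t : ℝ} (hq : (x, t) ∈ Ω)
    {e : Module.Basis ι ℝ (ι → ℝ)} (he : IsONB (g (x, t)) e) :
    ∃ r > 0, ∃ X : ι → ℝ → ι → ℝ, (∀ a, X a t = e a) ∧
      (∀ a, ∀ s ∈ Ioo (t - r) (t + r), HasDerivAt (X a) (B (x, s) (X a s)) s) ∧
      (∀ s ∈ Ioo (t - r) (t + r), (x, s) ∈ Ω) ∧
      ∀ s ∈ Ioo (t - r) (t + r), ∀ a b, g (x, s) (X a s) (X b s) = if a = b then 1 else 0 := by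
  have hnear : ∀ᶠ s in 𝓝 t, (x, s) ∈ Ω :=
    (continuous_const.prodMk continuous_id : Continuous fun s : ℝ => (x, s)).continuousAt.eventually
      (M.isOpen.mem_nhds hq)
  obtain ⟨r, hr, hrΩ⟩ := Metric.nhds_basis_closedBall.eventually_iff.1 hnear
  have hΩ : ∀ s ∈ Icc (t - r) (t + r), (x, s) ∈ Ω := fun s hs => hrΩ (by
    rwa [Real.closedBall_eq_Icc])
  have hA : ContinuousOn (fun s => B (x, s)) (Icc (t - r) (t + r)) := fun s hs =>
    (ContinuousAt.comp (f := fun s : ℝ => (x, s)) (hBc _ (hΩ s hs))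
      (continuous_const.prodMk continuous_id).continuousAt).continuousWithinAt
  choose X hX0 hX using fun a => exists_linear_ode hr (t₀ := t) hA (e a)
  refine ⟨r, hr, X, hX0, hX, fun s hs => hΩ s (Ioo_subset_Icc_self hs), fun s hs a b => ?_⟩
  have hd : ∀ s ∈ Ioo (t - r) (t + r),
      HasDerivAt (fun s => g (x, s) (X a s) (X b s)) 0 s := fun s hs => by
    have hz := hΩ s (Ioo_subset_Icc_self hs)
    refine (M.hasDerivAt_metric (c := fun s => (x, s)) (w := (0, 1))
      ((hasDerivAt_const s x).prodMk (hasDerivAt_id s)) hz (hX a s hs) (hX b s hs)).congr_deriv ?_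
    rw [hfl _ hz, M.symm _ hz (X a s), hB _ hz, hB _ hz, M.trace_curv_symm hz (X b s)]
    simp only [Hom.smul_apply, smul_eq_mul]
    ring
  rw [eq_of_hasDerivAt_zero hd hs (s' := t) ⟨by linarith, by linarith⟩, hX0, hX0]
  exact he a b

/-- Evolution inequality for the squared norm of the curvature under Ricci flow. -/
theorem deriv_normSq_le
    (hfl : ∀ z ∈ Ω, fderiv ℝ g z (0, 1) = (-2 : ℝ) • traceTen (curv Γ z))
    {U : (ι → ℝ) × ℝ → ℝ} (hU : IsCurvNormSq g Γ Ω U) {x : ι → ℝ} {t : ℝ}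
    (hΩ : ∀ y, (y, t) ∈ Ω) {e : Module.Basis ι ℝ (ι → ℝ)} (he : IsONB (g (x, t)) e) :
    deriv (fun s => U (x, s)) t ≤ ∑ a, deriv (deriv fun h => U (geo Γ x t (e a) h, t)) 0
      + 32 * (Fintype.card ι) ^ 6 * (U (x, t) * √(U (x, t))) := by
  have hq := hΩ x
  set u := √(U (x, t)) with hu_def
  set n : ℝ := ((Fintype.card ι : ℕ) : ℝ) with hn
  have hUq := hU _ hq e he
  have hU0 : 0 ≤ U (x, t) := by rw [hUq]; positivity
  have u0 : 0 ≤ u := Real.sqrt_nonneg _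
  have uu : u ^ 2 = U (x, t) := Real.sq_sqrt hU0
  have n0 : 0 ≤ n := Nat.cast_nonneg _
  have hu : ∀ a b c d, |g (x, t) (curv Γ (x, t) (e a) (e b) (e c)) (e d)| ≤ u := fun a b c d =>
    abs_le_sqrt_sum_sq (fun I : ι × ι × ι × ι =>
      g (x, t) (curv Γ (x, t) (e I.1) (e I.2.1) (e I.2.2.1)) (e I.2.2.2)) hUq (a, b, c, d)
  have card_sum : ∀ (f : ι → ℝ) (m : ℝ), (∀ a, |f a| ≤ m) → |∑ a, f a| ≤ n * m := fun f m hf => by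
    refine (Finset.abs_sum_le_sum_abs _ _).trans ?_
    rw [hn, ← nsmul_eq_mul, ← Finset.card_univ]
    exact Finset.sum_le_card_nsmul _ _ _ fun k _ => hf k
  have card_sum' : ∀ (f f' : ι → ℝ) , (∀ a, |f a| ≤ n * u) → (∀ a, |f' a| ≤ u) →
      |∑ a, f a * f' a| ≤ n ^ 2 * u ^ 2 := fun f f' hf hf' => by
    refine (card_sum _ ((n * u) * u) fun a => ?_).trans (by nlinarith)
    rw [abs_mul]; exact mul_le_mul (hf a) (hf' a) (abs_nonneg _) (by positivity)
  have hRic : ∀ a b, |traceTen (curv Γ (x, t)) (e a) (e b)| ≤ n * u := fun a b => by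
    rw [he.traceTen_eq]; exact card_sum _ _ fun c => hu _ _ _ _
  obtain ⟨B, hB, hBc⟩ := M.exists_sharp fun z => traceTen (curv Γ z)
  have hRc : ∀ z ∈ Ω, ContinuousAt (fun z => traceTen (curv Γ z)) z := fun z hz =>
    ContinuousAt.comp (g := traceTen) traceTen.continuous.continuousAt
      (M.differentiableAt_curv hz).continuousAt
  obtain ⟨r, hr, X, hX0, hX, hXΩ, hXo⟩ := M.exists_time_frame hfl hB (fun z hz => hBc z hz (hRc z hz))
    hq he
  have tm : t ∈ Ioo (t - r) (t + r) := ⟨by linarith, by linarith⟩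
  have hU' : (fun s => U (x, s)) =ᶠ[𝓝 t] fun s => ∑ I : ι × ι × ι × ι,
      g (x, s) (curv Γ (x, s) (X I.1 s) (X I.2.1 s) (X I.2.2.1 s)) (X I.2.2.2 s) ^ 2 := by
    filter_upwards [Ioo_mem_nhds tm.1 tm.2] with s hs
    exact hU.eq_family (z := (x, s)) (v := fun a => X a s) (hXΩ s hs) (hXo s hs)
  have hc : HasDerivAt (fun s => (x, s)) ((0, 1) : (ι → ℝ) × ℝ) t :=
    (hasDerivAt_const t x).prodMk (hasDerivAt_id t)
  have Be : ∀ a, B (x, t) (e a) = ∑ m, traceTen (curv Γ (x, t)) (e a) (e m) • e m := fun a => by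
    conv_lhs => rw [← he.sum_eq (B (x, t) (e a))]
    simp only [hB _ hq]
  set f' : ι × ι × ι × ι → ℝ := fun I =>
    deriv (fun s => g (x, s) (curv Γ (x, s) (X I.1 s) (X I.2.1 s) (X I.2.2.1 s)) (X I.2.2.2 s)) t
  have hf : ∀ I : ι × ι × ι × ι, HasDerivAt
      (fun s => g (x, s) (curv Γ (x, s) (X I.1 s) (X I.2.1 s) (X I.2.2.1 s)) (X I.2.2.2 s))
      (f' I) t ∧ |f' I - ∑ a, g (x, t) (covTwo Γ actTen (e a) (e a) (curv Γ) (x, t)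
        (e I.1) (e I.2.1) (e I.2.2.1)) (e I.2.2.2)| ≤ 16 * n ^ 2 * u ^ 2 := by
    rintro ⟨i, j, k, l⟩
    have h := M.hasDerivAt_metric hc hq (hasDerivAt_ten_apply hc (M.differentiableAt_curv hq)
      (hX i t tm) (hX j t tm) (hX k t tm)) (hX l t tm)
    refine ⟨h.differentiableAt.hasDerivAt, ?_⟩
    have hev := M.abs_evolution_le hfl hq he hu i j k l
    have e1 : |g (x, t) (curv Γ (x, t) (B (x, t) (e i)) (e j) (e k)) (e l)| ≤ n ^ 2 * u ^ 2 := by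
      rw [Be]
      simp only [map_sum, map_smul, Hom.sum_apply, Hom.smul_apply, _root_.sum_apply,
        _root_.smul_apply, smul_eq_mul]
      exact card_sum' _ _ (fun _ => hRic _ _) fun _ => hu _ _ _ _
    have e2 : |g (x, t) (curv Γ (x, t) (e i) (B (x, t) (e j)) (e k)) (e l)| ≤ n ^ 2 * u ^ 2 := by
      rw [Be]
      simp only [map_sum, map_smul, Hom.sum_apply, Hom.smul_apply, _root_.sum_apply,
        _root_.smul_apply, smul_eq_mul]
      exact card_sum' _ _ (fun _ => hRic _ _) fun _ => hu _ _ _ _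
    have e3 : |g (x, t) (curv Γ (x, t) (e i) (e j) (B (x, t) (e k))) (e l)| ≤ n ^ 2 * u ^ 2 := by
      rw [Be]
      simp only [map_sum, map_smul, Hom.sum_apply, Hom.smul_apply, _root_.sum_apply,
        _root_.smul_apply, smul_eq_mul]
      exact card_sum' _ _ (fun _ => hRic _ _) fun _ => hu _ _ _ _
    have e4 : |g (x, t) (curv Γ (x, t) (e i) (e j) (e k)) (B (x, t) (e l))| ≤ n ^ 2 * u ^ 2 := by
      rw [Be]
      simp only [map_sum, map_smul, Hom.sum_apply, Hom.smul_apply, _root_.sum_apply,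
        _root_.smul_apply, smul_eq_mul]
      exact card_sum' _ _ (fun _ => hRic _ _) fun _ => hu _ _ _ _
    have e5 : traceTen (curv Γ (x, t)) (curv Γ (x, t) (e i) (e j) (e k)) (e l) =
        g (x, t) (curv Γ (x, t) (e i) (e j) (e k)) (B (x, t) (e l)) := by
      rw [M.symm _ hq _ (B (x, t) (e l)), hB _ hq, M.trace_curv_symm hq]
    change |deriv (fun s => g (x, s) (curv Γ (x, s) (X i s) (X j s) (X k s)) (X l s)) t - _| ≤ _
    rw [h.deriv, hfl _ hq]
    simp only [hX0, Hom.smul_apply, smul_eq_mul, e5, map_add, Hom.add_apply] at hev ⊢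
    rw [abs_le] at *
    constructor <;> linarith [e1.1, e1.2, e2.1, e2.2, e3.1, e3.2, e4.1, e4.2, hev.1, hev.2]
  rw [hU'.deriv_eq, (HasDerivAt.fun_sum (u := Finset.univ) fun I _ => (hf I).1.fun_pow 2).deriv]
  have hlap : ∀ a, _ := fun a => M.le_deriv_deriv hU hΩ he (e a)
  refine le_trans ?_ (add_le_add_left (Finset.sum_le_sum fun a _ => hlap a) _)
  rw [Finset.sum_comm]
  have hcard : ∑ I : ι × ι × ι × ι, 32 * n ^ 2 * u ^ 3 = 32 * n ^ 6 * (U (x, t) * u) := by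
    rw [Finset.sum_const, ← uu, nsmul_eq_mul, Finset.card_univ]
    simp only [Fintype.card_prod]; push_cast; ring
  rw [← hcard, ← Finset.sum_add_distrib]
  refine Finset.sum_le_sum fun I _ => ?_
  rw [← Finset.mul_sum, ← Finset.mul_sum]
  simp only [hX0]
  have h1 := hu I.1 I.2.1 I.2.2.1 I.2.2.2
  have h2 := (hf I).2
  set F := g (x, t) (curv Γ (x, t) (e I.1) (e I.2.1) (e I.2.2.1)) (e I.2.2.2)
  set D := ∑ a, g (x, t) (covTwo Γ actTen (e a) (e a) (curv Γ) (x, t)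
        (e I.1) (e I.2.1) (e I.2.2.1)) (e I.2.2.2)
  have h3 : F * (f' I - D) ≤ u * (16 * n ^ 2 * u ^ 2) :=
    (le_abs_self _).trans (by rw [abs_mul]; gcongr)
  norm_num
  nlinarith

end MetricOn
end Evolution

section Coordinates
variable {n : ℕ}

/-- The bilinear form `dxⁱ ⊗ dxʲ`. -/
def coordForm (i j : Fin n) : Form (Fin n → ℝ) :=
  Hom.of ((ContinuousLinearMap.proj (R := ℝ) (φ := fun _ : Fin n => ℝ) i).smulRight
    (Hom.of (ContinuousLinearMap.proj (R := ℝ) (φ := fun _ : Fin n => ℝ) j)))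

theorem coordForm_apply (i j : Fin n) (X Y : Fin n → ℝ) : coordForm i j X Y = X i * Y j := rfl

/-- The bilinear map with values in the `k`-th coordinate direction. -/
def coordConn (k i j : Fin n) : (Fin n → ℝ) →L[ℝ] (Fin n → ℝ) →L[ℝ] (Fin n → ℝ) :=
  (ContinuousLinearMap.proj (R := ℝ) (φ := fun _ : Fin n => ℝ) i).smulRight
    ((ContinuousLinearMap.proj (R := ℝ) (φ := fun _ : Fin n => ℝ) j).smulRight (Pi.single k 1))

theorem coordConn_apply (k i j : Fin n) (X Y : Fin n → ℝ) :
    coordConn k i j X Y = (X i * Y j) • Pi.single k 1 := by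
  simp [coordConn, mul_smul]

/-- The time-dependent metric as a bilinear form. -/
def metricForm (g : (Fin n → ℝ) → ℝ → Matrix (Fin n) (Fin n) ℝ) (z : (Fin n → ℝ) × ℝ) :
    Form (Fin n → ℝ) := ∑ i, ∑ j, g z.1 z.2 i j • coordForm i j

/-- The Levi-Civita connection form. -/
def conn (g : (Fin n → ℝ) → ℝ → Matrix (Fin n) (Fin n) ℝ) (z : (Fin n → ℝ) × ℝ) :
    (Fin n → ℝ) →L[ℝ] (Fin n → ℝ) →L[ℝ] (Fin n → ℝ) :=
  ∑ k, ∑ i, ∑ j, christoffel (fun y => g y z.2) z.1 k i j • coordConn k i j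

variable {g : (Fin n → ℝ) → ℝ → Matrix (Fin n) (Fin n) ℝ} {z : (Fin n → ℝ) × ℝ}

theorem metricForm_apply (X Y : Fin n → ℝ) :
    metricForm g z X Y = ∑ i, ∑ j, g z.1 z.2 i j * X i * Y j := by
  simp only [metricForm, Hom.sum_apply, Hom.smul_apply, coordForm_apply, smul_eq_mul, mul_assoc]

theorem conn_apply (X Y : Fin n → ℝ) (k : Fin n) :
    conn g z X Y k = ∑ i, ∑ j, christoffel (fun y => g y z.2) z.1 k i j * X i * Y j := by
  simp only [conn, _root_.sum_apply, _root_.smul_apply, coordConn_apply, Finset.sum_apply,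
    Pi.smul_apply, smul_eq_mul, Pi.single_apply]
  rw [Finset.sum_eq_single k]
  · simp [mul_assoc]
  · intro b _ hb; simp [hb.symm]
  · simp

theorem conn_single (i j k : Fin n) :
    conn g z (Pi.single i 1) (Pi.single j 1) k = christoffel (fun y => g y z.2) z.1 k i j := by
  rw [conn_apply, Finset.sum_eq_single i, Finset.sum_eq_single j] <;>
    simp +contextual [Pi.single_apply]

section Smoothness
variable {T : ℝ} {f : (Fin n → ℝ) → ℝ → ℝ}

theorem uniqueDiffOn_slab (hT : 0 < T) :
    UniqueDiffOn ℝ ((univ : Set (Fin n → ℝ)) ×ˢ Icc 0 T) :=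
  uniqueDiffOn_univ.prod (uniqueDiffOn_Icc hT)

theorem contDiffOn_pd (hT : 0 < T)
    (hf : ContDiffOn ℝ ∞ (fun p : (Fin n → ℝ) × ℝ => f p.1 p.2) (univ ×ˢ Icc 0 T)) (i : Fin n) :
    ContDiffOn ℝ ∞ (fun p : (Fin n → ℝ) × ℝ => pd (fun y => f y p.2) i p.1) (univ ×ˢ Icc 0 T) := by
  have h := (hf.fderivWithin (m := ∞) (uniqueDiffOn_slab hT) (by simp)).clm_apply
    (contDiffOn_const (c := ((Pi.single i 1, 0) : (Fin n → ℝ) × ℝ)))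
  refine h.congr fun p hp => ?_
  have h1 := ((hf p hp).differentiableWithinAt (by simp)).hasFDerivWithinAt
  have h2 : HasFDerivAt (fun y : Fin n → ℝ => (y, p.2))
      (ContinuousLinearMap.inl ℝ (Fin n → ℝ) ℝ) p.1 := hasFDerivAt_prodMk_left p.1 p.2
  have hm : MapsTo (fun y : Fin n → ℝ => (y, p.2)) univ (univ ×ˢ Icc 0 T) :=
    fun y _ => ⟨mem_univ _, hp.2⟩
  have h3 := h1.comp p.1 (h2.hasFDerivWithinAt (s := univ)) hm
  rw [hasFDerivWithinAt_univ] at h3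
  have h4 : fderiv ℝ (fun y => f y p.2) p.1 = _ := h3.fderiv
  rw [pd, h4]; rfl

theorem contDiffOn_det {A : (Fin n → ℝ) × ℝ → Matrix (Fin n) (Fin n) ℝ}
    {S : Set ((Fin n → ℝ) × ℝ)} (hA : ∀ i j, ContDiffOn ℝ ∞ (fun p => A p i j) S) :
    ContDiffOn ℝ ∞ (fun p => (A p).det) S := by
  simp only [Matrix.det_apply]
  refine ContDiffOn.sum fun σ _ => ContDiffOn.const_smul _ ?_
  exact contDiffOn_prod fun i _ => hA _ _

theorem contDiffOn_matrix_inv {A : (Fin n → ℝ) × ℝ → Matrix (Fin n) (Fin n) ℝ}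
    {S : Set ((Fin n → ℝ) × ℝ)} (hA : ∀ i j, ContDiffOn ℝ ∞ (fun p => A p i j) S)
    (h0 : ∀ p ∈ S, (A p).det ≠ 0) (i j : Fin n) : ContDiffOn ℝ ∞ (fun p => (A p)⁻¹ i j) S := by
  simp only [Matrix.inv_def, Matrix.smul_apply, Ring.inverse_eq_inv', smul_eq_mul,
    Matrix.adjugate_apply]
  refine ((contDiffOn_det hA).inv h0).mul (contDiffOn_det fun a b => ?_)
  simp only [Matrix.updateRow_apply]
  split_ifs
  · exact contDiffOn_const
  · exact hA a b

theorem contDiffOn_smul_vec {P F : Type*} [NormedAddCommGroup P] [NormedSpace ℝ P]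
    [NormedAddCommGroup F] [NormedSpace ℝ F] {f : P → ℝ} {S : Set P} (h : ContDiffOn ℝ ∞ f S)
    (v : F) : ContDiffOn ℝ ∞ (fun p => f p • v) S := h.smul contDiffOn_const

variable (hT : 0 < T) (hg : SmoothMetricFamily g (Icc 0 T))
include hT hg

theorem contDiffOn_christoffel (k i j : Fin n) :
    ContDiffOn ℝ ∞ (fun p : (Fin n → ℝ) × ℝ => christoffel (fun y => g y p.2) p.1 k i j)
      (univ ×ˢ Icc 0 T) := by
  simp only [christoffel]
  refine contDiffOn_const.mul (ContDiffOn.sum fun l _ => ContDiffOn.mul ?_ ?_)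
  · exact contDiffOn_matrix_inv hg.1 (fun p hp => (hg.2 p.1 p.2 hp.2).2.det_pos.ne') k l
  · exact ((contDiffOn_pd (f := fun y t => g y t j l) hT (hg.1 j l) i).add
      (contDiffOn_pd (f := fun y t => g y t i l) hT (hg.1 i l) j)).sub
      (contDiffOn_pd (f := fun y t => g y t i j) hT (hg.1 i j) l)

theorem contDiffOn_riemann (i j k l : Fin n) :
    ContDiffOn ℝ ∞ (fun p : (Fin n → ℝ) × ℝ => riemann (fun y => g y p.2) p.1 i j k l)
      (univ ×ˢ Icc 0 T) := by
  have hC := contDiffOn_christoffel hT hg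
  simp only [riemann]
  refine ContDiffOn.sum fun m _ => ContDiffOn.mul (hg.1 l m) (ContDiffOn.add (ContDiffOn.sub ?_ ?_)
    (ContDiffOn.sum fun p _ => ((hC m i p).mul (hC p j k)).sub ((hC m j p).mul (hC p i k))))
  · exact contDiffOn_pd (f := fun y t => christoffel (fun y => g y t) y m j k) hT (hC m j k) i
  · exact contDiffOn_pd (f := fun y t => christoffel (fun y => g y t) y m i k) hT (hC m i k) j

theorem contDiffOn_metricForm : ContDiffOn ℝ ∞ (metricForm g) (univ ×ˢ Icc 0 T) :=
  ContDiffOn.sum fun i _ => ContDiffOn.sum fun j _ => (hg.1 i j).smul contDiffOn_const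

theorem contDiffOn_conn : ContDiffOn ℝ ∞ (conn g) (univ ×ˢ Icc 0 T) :=
  ContDiffOn.sum fun k _ => ContDiffOn.sum fun i _ => ContDiffOn.sum fun j _ =>
    contDiffOn_smul_vec (contDiffOn_christoffel hT hg k i j) (coordConn k i j)

end Smoothness
end Coordinates

section Bridge
variable {n : ℕ} {g : (Fin n → ℝ) → ℝ → Matrix (Fin n) (Fin n) ℝ} {z : (Fin n → ℝ) × ℝ} {T : ℝ}

theorem fderiv_slice {F : Type*} [NormedAddCommGroup F] [NormedSpace ℝ F]
    {f : (Fin n → ℝ) × ℝ → F} (hf : DifferentiableAt ℝ f z) (v : Fin n → ℝ) :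
    fderiv ℝ f z (v, 0) = fderiv ℝ (fun y => f (y, z.2)) z.1 v := by
  have h2 : HasFDerivAt (fun y : Fin n → ℝ => (y, z.2))
      (ContinuousLinearMap.inl ℝ (Fin n → ℝ) ℝ) z.1 := hasFDerivAt_prodMk_left z.1 z.2
  have h3 := HasFDerivAt.comp (f := fun y : Fin n → ℝ => (y, z.2)) z.1 hf.hasFDerivAt h2
  have h4 : fderiv ℝ (fun y => f (y, z.2)) z.1 = _ := h3.fderiv
  rw [h4]; rfl

theorem pi_eq_sum_single (X : Fin n → ℝ) : X = ∑ i, X i • Pi.single i (1 : ℝ) := by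
  ext k
  simp [Finset.sum_apply, Pi.single_apply]

theorem isOpen_slab : IsOpen ((univ : Set (Fin n → ℝ)) ×ˢ Ioo 0 T) := isOpen_univ.prod isOpen_Ioo

theorem slab_mem_nhds (hz : z ∈ (univ : Set (Fin n → ℝ)) ×ˢ Ioo 0 T) :
    (univ : Set (Fin n → ℝ)) ×ˢ Icc 0 T ∈ 𝓝 z :=
  Filter.mem_of_superset (isOpen_slab.mem_nhds hz) (prod_mono_right Ioo_subset_Icc_self)

theorem fderiv_metricForm (hg : SmoothMetricFamily g (Icc 0 T))
    (hz : z ∈ (univ : Set (Fin n → ℝ)) ×ˢ Ioo 0 T) (w : (Fin n → ℝ) × ℝ) (X Y : Fin n → ℝ) :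
    fderiv ℝ (metricForm g) z w X Y =
      ∑ i, ∑ j, fderiv ℝ (fun p : (Fin n → ℝ) × ℝ => g p.1 p.2 i j) z w * X i * Y j := by
  have hd : ∀ i j, DifferentiableAt ℝ (fun p : (Fin n → ℝ) × ℝ => g p.1 p.2 i j) z := fun i j =>
    ((hg.1 i j).contDiffAt (slab_mem_nhds hz)).differentiableAt (by simp)
  have : HasFDerivAt (metricForm g) (∑ i, ∑ j,
      (fderiv ℝ (fun p : (Fin n → ℝ) × ℝ => g p.1 p.2 i j) z).smulRight (coordForm i j)) z :=
    HasFDerivAt.fun_sum fun i _ => HasFDerivAt.fun_sum fun j _ =>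
      (hd i j).hasFDerivAt.smul_const _
  rw [this.fderiv]
  simp only [_root_.sum_apply, ContinuousLinearMap.smulRight_apply, Hom.sum_apply, Hom.smul_apply,
    coordForm_apply, smul_eq_mul, mul_assoc]

theorem exists_hasFDerivAt_eval {P E W : Type*} [NormedAddCommGroup P] [NormedSpace ℝ P]
    [NormedAddCommGroup E] [NormedSpace ℝ E] [NormedAddCommGroup W] [NormedSpace ℝ W]
    {Γ : P → E →L[ℝ] E →L[ℝ] W} {p : P} (h : DifferentiableAt ℝ Γ p) (X Y : E) (ℓ : W →L[ℝ] ℝ) :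
    ∃ D : P →L[ℝ] ℝ, (∀ w, D w = ℓ (fderiv ℝ Γ p w X Y)) ∧
      HasFDerivAt (fun p => ℓ (Γ p X Y)) D p := by
  have h1 := (h.hasFDerivAt.clm_apply (hasFDerivAt_const X p)).clm_apply (hasFDerivAt_const Y p)
  have h2 := HasFDerivAt.comp (g := ℓ) p ℓ.hasFDerivAt h1
  exact ⟨_, fun w => by simp, h2⟩

variable (hT : 0 < T) (hg : SmoothMetricFamily g (Icc 0 T))
include hT hg

theorem fderiv_conn (hz : z ∈ (univ : Set (Fin n → ℝ)) ×ˢ Ioo 0 T) (w : (Fin n → ℝ) × ℝ)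
    (X Y : Fin n → ℝ) (k : Fin n) :
    fderiv ℝ (conn g) z w X Y k = ∑ i, ∑ j, fderiv ℝ (fun p : (Fin n → ℝ) × ℝ =>
      christoffel (fun y => g y p.2) p.1 k i j) z w * X i * Y j := by
  have hd : ∀ k i j, DifferentiableAt ℝ (fun p : (Fin n → ℝ) × ℝ =>
      christoffel (fun y => g y p.2) p.1 k i j) z := fun k i j =>
    ((contDiffOn_christoffel hT hg k i j).contDiffAt (slab_mem_nhds hz)).differentiableAt (by simp)
  have hc : DifferentiableAt ℝ (conn g) z :=
    ((contDiffOn_conn hT hg).contDiffAt (slab_mem_nhds hz)).differentiableAt (by simp)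
  obtain ⟨D, hD, h1⟩ := exists_hasFDerivAt_eval hc X Y
    (ContinuousLinearMap.proj (R := ℝ) (φ := fun _ : Fin n => ℝ) k)
  have h2 : HasFDerivAt (fun p => conn g p X Y k) (∑ i, ∑ j, Y j • X i •
      fderiv ℝ (fun p : (Fin n → ℝ) × ℝ => christoffel (fun y => g y p.2) p.1 k i j) z) z := by
    simp only [conn_apply]
    exact HasFDerivAt.fun_sum fun i _ => HasFDerivAt.fun_sum fun j _ =>
      ((hd k i j).hasFDerivAt.mul_const _).mul_const _
  have h3 := congrArg (fun l => l w) (h1.unique h2)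
  refine (hD w).symm.trans (h3.trans ?_)
  simp only [_root_.sum_apply, _root_.smul_apply, smul_eq_mul]
  exact Finset.sum_congr rfl fun i _ => Finset.sum_congr rfl fun j _ => by ring

omit hT hg in
theorem christoffel_symm {G : (Fin n → ℝ) → Matrix (Fin n) (Fin n) ℝ} (hG : ∀ y, (G y).IsSymm)
    (x : Fin n → ℝ) (k i j : Fin n) : christoffel G x k i j = christoffel G x k j i := by
  have : (fun y => G y i j) = fun y => G y j i := by ext y; exact (hG y).apply j i
  simp only [christoffel, this]
  congr 1
  exact Finset.sum_congr rfl fun l _ => by ring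

omit hT hg in
theorem sum_christoffel {G : (Fin n → ℝ) → Matrix (Fin n) (Fin n) ℝ} {x : Fin n → ℝ}
    (hs : (G x).IsSymm) (hG : (G x).PosDef) (i j l : Fin n) :
    ∑ m, G x m l * christoffel G x m i j = 1 / 2 *
      (pd (fun y => G y j l) i x + pd (fun y => G y i l) j x - pd (fun y => G y i j) l x) := by
  have hinv : G x * (G x)⁻¹ = 1 := Matrix.mul_nonsing_inv _ hG.det_pos.ne'.isUnit
  set A : Fin n → ℝ := fun l =>
    pd (fun y => G y j l) i x + pd (fun y => G y i l) j x - pd (fun y => G y i j) l x with hA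
  have h1 : ∀ p, ∑ m, G x m l * (G x)⁻¹ m p = if l = p then 1 else 0 := fun p => by
    have := congrFun (congrFun hinv l) p
    rw [Matrix.mul_apply, Matrix.one_apply] at this
    rw [← this]
    exact Finset.sum_congr rfl fun m _ => by rw [hs.apply]
  change ∑ m, G x m l * (1 / 2 * ∑ p, (G x)⁻¹ m p * A p) = 1 / 2 * A l
  calc _ = ∑ m, ∑ p, 1 / 2 * ((G x m l * (G x)⁻¹ m p) * A p) := by
        simp only [Finset.mul_sum]
        exact Finset.sum_congr rfl fun m _ => Finset.sum_congr rfl fun p _ => by ring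
    _ = ∑ p, 1 / 2 * ((∑ m, G x m l * (G x)⁻¹ m p) * A p) := by
        rw [Finset.sum_comm]
        simp only [Finset.mul_sum, Finset.sum_mul]
    _ = _ := by simp only [h1]; simp

theorem metricOn_conn :
    MetricOn ((univ : Set (Fin n → ℝ)) ×ˢ Ioo 0 T) (metricForm g) (conn g) where
  isOpen := isOpen_slab
  smooth_metric z hz := (contDiffOn_metricForm hT hg).contDiffAt (slab_mem_nhds hz)
  smooth_conn z hz := (contDiffOn_conn hT hg).contDiffAt (slab_mem_nhds hz)
  symm z hz X Y := by
    rw [metricForm_apply, metricForm_apply, Finset.sum_comm]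
    refine Finset.sum_congr rfl fun i _ => Finset.sum_congr rfl fun j _ => ?_
    rw [(hg.2 z.1 z.2 (Ioo_subset_Icc_self hz.2)).1.apply]; ring
  pos z hz X hX := by
    have := (hg.2 z.1 z.2 (Ioo_subset_Icc_self hz.2)).2.dotProduct_mulVec_pos hX
    rw [metricForm_apply]
    simp only [dotProduct, Matrix.mulVec, Finset.mul_sum, Pi.star_apply, star_trivial] at this
    refine this.trans_eq (Finset.sum_congr rfl fun i _ => Finset.sum_congr rfl fun j _ => ?_)
    ring
  torsion z hz X Y := by
    ext k
    rw [conn_apply, conn_apply, Finset.sum_comm]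
    refine Finset.sum_congr rfl fun i _ => Finset.sum_congr rfl fun j _ => ?_
    rw [christoffel_symm fun y => (hg.2 y z.2 (Ioo_subset_Icc_self hz.2)).1]; ring
  compat z hz X Y Z := by
    have hG := fun y => hg.2 y z.2 (Ioo_subset_Icc_self hz.2)
    have hd : ∀ i j, DifferentiableAt ℝ (fun p : (Fin n → ℝ) × ℝ => g p.1 p.2 i j) z := fun i j =>
      ((hg.1 i j).contDiffAt (slab_mem_nhds hz)).differentiableAt (by simp)
    have key : ∀ i j l : Fin n, fderiv ℝ (metricForm g) z (Pi.single i 1, 0) (Pi.single j 1)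
        (Pi.single l 1) = metricForm g z (conn g z (Pi.single i 1) (Pi.single j 1)) (Pi.single l 1)
          + metricForm g z (Pi.single j 1) (conn g z (Pi.single i 1) (Pi.single l 1)) := by
      intro i j l
      have e1 : ∀ (W : Fin n → ℝ) (l : Fin n), metricForm g z W (Pi.single l 1) =
          ∑ m, g z.1 z.2 m l * W m := fun W l => by
        rw [metricForm_apply]
        refine Finset.sum_congr rfl fun m _ => ?_
        simp [Pi.single_apply]
      have e2 : ∀ (W : Fin n → ℝ) (l : Fin n), metricForm g z (Pi.single l 1) W =
          ∑ m, g z.1 z.2 m l * W m := fun W l => by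
        rw [metricForm_apply, Finset.sum_comm]
        refine Finset.sum_congr rfl fun m _ => ?_
        simp [Pi.single_apply, (hG z.1).1.apply m l]
      rw [e1, e2]
      simp only [conn_single]
      rw [sum_christoffel (G := fun y => g y z.2) (hG z.1).1 (hG z.1).2,
        sum_christoffel (G := fun y => g y z.2) (hG z.1).1 (hG z.1).2, fderiv_metricForm hg hz]
      rw [Finset.sum_eq_single j (by simp +contextual [Pi.single_apply]) (by simp),
        Finset.sum_eq_single l (by simp +contextual [Pi.single_apply]) (by simp),
        fderiv_slice (hd j l)]
      have hs : ∀ a b : Fin n, (fun y => g y z.2 a b) = fun y => g y z.2 b a := fun a b => by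
        ext y; exact (hG y).1.apply b a
      simp only [Pi.single_eq_same, mul_one, hs l j, pd]
      ring
    conv_lhs => rw [pi_eq_sum_single X, pi_eq_sum_single Y, pi_eq_sum_single Z]
    conv_rhs => rw [pi_eq_sum_single X, pi_eq_sum_single Y, pi_eq_sum_single Z]
    have hX0 : ((∑ i, X i • Pi.single i (1 : ℝ) : Fin n → ℝ), (0 : ℝ)) =
        ∑ i, X i • ((Pi.single i (1 : ℝ) : Fin n → ℝ), (0 : ℝ)) := by
      rw [Prod.ext_iff]; simp [Prod.fst_sum, Prod.snd_sum]
    rw [hX0]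
    simp only [map_sum, map_smul, Hom.sum_apply, Hom.smul_apply, _root_.sum_apply,
      _root_.smul_apply, key, smul_add, Finset.sum_add_distrib]
    congr 1
    refine Finset.sum_congr rfl fun l _ => ?_
    simp only [Finset.smul_sum]
    rw [Finset.sum_comm]
    refine Finset.sum_congr rfl fun i _ => Finset.sum_congr rfl fun j _ => ?_
    rw [smul_comm (Y j)]

end Bridge

section CurvatureBridge
variable {n : ℕ} {g : (Fin n → ℝ) → ℝ → Matrix (Fin n) (Fin n) ℝ} {z : (Fin n → ℝ) × ℝ} {T : ℝ}

theorem bilin_expand {W : Type*} [AddCommMonoid W] [Module ℝ W] (b : (Fin n → ℝ) → (Fin n → ℝ) → W)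
    (h1 : ∀ (c : Fin n → ℝ) Y, b (∑ i, c i • Pi.single i 1) Y = ∑ i, c i • b (Pi.single i 1) Y)
    (h2 : ∀ (c : Fin n → ℝ) X, b X (∑ i, c i • Pi.single i 1) = ∑ i, c i • b X (Pi.single i 1))
    (X Y : Fin n → ℝ) : b X Y = ∑ i, ∑ j, X i • Y j • b (Pi.single i 1) (Pi.single j 1) := by
  conv_lhs => rw [pi_eq_sum_single X, pi_eq_sum_single Y, h1]
  simp only [h2, Finset.smul_sum]

theorem form_expand (S : Form (Fin n → ℝ)) (X Y : Fin n → ℝ) :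
    S X Y = ∑ i, ∑ j, S (Pi.single i 1) (Pi.single j 1) * X i * Y j := by
  rw [bilin_expand (fun X Y => S X Y) (by simp) (by simp) X Y]
  exact Finset.sum_congr rfl fun i _ => Finset.sum_congr rfl fun j _ => by
    simp only [smul_eq_mul]; ring

variable (hT : 0 < T) (hg : SmoothMetricFamily g (Icc 0 T))
  (hz : z ∈ (univ : Set (Fin n → ℝ)) ×ˢ Ioo 0 T)
include hT hg hz

theorem curv_conn_single (i j k m : Fin n) :
    curv (conn g) z (Pi.single i 1) (Pi.single j 1) (Pi.single k 1) m =
      pd (fun y => christoffel (fun y => g y z.2) y m j k) i z.1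
        - pd (fun y => christoffel (fun y => g y z.2) y m i k) j z.1
      + ∑ p, (christoffel (fun y => g y z.2) z.1 m i p * christoffel (fun y => g y z.2) z.1 p j k
            - christoffel (fun y => g y z.2) z.1 m j p
              * christoffel (fun y => g y z.2) z.1 p i k) := by
  have hd : ∀ k i j, DifferentiableAt ℝ (fun p : (Fin n → ℝ) × ℝ =>
      christoffel (fun y => g y p.2) p.1 k i j) z := fun k i j =>
    ((contDiffOn_christoffel hT hg k i j).contDiffAt (slab_mem_nhds hz)).differentiableAt (by simp)
  have h1 : ∀ i j k : Fin n, fderiv ℝ (conn g) z (Pi.single i 1, 0) (Pi.single j 1)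
      (Pi.single k 1) m = pd (fun y => christoffel (fun y => g y z.2) y m j k) i z.1 := by
    intro i j k
    rw [fderiv_conn hT hg hz, Finset.sum_eq_single j (by simp +contextual [Pi.single_apply])
      (by simp), Finset.sum_eq_single k (by simp +contextual [Pi.single_apply]) (by simp),
      fderiv_slice (hd m j k)]
    simp [pd]
  have h2 : ∀ (W : Fin n → ℝ) (i : Fin n), conn g z (Pi.single i 1) W m =
      ∑ p, christoffel (fun y => g y z.2) z.1 m i p * W p := fun W i => by
    rw [conn_apply, Finset.sum_eq_single i (by simp +contextual [Pi.single_apply]) (by simp)]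
    simp
  rw [curv_apply, curvEnd]
  simp only [_root_.add_apply, _root_.sub_apply, Pi.add_apply, Pi.sub_apply, h1,
    ContinuousLinearMap.comp_apply, h2, conn_single, Finset.sum_sub_distrib]

theorem riemann_eq (i j k l : Fin n) :
    metricForm g z (curv (conn g) z (Pi.single i 1) (Pi.single j 1) (Pi.single k 1))
      (Pi.single l 1) = riemann (fun y => g y z.2) z.1 i j k l := by
  rw [(metricOn_conn hT hg).symm z hz, metricForm_apply,
    Finset.sum_eq_single l (by simp +contextual [Pi.single_apply]) (by simp)]
  simp only [curv_conn_single hT hg hz, riemann, Pi.single_eq_same, mul_one]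

theorem traceTen_single (j k : Fin n) :
    traceTen (curv (conn g) z) (Pi.single j 1) (Pi.single k 1) =
      ricci (fun y => g y z.2) z.1 j k := by
  rw [traceTen_apply, LinearMap.trace_eq_matrix_trace ℝ (Pi.basisFun ℝ (Fin n)), Matrix.trace]
  refine Finset.sum_congr rfl fun i _ => ?_
  rw [Matrix.diag_apply, LinearMap.toMatrix_apply, Pi.basisFun_repr, Pi.basisFun_apply]
  exact curv_conn_single hT hg hz i j k i

theorem flow_metricForm (hfl : IsRicciFlow g (Icc 0 T)) :
    fderiv ℝ (metricForm g) z (0, 1) = (-2 : ℝ) • traceTen (curv (conn g) z) := by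
  have hd : ∀ i j, DifferentiableAt ℝ (fun p : (Fin n → ℝ) × ℝ => g p.1 p.2 i j) z := fun i j =>
    ((hg.1 i j).contDiffAt (slab_mem_nhds hz)).differentiableAt (by simp)
  ext X Y
  rw [fderiv_metricForm hg hz, Hom.smul_apply, Hom.smul_apply, form_expand, smul_eq_mul,
    Finset.mul_sum]
  simp only [Finset.mul_sum]
  refine Finset.sum_congr rfl fun i _ => Finset.sum_congr rfl fun j _ => ?_
  have h1 : HasDerivAt (fun s => g z.1 s i j)
      (fderiv ℝ (fun p : (Fin n → ℝ) × ℝ => g p.1 p.2 i j) z (0, 1)) z.2 :=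
    HasFDerivAt.comp_hasDerivAt (f := fun s : ℝ => (z.1, s)) z.2 (hd i j).hasFDerivAt
      ((hasDerivAt_const z.2 z.1).prodMk (hasDerivAt_id z.2))
  have h2 := hfl z.1 z.2 (Ioo_subset_Icc_self hz.2) i j
  rw [h1.hasDerivWithinAt.derivWithin (uniqueDiffOn_Icc hT _ (Ioo_subset_Icc_self hz.2))] at h2
  rw [h2, traceTen_single hT hg hz]
  ring

end CurvatureBridge

section NormSq
variable {n : ℕ}

/-- Squared norm of the Riemann tensor. -/
def riemNormSq (G : (Fin n → ℝ) → Matrix (Fin n) (Fin n) ℝ) (x : Fin n → ℝ) : ℝ :=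
  ∑ i, ∑ j, ∑ k, ∑ l, ∑ a, ∑ b, ∑ c, ∑ d,
    (G x)⁻¹ i a * (G x)⁻¹ j b * (G x)⁻¹ k c * (G x)⁻¹ l d *
      riemann G x i j k l * riemann G x a b c d

theorem riemNorm_eq (G : (Fin n → ℝ) → Matrix (Fin n) (Fin n) ℝ) (x : Fin n → ℝ) :
    riemNorm G x = √(riemNormSq G x) := rfl

theorem sum_mul_sum_mul_sum_mul_sum {ι : Type*} [Fintype ι] (f₁ f₂ f₃ f₄ : ι → ℝ) :
    (∑ i, f₁ i) * (∑ i, f₂ i) * (∑ i, f₃ i) * (∑ i, f₄ i) =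
      ∑ I : ι × ι × ι × ι, f₁ I.1 * f₂ I.2.1 * f₃ I.2.2.1 * f₄ I.2.2.2 := by
  simp only [Fintype.sum_prod_type, ← Finset.mul_sum, ← Finset.sum_mul]

theorem contract_frame (R : Fin n → Fin n → Fin n → Fin n → ℝ) (P : Matrix (Fin n) (Fin n) ℝ) :
    ∑ i, ∑ j, ∑ k, ∑ l, ∑ a, ∑ b, ∑ c, ∑ d,
      (P * Pᵀ) i a * (P * Pᵀ) j b * (P * Pᵀ) k c * (P * Pᵀ) l d * R i j k l * R a b c d =
    ∑ I : Fin n × Fin n × Fin n × Fin n, (∑ i, ∑ j, ∑ k, ∑ l,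
      R i j k l * P i I.1 * P j I.2.1 * P k I.2.2.1 * P l I.2.2.2) ^ 2 := by
  set w : (Fin n × Fin n × Fin n × Fin n) → (Fin n × Fin n × Fin n × Fin n) → ℝ := fun A I =>
    P A.1 I.1 * P A.2.1 I.2.1 * P A.2.2.1 I.2.2.1 * P A.2.2.2 I.2.2.2 with hw
  have h1 : ∀ A B : Fin n × Fin n × Fin n × Fin n, (P * Pᵀ) A.1 B.1 * (P * Pᵀ) A.2.1 B.2.1 *
      (P * Pᵀ) A.2.2.1 B.2.2.1 * (P * Pᵀ) A.2.2.2 B.2.2.2 = ∑ I, w A I * w B I := by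
    intro A B
    simp only [Matrix.mul_apply, Matrix.transpose_apply, hw]
    rw [sum_mul_sum_mul_sum_mul_sum]
    exact Finset.sum_congr rfl fun I _ => by ring
  have h2 : ∑ A : Fin n × Fin n × Fin n × Fin n, ∑ B : Fin n × Fin n × Fin n × Fin n,
      (P * Pᵀ) A.1 B.1 * (P * Pᵀ) A.2.1 B.2.1 * (P * Pᵀ) A.2.2.1 B.2.2.1 * (P * Pᵀ) A.2.2.2 B.2.2.2
        * R A.1 A.2.1 A.2.2.1 A.2.2.2 * R B.1 B.2.1 B.2.2.1 B.2.2.2 =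
      ∑ I, (∑ A : Fin n × Fin n × Fin n × Fin n, R A.1 A.2.1 A.2.2.1 A.2.2.2 * w A I) ^ 2 := by
    simp only [h1, pow_two, Finset.sum_mul_sum, Finset.sum_mul]
    conv_rhs => rw [Finset.sum_comm]
    refine Finset.sum_congr rfl fun A _ => ?_
    rw [Finset.sum_comm]
    refine Finset.sum_congr rfl fun I _ => ?_
    rw [Finset.mul_sum]
    exact Finset.sum_congr rfl fun B _ => by ring
  simp only [hw, Fintype.sum_prod_type, ← mul_assoc] at h2 ⊢
  exact h2

variable {g : (Fin n → ℝ) → ℝ → Matrix (Fin n) (Fin n) ℝ} {z : (Fin n → ℝ) × ℝ} {T : ℝ}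

theorem metricForm_symm (hg : SmoothMetricFamily g (Icc 0 T)) (hz : z.2 ∈ Icc 0 T)
    (X Y : Fin n → ℝ) : metricForm g z X Y = metricForm g z Y X := by
  rw [metricForm_apply, metricForm_apply, Finset.sum_comm]
  refine Finset.sum_congr rfl fun i _ => Finset.sum_congr rfl fun j _ => ?_
  rw [(hg.2 z.1 z.2 hz).1.apply]; ring

theorem metricForm_pos (hg : SmoothMetricFamily g (Icc 0 T)) (hz : z.2 ∈ Icc 0 T)
    {X : Fin n → ℝ} (hX : X ≠ 0) : 0 < metricForm g z X X := by
  have := (hg.2 z.1 z.2 hz).2.dotProduct_mulVec_pos hX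
  rw [metricForm_apply]
  simp only [dotProduct, Matrix.mulVec, Finset.mul_sum, Pi.star_apply, star_trivial] at this
  refine this.trans_eq (Finset.sum_congr rfl fun i _ => Finset.sum_congr rfl fun j _ => ?_)
  ring

theorem inv_eq_frame {e : Module.Basis (Fin n) ℝ (Fin n → ℝ)} (he : IsONB (metricForm g z) e) :
    (g z.1 z.2)⁻¹ = (Matrix.of fun i a => e a i) * (Matrix.of fun i a => e a i)ᵀ := by
  set P : Matrix (Fin n) (Fin n) ℝ := Matrix.of fun i a => e a i with hP
  have h1 : (Pᵀ * g z.1 z.2) * P = 1 := by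
    ext a b
    have := he a b
    rw [metricForm_apply] at this
    rw [Matrix.one_apply, ← this]
    simp only [Matrix.mul_apply, Matrix.transpose_apply, hP, Matrix.of_apply, Finset.sum_mul]
    rw [Finset.sum_comm]
    exact Finset.sum_congr rfl fun i _ => Finset.sum_congr rfl fun j _ => by ring
  have h2 := mul_eq_one_comm.1 h1
  exact Matrix.inv_eq_left_inv (by rw [Matrix.mul_assoc]; exact h2)

theorem riemNormSq_eq_frame {e : Module.Basis (Fin n) ℝ (Fin n → ℝ)}
    (he : IsONB (metricForm g z) e) : riemNormSq (fun y => g y z.2) z.1 =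
    ∑ I : Fin n × Fin n × Fin n × Fin n, (∑ i, ∑ j, ∑ k, ∑ l,
      riemann (fun y => g y z.2) z.1 i j k l * e I.1 i * e I.2.1 j * e I.2.2.1 k
        * e I.2.2.2 l) ^ 2 := by
  rw [riemNormSq]
  simp only [inv_eq_frame he]
  exact contract_frame _ _

theorem riemNormSq_nonneg (hg : SmoothMetricFamily g (Icc 0 T)) (hz : z.2 ∈ Icc 0 T) :
    0 ≤ riemNormSq (fun y => g y z.2) z.1 := by
  obtain ⟨e, he⟩ := IsONB.exists (G := metricForm g z) (ι := Fin n) (metricForm_symm hg hz)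
    (fun X hX => metricForm_pos hg hz hX) (by simp)
  rw [riemNormSq_eq_frame he]
  positivity

theorem metricForm_curv_expand (hT : 0 < T) (hg : SmoothMetricFamily g (Icc 0 T))
    (hz : z ∈ (univ : Set (Fin n → ℝ)) ×ˢ Ioo 0 T) (A B C D : Fin n → ℝ) :
    metricForm g z (curv (conn g) z A B C) D = ∑ i, ∑ j, ∑ k, ∑ l,
      riemann (fun y => g y z.2) z.1 i j k l * A i * B j * C k * D l := by
  set Q : (Fin n → ℝ) → (Fin n → ℝ) → (Fin n → ℝ) → (Fin n → ℝ) → ℝ := fun A B C D =>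
    metricForm g z (curv (conn g) z A B C) D with hQ
  have hA : ∀ A B C D, Q A B C D = ∑ i, A i * Q (Pi.single i 1) B C D := fun A B C D => by
    simp only [hQ]
    conv_lhs => rw [pi_eq_sum_single A]
    simp
  have hB : ∀ A B C D, Q A B C D = ∑ i, B i * Q A (Pi.single i 1) C D := fun A B C D => by
    simp only [hQ]
    conv_lhs => rw [pi_eq_sum_single B]
    simp
  have hC : ∀ A B C D, Q A B C D = ∑ i, C i * Q A B (Pi.single i 1) D := fun A B C D => by
    simp only [hQ]
    conv_lhs => rw [pi_eq_sum_single C]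
    simp
  have hD : ∀ A B C D, Q A B C D = ∑ i, D i * Q A B C (Pi.single i 1) := fun A B C D => by
    simp only [hQ]
    conv_lhs => rw [pi_eq_sum_single D]
    simp
  change Q A B C D = _
  rw [hA]
  refine Finset.sum_congr rfl fun i _ => ?_
  rw [hB, Finset.mul_sum]
  refine Finset.sum_congr rfl fun j _ => ?_
  rw [hC, Finset.mul_sum, Finset.mul_sum]
  refine Finset.sum_congr rfl fun k _ => ?_
  rw [hD, Finset.mul_sum, Finset.mul_sum, Finset.mul_sum]
  refine Finset.sum_congr rfl fun l _ => ?_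
  rw [← riemann_eq hT hg hz]
  ring

theorem isCurvNormSq_riemNormSq (hT : 0 < T) (hg : SmoothMetricFamily g (Icc 0 T)) :
    IsCurvNormSq (metricForm g) (conn g) ((univ : Set (Fin n → ℝ)) ×ˢ Ioo 0 T)
      (fun z => riemNormSq (fun y => g y z.2) z.1) := by
  intro z hz e he
  simp only [riemNormSq_eq_frame he, metricForm_curv_expand hT hg hz]

theorem contDiffOn_riemNormSq (hT : 0 < T) (hg : SmoothMetricFamily g (Icc 0 T)) :
    ContDiffOn ℝ ∞ (fun z : (Fin n → ℝ) × ℝ => riemNormSq (fun y => g y z.2) z.1)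
      (univ ×ˢ Icc 0 T) := by
  have hI := contDiffOn_matrix_inv hg.1 (fun p hp => (hg.2 p.1 p.2 hp.2).2.det_pos.ne')
  have hR := contDiffOn_riemann hT hg
  simp only [riemNormSq]
  exact ContDiffOn.sum fun i _ => ContDiffOn.sum fun j _ => ContDiffOn.sum fun k _ =>
    ContDiffOn.sum fun l _ => ContDiffOn.sum fun a _ => ContDiffOn.sum fun b _ =>
    ContDiffOn.sum fun c _ => ContDiffOn.sum fun d _ => (((((hI i a).mul (hI j b)).mul
      (hI k c)).mul (hI l d)).mul (hR i j k l)).mul (hR a b c d)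

end NormSq

section UniformTaylor
variable {Z : Type*} [NormedAddCommGroup Z] [NormedSpace ℝ Z] {k : Z × ℝ → ℝ} {S : Set Z}

/-- Derivative in the last variable. -/
def lastDeriv (k : Z × ℝ → ℝ) (p : Z × ℝ) : ℝ := fderiv ℝ k p (0, 1)

theorem hasDerivAt_last {z : Z} {h : ℝ} (hk : DifferentiableAt ℝ k (z, h)) :
    HasDerivAt (fun h => k (z, h)) (lastDeriv k (z, h)) h :=
  HasFDerivAt.comp_hasDerivAt (f := fun h : ℝ => (z, h)) h hk.hasFDerivAt
    ((hasDerivAt_const h z).prodMk (hasDerivAt_id h))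

theorem contDiffAt_lastDeriv {p : Z × ℝ} (hk : ContDiffAt ℝ ∞ k p) :
    ContDiffAt ℝ ∞ (lastDeriv k) p :=
  (hk.fderiv_right (m := ∞) (by simp)).clm_apply contDiffAt_const

theorem eventually_contDiffAt {F W : Type*} [NormedAddCommGroup F] [NormedSpace ℝ F]
    [NormedAddCommGroup W] [NormedSpace ℝ W] {f : F → W} {p : F} (hk : ContDiffAt ℝ ∞ f p) :
    ∀ᶠ q in 𝓝 p, DifferentiableAt ℝ f q := by
  have h1 : ContDiffAt ℝ 1 f p := hk.of_le (by simp)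
  exact (h1.eventually (by simp)).mono fun q hq => hq.differentiableAt (by simp)

theorem lastDeriv_eq_deriv {z : Z} (hk : ContDiffAt ℝ ∞ k (z, 0)) :
    lastDeriv k (z, 0) = deriv (fun h => k (z, h)) 0 :=
  (hasDerivAt_last (hk.differentiableAt (by simp))).deriv.symm

theorem lastDeriv_lastDeriv_eq {z : Z} (hk : ContDiffAt ℝ ∞ k (z, 0)) :
    lastDeriv (lastDeriv k) (z, 0) = deriv (deriv fun h => k (z, h)) 0 := by
  have hc : Filter.Tendsto (fun h : ℝ => (z, h)) (𝓝 0) (𝓝 (z, 0)) :=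
    (Continuous.prodMk_right z).tendsto 0
  have : (deriv fun h => k (z, h)) =ᶠ[𝓝 0] fun h => lastDeriv k (z, h) := by
    filter_upwards [hc.eventually (eventually_contDiffAt hk)] with h hh
    exact (hasDerivAt_last hh).deriv
  rw [this.deriv_eq, (hasDerivAt_last ((contDiffAt_lastDeriv hk).differentiableAt (by simp))).deriv]

theorem exists_uniform_deriv (hS : IsCompact S) (hk : ∀ z ∈ S, ContDiffAt ℝ ∞ k (z, 0))
    {η : ℝ} (hη : 0 < η) : ∃ ρ > 0, ∀ z ∈ S, ∀ h : ℝ, |h| ≤ ρ → DifferentiableAt ℝ k (z, h) ∧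
      |lastDeriv k (z, h) - lastDeriv k (z, 0)| ≤ η := by
  have h1 : ∀ᶠ h : ℝ in 𝓝 0, ∀ z ∈ S, DifferentiableAt ℝ k (z, h) ∧
      |lastDeriv k (z, h) - lastDeriv k (z, 0)| ≤ η := by
    refine hS.eventually_forall_of_forall_eventually fun z hz => ?_
    have hsw : Filter.Tendsto (fun p : ℝ × Z => (p.2, p.1)) (𝓝 (0, z)) (𝓝 (z, 0)) :=
      continuous_swap.tendsto _
    have hs0 : Filter.Tendsto (fun p : ℝ × Z => (p.2, (0 : ℝ))) (𝓝 (0, z)) (𝓝 (z, 0)) :=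
      Continuous.tendsto (by fun_prop) _
    have hc := (contDiffAt_lastDeriv (hk z hz)).continuousAt
    have h2 : Filter.Tendsto (fun p : ℝ × Z => lastDeriv k (p.2, p.1) - lastDeriv k (p.2, 0))
        (𝓝 (0, z)) (𝓝 0) := by
      have := (hc.tendsto.comp hsw).sub (hc.tendsto.comp hs0)
      rwa [sub_self] at this
    filter_upwards [hsw.eventually (eventually_contDiffAt (hk z hz)),
      h2.eventually (Metric.ball_mem_nhds 0 hη)] with p hp hp'
    have hp' : dist _ (0 : ℝ) < η := hp'
    rw [dist_zero_right, Real.norm_eq_abs] at hp'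
    exact ⟨hp, hp'.le⟩
  obtain ⟨ε, hε, h⟩ := Metric.eventually_nhds_iff.1 h1
  refine ⟨ε / 2, by positivity, fun z hz h' hh => h (y := h') ?_ z hz⟩
  rw [dist_zero_right, Real.norm_eq_abs]
  linarith

theorem abs_sub_le_of_deriv {f f' : ℝ → ℝ} {h η : ℝ}
    (hf : ∀ u, |u| ≤ |h| → HasDerivAt f (f' u) u) (hb : ∀ u, |u| ≤ |h| → |f' u| ≤ η) :
    |f h - f 0| ≤ η * |h| := by
  have := (convex_Icc (-|h|) |h|).norm_image_sub_le_of_norm_hasDerivWithin_le (f := f) (f' := f')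
    (C := η) (x := 0) (y := h) (fun u hu => (hf u (abs_le.2 (mem_Icc.1 hu))).hasDerivWithinAt)
    (fun u hu => hb u (abs_le.2 (mem_Icc.1 hu))) (mem_Icc.2 (by simp))
    (mem_Icc.2 (abs_le.1 le_rfl))
  simpa using this

/-- First order Taylor expansion, uniformly on a compact set of parameters. -/
theorem exists_uniform_taylor_one (hS : IsCompact S) (hk : ∀ z ∈ S, ContDiffAt ℝ ∞ k (z, 0))
    {η : ℝ} (hη : 0 < η) : ∃ ρ > 0, ∀ z ∈ S, ∀ h : ℝ, |h| ≤ ρ →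
      |k (z, h) - k (z, 0) - h * lastDeriv k (z, 0)| ≤ η * |h| := by
  obtain ⟨ρ, hρ, H⟩ := exists_uniform_deriv hS hk hη
  refine ⟨ρ, hρ, fun z hz h hh => ?_⟩
  have := abs_sub_le_of_deriv (f := fun h => k (z, h) - h * lastDeriv k (z, 0))
    (f' := fun h => lastDeriv k (z, h) - lastDeriv k (z, 0)) (h := h) (η := η)
    (fun u hu => ((hasDerivAt_last (H z hz u (hu.trans hh)).1).sub
        ((hasDerivAt_id u).mul_const (lastDeriv k (z, 0)))).congr_deriv (by rw [one_mul]))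
    (fun u hu => (H z hz u (hu.trans hh)).2)
  refine le_trans (le_of_eq ?_) this
  congr 1; ring

/-- Second order Taylor expansion, uniformly on a compact set of parameters. -/
theorem exists_uniform_taylor_two (hS : IsCompact S) (hk : ∀ z ∈ S, ContDiffAt ℝ ∞ k (z, 0))
    {η : ℝ} (hη : 0 < η) : ∃ ρ > 0, ∀ z ∈ S, ∀ h : ℝ, |h| ≤ ρ →
      |k (z, h) - k (z, 0) - h * lastDeriv k (z, 0)
        - h ^ 2 / 2 * lastDeriv (lastDeriv k) (z, 0)| ≤ η * h ^ 2 := by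
  obtain ⟨ρ, hρ, H⟩ := exists_uniform_deriv hS hk hη
  obtain ⟨ρ', hρ', H'⟩ := exists_uniform_taylor_one hS
    (fun z hz => contDiffAt_lastDeriv (hk z hz)) hη
  refine ⟨min ρ ρ', lt_min hρ hρ', fun z hz h hh => ?_⟩
  have := abs_sub_le_of_deriv (f := fun h => k (z, h) - h * lastDeriv k (z, 0)
      - h ^ 2 / 2 * lastDeriv (lastDeriv k) (z, 0))
    (f' := fun h => lastDeriv k (z, h) - lastDeriv k (z, 0)
      - h * lastDeriv (lastDeriv k) (z, 0)) (h := h) (η := η * |h|)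
    (fun u hu => by
      have h1 := ((hasDerivAt_last (H z hz u (hu.trans (hh.trans (min_le_left _ _)))).1).sub
        ((hasDerivAt_id u).mul_const (lastDeriv k (z, 0)))).sub
        ((((hasDerivAt_id u).fun_pow 2).div_const 2).mul_const (lastDeriv (lastDeriv k) (z, 0)))
      refine h1.congr_deriv ?_
      simp)
    (fun u hu => (H' z hz u (hu.trans (hh.trans (min_le_right _ _)))).trans (by gcongr))
  rw [mul_assoc, ← pow_two, sq_abs] at this
  refine le_trans (le_of_eq ?_) this
  congr 1; ring

end UniformTaylor

section SecondVariation
variable {ι : Type*} [Fintype ι] [DecidableEq ι]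
variable {Ω : Set ((ι → ℝ) × ℝ)} {g : (ι → ℝ) × ℝ → Form (ι → ℝ)}
  {Γ : (ι → ℝ) × ℝ → (ι → ℝ) →L[ℝ] (ι → ℝ) →L[ℝ] (ι → ℝ)}

/-- The derivative in `s` of `geo Γ (γ s) t (V s) h`, where `v` and `W` are the derivatives of
`γ` and `V`. -/
def geoVel (Γ : (ι → ℝ) × ℝ → (ι → ℝ) →L[ℝ] (ι → ℝ) →L[ℝ] (ι → ℝ)) (x : ι → ℝ) (t : ℝ)
    (v V W : ι → ℝ) (h : ℝ) : ι → ℝ :=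
  v + h • W - (h ^ 2 / 2) • (fderiv ℝ Γ (x, t) (v, 0) V V + Γ (x, t) W V + Γ (x, t) V W)

theorem hasDerivAt_conn_apply {E : Type*} [NormedAddCommGroup E] [NormedSpace ℝ E]
    {Γ : E × ℝ → E →L[ℝ] E →L[ℝ] E} {γ V : ℝ → E} {v W : E} {t s : ℝ}
    (hΓ : ContDiffAt ℝ ∞ Γ (γ s, t)) (hγ : HasDerivAt γ v s) (hV : HasDerivAt V W s) :
    HasDerivAt (fun s => Γ (γ s, t) (V s) (V s)) (fderiv ℝ Γ (γ s, t) (v, 0) (V s) (V s)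
      + Γ (γ s, t) W (V s) + Γ (γ s, t) (V s) W) s := by
  have hp : HasDerivAt (fun s => (γ s, t)) (v, 0) s := hγ.prodMk (hasDerivAt_const s t)
  have hc := (hΓ.differentiableAt (by simp)).hasFDerivAt.comp_hasDerivAt s hp
  exact (hc.clm_apply hV).clm_apply hV

theorem hasDerivAt_geo_path {γ V : ℝ → ι → ℝ} {v W : ι → ℝ} {t s h : ℝ}
    (hΓ : ContDiffAt ℝ ∞ Γ (γ s, t)) (hγ : HasDerivAt γ v s) (hV : HasDerivAt V W s) :
    HasDerivAt (fun s => geo Γ (γ s) t (V s) h) (geoVel Γ (γ s) t v (V s) W h) s :=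
  ((hγ.add (hV.const_smul h)).sub ((hasDerivAt_conn_apply hΓ hγ hV).const_smul (h ^ 2 / 2)))

theorem hasDerivAt_geoVel (x : ι → ℝ) (t : ℝ) (v V W : ι → ℝ) (h : ℝ) :
    HasDerivAt (geoVel Γ x t v V W)
      (W - h • (fderiv ℝ Γ (x, t) (v, 0) V V + Γ (x, t) W V + Γ (x, t) V W)) h := by
  have h1 := ((hasDerivAt_id h).smul_const W).const_add v
  have h2 := (((hasDerivAt_id h).pow 2).div_const 2).smul_const
    (fderiv ℝ Γ (x, t) (v, 0) V V + Γ (x, t) W V + Γ (x, t) V W)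
  refine (h1.sub h2).congr_deriv ?_
  simp

/-- Covariant derivative of the velocity field of the variation in the direction of the
variation. -/
def geoVelCov (Γ : (ι → ℝ) × ℝ → (ι → ℝ) →L[ℝ] (ι → ℝ) →L[ℝ] (ι → ℝ)) (x : ι → ℝ) (t : ℝ)
    (v V W : ι → ℝ) (h : ℝ) : ι → ℝ :=
  W - h • (fderiv ℝ Γ (x, t) (v, 0) V V + Γ (x, t) W V + Γ (x, t) V W)
    + Γ (geo Γ x t V h, t) (V - h • Γ (x, t) V V) (geoVel Γ x t v V W h)

variable (M : MetricOn Ω g Γ) {x : ι → ℝ} {t : ℝ} (hΩ : ∀ y, (y, t) ∈ Ω) (v V W : ι → ℝ)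
include M hΩ

theorem MetricOn.hasDerivAt_energy (h : ℝ) :
    HasDerivAt (fun h => g (geo Γ x t V h, t) (geoVel Γ x t v V W h) (geoVel Γ x t v V W h))
      (2 * g (geo Γ x t V h, t) (geoVelCov Γ x t v V W h) (geoVel Γ x t v V W h)) h := by
  refine (M.hasDerivAt_metric_space (c := fun h => (geo Γ x t V h, t))
    ((hasDerivAt_geo x t V h).prodMk (hasDerivAt_const h t)) (hΩ _)
    (hasDerivAt_geoVel x t v V W h) (hasDerivAt_geoVel x t v V W h)).congr_deriv ?_
  rw [M.symm _ (hΩ _) (geoVel Γ x t v V W h)]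
  simp only [geoVelCov]
  ring

theorem MetricOn.deriv_energy_zero :
    deriv (fun h => g (geo Γ x t V h, t) (geoVel Γ x t v V W h) (geoVel Γ x t v V W h)) 0 =
      2 * g (x, t) (W + Γ (x, t) V v) v := by
  rw [(M.hasDerivAt_energy hΩ v V W 0).deriv]
  simp [geoVelCov, geo, geoVel]

theorem MetricOn.deriv_deriv_energy_zero :
    deriv (deriv fun h =>
      g (geo Γ x t V h, t) (geoVel Γ x t v V W h) (geoVel Γ x t v V W h)) 0 =
      2 * (g (x, t) (W + Γ (x, t) V v) (W + Γ (x, t) V v)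
        - g (x, t) (curv Γ (x, t) V v v) V) := by
  have h0 : geo Γ x t V 0 = x := by simp [geo]
  have h0' : geoVel Γ x t v V W 0 = v := by simp [geoVel]
  have hN0 : geoVelCov Γ x t v V W 0 = W + Γ (x, t) V v := by simp [geoVelCov, h0, h0']
  have hc : HasDerivAt (fun h => (geo Γ x t V h, t)) (V, 0) 0 := by
    simpa using (hasDerivAt_geo (Γ := Γ) x t V 0).prodMk (hasDerivAt_const 0 t)
  have hv : HasDerivAt (geoVel Γ x t v V W) W 0 := by
    simpa using hasDerivAt_geoVel (Γ := Γ) x t v V W 0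
  have hΓ : HasDerivAt (fun h => Γ (geo Γ x t V h, t)) (fderiv ℝ Γ (x, t) (V, 0)) 0 := by
    have hd := ((M.smooth_conn (geo Γ x t V 0, t) (hΩ _)).differentiableAt
      (by simp)).hasFDerivAt.comp_hasDerivAt (f := fun h => (geo Γ x t V h, t)) 0 hc
    rwa [h0] at hd
  set A := fderiv ℝ Γ (x, t) (v, 0) V V + Γ (x, t) W V + Γ (x, t) V W with hA
  have h1 : HasDerivAt (fun h : ℝ => W - h • A) (-A) 0 := by
    simpa using ((hasDerivAt_id (0 : ℝ)).smul_const A).const_sub W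
  have h2 : HasDerivAt (fun h : ℝ => V - h • Γ (x, t) V V) (-Γ (x, t) V V) 0 := by
    simpa using ((hasDerivAt_id (0 : ℝ)).smul_const (Γ (x, t) V V)).const_sub V
  have hN : HasDerivAt (geoVelCov Γ x t v V W) (-A + (fderiv ℝ Γ (x, t) (V, 0) V v
      - Γ (x, t) (Γ (x, t) V V) v + Γ (x, t) V W)) 0 := by
    refine (h1.add ((hΓ.clm_apply h2).clm_apply hv)).congr_deriv ?_
    simp only [_root_.add_apply, h0, h0', map_neg, _root_.neg_apply, zero_smul, sub_zero]
    abel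
  have hk : (deriv fun h =>
      g (geo Γ x t V h, t) (geoVel Γ x t v V W h) (geoVel Γ x t v V W h)) = fun h =>
      2 * g (geo Γ x t V h, t) (geoVelCov Γ x t v V W h) (geoVel Γ x t v V W h) :=
    funext fun h => (M.hasDerivAt_energy hΩ v V W h).deriv
  rw [hk, ((M.hasDerivAt_metric_space (c := fun h => (geo Γ x t V h, t)) hc (hΩ _)
    hN hv).const_mul 2).deriv]
  simp only [h0, h0', hN0]
  have e1 : -A + (fderiv ℝ Γ (x, t) (V, 0) V v - Γ (x, t) (Γ (x, t) V V) v + Γ (x, t) V W)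
      + Γ (x, t) V (W + Γ (x, t) V v) = curv Γ (x, t) V v V := by
    have ht : ∀ X Y, Γ (x, t) X Y = Γ (x, t) Y X := M.torsion _ (hΩ x)
    have hd : fderiv ℝ Γ (x, t) (V, 0) V v = fderiv ℝ Γ (x, t) (V, 0) v V :=
      M.fderiv_conn_symm (hΩ x) (V, 0) V v
    rw [curv_apply, curvEnd, hA, hd]
    simp only [_root_.add_apply, _root_.sub_apply, ContinuousLinearMap.comp_apply, map_add]
    rw [ht v (Γ (x, t) V V), ht W V, ht v V]
    abel
  rw [e1, (M.isCurvLike_curv (hΩ x)).skew V v V v, M.symm _ (hΩ x) V]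
  ring

end SecondVariation

section NearMaximum

theorem abs_mul_mul_le {a b c m : ℝ} (ha : |a| ≤ m) (hb : |b| ≤ m) (hc : |c| ≤ m) :
    |a * b * c| ≤ m ^ 3 := by
  have hm : 0 ≤ m := (abs_nonneg a).trans ha
  rw [abs_mul, abs_mul, pow_succ, pow_two]
  gcongr

/-- Expansion of a product `A * P ^ 2` of quadratic polynomials up to third order. -/
theorem abs_quadratic_mul_sq_le {U b k ψ p s h m : ℝ} (hU : |U| ≤ m) (hb : |b| ≤ m) (hk : |k| ≤ m)
    (hψ : |ψ| ≤ m) (hp : |p| ≤ m) (hs : |s| ≤ m) (hh : |h| ≤ 1) :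
    |(U + h * b + h ^ 2 * k) * (ψ + h * p + h ^ 2 * s) ^ 2 - (U * ψ ^ 2
      + h * (b * ψ ^ 2 + 2 * U * ψ * p)
      + h ^ 2 * (k * ψ ^ 2 + 2 * b * ψ * p + U * (p ^ 2 + 2 * ψ * s)))| ≤ 17 * m ^ 3 * |h| ^ 3 := by
  have hm : 0 ≤ m := (abs_nonneg _).trans hU
  have hx : ∀ {x : ℝ}, |x| ≤ m → |h * x| ≤ m := fun hx => by
    rw [abs_mul]; exact (mul_le_mul hh hx (abs_nonneg _) zero_le_one).trans_eq (one_mul m)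
  have e : (U + h * b + h ^ 2 * k) * (ψ + h * p + h ^ 2 * s) ^ 2 - (U * ψ ^ 2
      + h * (b * ψ ^ 2 + 2 * U * ψ * p)
      + h ^ 2 * (k * ψ ^ 2 + 2 * b * ψ * p + U * (p ^ 2 + 2 * ψ * s))) =
      (2 * (U * p * s) + U * (h * s) * s + b * p * p + 2 * (b * ψ * s) + 2 * (b * (h * p) * s)
        + b * (h * s) * (h * s) + 2 * (k * ψ * p) + (h * k) * p * p + 2 * ((h * k) * ψ * s)
        + 2 * ((h * k) * (h * p) * s) + (h * k) * (h * s) * (h * s)) * h ^ 3 := by ring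
  rw [e, abs_mul, abs_pow]
  refine mul_le_mul_of_nonneg_right ?_ (by positivity)
  have a1 := abs_le.1 (abs_mul_mul_le hU hp hs)
  have a2 := abs_le.1 (abs_mul_mul_le hU (hx hs) hs)
  have a3 := abs_le.1 (abs_mul_mul_le hb hp hp)
  have a4 := abs_le.1 (abs_mul_mul_le hb hψ hs)
  have a5 := abs_le.1 (abs_mul_mul_le hb (hx hp) hs)
  have a6 := abs_le.1 (abs_mul_mul_le hb (hx hs) (hx hs))
  have a7 := abs_le.1 (abs_mul_mul_le hk hψ hp)
  have a8 := abs_le.1 (abs_mul_mul_le (hx hk) hp hp)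
  have a9 := abs_le.1 (abs_mul_mul_le (hx hk) hψ hs)
  have a10 := abs_le.1 (abs_mul_mul_le (hx hk) (hx hp) hs)
  have a11 := abs_le.1 (abs_mul_mul_le (hx hk) (hx hs) (hx hs))
  have := pow_nonneg hm 3
  rw [abs_le]
  constructor <;> linarith

theorem abs_second_coeff_le {U b k ψ p s m : ℝ} (hU : |U| ≤ m) (hb : |b| ≤ m) (hk : |k| ≤ m)
    (hψ : |ψ| ≤ m) (hp : |p| ≤ m) (hs : |s| ≤ m) :
    |k * ψ ^ 2 + 2 * b * ψ * p + U * (p ^ 2 + 2 * ψ * s)| ≤ 6 * m ^ 3 := by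
  have e : k * ψ ^ 2 + 2 * b * ψ * p + U * (p ^ 2 + 2 * ψ * s) =
    k * ψ * ψ + 2 * (b * ψ * p) + U * p * p + 2 * (U * ψ * s) := by ring
  rw [e]
  have a1 := abs_le.1 (abs_mul_mul_le hk hψ hψ)
  have a2 := abs_le.1 (abs_mul_mul_le hb hψ hp)
  have a3 := abs_le.1 (abs_mul_mul_le hU hp hp)
  have a4 := abs_le.1 (abs_mul_mul_le hU hψ hs)
  rw [abs_le]
  constructor <;> linarith

theorem near_max_aux {r η B c1 c2 : ℝ} (hr0 : 0 < r) (hr1 : r ≤ 1) (hη : 0 < η) (hB0 : 0 < B)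
    (hrB : r * (8 * B) ≤ η) (hc2B : -B ≤ c2)
    (k1 : r * c1 + r ^ 2 * c2 ≤ r ^ 2 * η / 4 + B * r ^ 3)
    (k2 : -r * c1 + r ^ 2 * c2 ≤ r ^ 2 * η / 4 + B * r ^ 3) : |c1| ≤ η ∧ c2 ≤ η / 2 := by
  have h1 : r * (c1 + r * c2) ≤ r * (r * η / 4 + B * r ^ 2) := by linarith
  have h2 : r * (-c1 + r * c2) ≤ r * (r * η / 4 + B * r ^ 2) := by linarith
  replace h1 := le_of_mul_le_mul_left h1 hr0
  replace h2 := le_of_mul_le_mul_left h2 hr0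
  have h3 : r * c2 ≤ r * (η / 4 + B * r) := by linarith
  replace h3 := le_of_mul_le_mul_left h3 hr0
  have h4 : r * -B ≤ r * c2 := mul_le_mul_of_nonneg_left hc2B hr0.le
  have h5 : r * η ≤ 1 * η := mul_le_mul_of_nonneg_right hr1 hη.le
  have h6 : r * (B * r) ≤ 1 * (B * r) := mul_le_mul_of_nonneg_right hr1 (by positivity)
  refine ⟨abs_le.2 ⟨?_, ?_⟩, ?_⟩ <;> linarith

/-- First and second derivative tests at an approximate maximum. -/
theorem near_max_test {M η : ℝ} (hM : 1 ≤ M) (hη : 0 < η) : ∃ η₀ > 0, ∀ ρ > 0, ∃ ε > 0,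
    ∀ U β κ ψ p s : ℝ, |U| ≤ M → |β| ≤ M → |κ| ≤ M → |ψ| ≤ M → |p| ≤ M → |s| ≤ M →
    (∀ h : ℝ, |h| ≤ ρ → (U + h * β + h ^ 2 / 2 * κ - η₀ * h ^ 2) *
      (ψ + h * p + h ^ 2 / 2 * s - η₀ * h ^ 2) ^ 2 ≤ U * ψ ^ 2 + ε) →
    |β * ψ ^ 2 + 2 * U * ψ * p| ≤ η ∧
      κ / 2 * ψ ^ 2 + 2 * β * ψ * p + U * (p ^ 2 + ψ * s) ≤ η := by
  have hM0 : 0 < M := by linarith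
  refine ⟨min 1 (η / (6 * M ^ 2)), by positivity, fun ρ hρ => ?_⟩
  set η₀ := min 1 (η / (6 * M ^ 2)) with hη₀
  have hη₁ : 0 < η₀ := by positivity
  have hη₂ : η₀ ≤ 1 := min_le_left _ _
  have hη₃ : η₀ * (6 * M ^ 2) ≤ η := by
    rw [← le_div_iff₀ (by positivity)]; exact min_le_right _ _
  set B := 17 * (2 * M) ^ 3 with hB
  have hB0 : 0 < B := by positivity
  set r := min (min ρ 1) (η / (8 * B)) with hr
  have hr0 : 0 < r := by positivity
  have hr1 : r ≤ 1 := (min_le_left _ _).trans (min_le_right _ _)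
  have hrρ : r ≤ ρ := (min_le_left _ _).trans (min_le_left _ _)
  have hrB : r * (8 * B) ≤ η := by
    rw [← le_div_iff₀ (by positivity)]; exact min_le_right _ _
  refine ⟨r ^ 2 * η / 4, by positivity, fun U β κ ψ p s hU hβ hκ hψ hp hs H => ?_⟩
  have d : ∀ {x : ℝ}, |x| ≤ M → |x| ≤ 2 * M := fun hx => by linarith
  have d' : ∀ {x : ℝ}, |x| ≤ M → |x / 2 - η₀| ≤ 2 * M := fun {x} hx => by
    rw [abs_le] at hx ⊢; constructor <;> linarith
  set c1 := β * ψ ^ 2 + 2 * U * ψ * p with hc1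
  set c2 := (κ / 2 - η₀) * ψ ^ 2 + 2 * β * ψ * p + U * (p ^ 2 + 2 * ψ * (s / 2 - η₀)) with hc2
  have key : ∀ h : ℝ, |h| = r → h * c1 + h ^ 2 * c2 ≤ r ^ 2 * η / 4 + B * r ^ 3 := by
    intro h hh
    have h1 := H h (hh.le.trans hrρ)
    have h2 := (abs_le.1 (abs_quadratic_mul_sq_le (h := h) (d hU) (d hβ) (d' hκ) (d hψ) (d hp)
      (d' hs) (hh.le.trans hr1))).1
    rw [hh, ← hc1, ← hc2, ← hB] at h2
    have e : (U + h * β + h ^ 2 / 2 * κ - η₀ * h ^ 2) *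
      (ψ + h * p + h ^ 2 / 2 * s - η₀ * h ^ 2) ^ 2 = (U + h * β + h ^ 2 * (κ / 2 - η₀)) *
        (ψ + h * p + h ^ 2 * (s / 2 - η₀)) ^ 2 := by ring
    rw [e] at h1
    generalize (U + h * β + h ^ 2 * (κ / 2 - η₀)) *
        (ψ + h * p + h ^ 2 * (s / 2 - η₀)) ^ 2 = X at h1 h2
    linarith
  have k1 := key r (abs_of_pos hr0)
  have k2 := key (-r) (by rw [abs_neg, abs_of_pos hr0])
  have hc2' := (abs_le.1 (abs_second_coeff_le (d hU) (d hβ) (d' hκ) (d hψ) (d hp) (d' hs))).1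
  have hc2B : -B ≤ c2 := by
    have : (0 : ℝ) ≤ (2 * M) ^ 3 := by positivity
    rw [← hc2] at hc2'
    linarith
  rw [neg_sq] at k2
  obtain ⟨hc1', h1⟩ := near_max_aux hr0 hr1 hη hB0 hrB hc2B k1 k2
  refine ⟨hc1', ?_⟩
  have h2 : ψ ^ 2 + 2 * U * ψ ≤ 3 * M ^ 2 := by
    have a1 : ψ ^ 2 ≤ M ^ 2 := sq_le_sq' (abs_le.1 hψ).1 (abs_le.1 hψ).2
    have a2 : U * ψ ≤ M ^ 2 := by
      refine (le_abs_self _).trans ?_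
      rw [abs_mul, pow_two]
      gcongr
    linarith
  have h3 := mul_le_mul_of_nonneg_left h2 hη₁.le
  have e : κ / 2 * ψ ^ 2 + 2 * β * ψ * p + U * (p ^ 2 + ψ * s) =
    c2 + η₀ * (ψ ^ 2 + 2 * U * ψ) := by rw [hc2]; ring
  linarith

/-- One-sided first derivative test at an approximate maximum. -/
theorem near_max_test_one {M η : ℝ} (hM : 1 ≤ M) (hη : 0 < η) : ∃ η₀ > 0, ∀ ρ > 0, ∃ ε > 0,
    ∀ c U D ψ q : ℝ, |c| ≤ M → |U| ≤ M → |D| ≤ M → |ψ| ≤ M → |q| ≤ M →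
    (∀ h : ℝ, 0 ≤ h → h ≤ ρ → (1 + c * h) * (U - h * D - η₀ * h) *
      (ψ + h * q - η₀ * h) ^ 2 ≤ U * ψ ^ 2 + ε) →
    c * U * ψ ^ 2 - D * ψ ^ 2 + 2 * U * ψ * q ≤ η := by
  have hM0 : 0 < M := by linarith
  refine ⟨min 1 (η / (6 * M ^ 2)), by positivity, fun ρ hρ => ?_⟩
  set η₀ := min 1 (η / (6 * M ^ 2)) with hη₀
  have hη₁ : 0 < η₀ := by positivity
  have hη₂ : η₀ ≤ 1 := min_le_left _ _
  have hη₃ : η₀ * (6 * M ^ 2) ≤ η := by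
    rw [← le_div_iff₀ (by positivity)]; exact min_le_right _ _
  set m := 3 * M ^ 2 with hm
  set B := 23 * m ^ 3 with hB
  have hB0 : 0 < B := by positivity
  set r := min (min ρ 1) (η / (8 * B)) with hr
  have hr0 : 0 < r := by positivity
  have hr1 : r ≤ 1 := (min_le_left _ _).trans (min_le_right _ _)
  have hrρ : r ≤ ρ := (min_le_left _ _).trans (min_le_left _ _)
  have hrB : r * (8 * B) ≤ η := by
    rw [← le_div_iff₀ (by positivity)]; exact min_le_right _ _
  refine ⟨r * η / 4, by positivity, fun c U D ψ q hc hU hD hψ hq H => ?_⟩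
  have hMM : M ≤ M ^ 2 := by nlinarith
  have d : ∀ {x : ℝ}, |x| ≤ M → |x| ≤ m := fun hx => by linarith
  have hq' : |q - η₀| ≤ m := by
    rw [abs_le] at hq ⊢; constructor <;> linarith
  have hD' : |-D - η₀| ≤ 2 * M := by
    rw [abs_le] at hD ⊢; constructor <;> linarith
  have hcU : |c * U| ≤ M ^ 2 := by rw [abs_mul, pow_two]; gcongr
  have hb : |c * U + (-D - η₀)| ≤ m := (abs_add_le _ _).trans (by linarith)
  have hk : |c * (-D - η₀)| ≤ m := by
    rw [abs_mul]
    have := mul_le_mul hc hD' (abs_nonneg _) hM0.le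
    nlinarith
  have h0 : |(0 : ℝ)| ≤ m := by rw [abs_zero]; positivity
  have h1 := H r hr0.le hrρ
  have h2 := (abs_le.1 (abs_quadratic_mul_sq_le (h := r) (d hU) hb hk (d hψ) hq' h0
    (by rw [abs_of_pos hr0]; exact hr1))).1
  have h3 := (abs_le.1 (abs_second_coeff_le (d hU) hb hk (d hψ) hq' h0)).1
  rw [abs_of_pos hr0] at h2
  have e : (1 + c * r) * (U - r * D - η₀ * r) * (ψ + r * q - η₀ * r) ^ 2 =
    (U + r * (c * U + (-D - η₀)) + r ^ 2 * (c * (-D - η₀))) * (ψ + r * (q - η₀) + r ^ 2 * 0) ^ 2 := by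
    ring
  rw [e] at h1
  set c1 := (c * U + (-D - η₀)) * ψ ^ 2 + 2 * U * ψ * (q - η₀) with hc1
  have hm3 : 0 < m ^ 3 := by positivity
  have h4 := mul_le_mul_of_nonneg_left h3 (sq_nonneg r)
  have h5 : r ^ 3 ≤ r ^ 2 := pow_le_pow_of_le_one hr0.le hr1 (by norm_num)
  have h6 := mul_le_mul_of_nonneg_left h5 hm3.le
  have h7 := mul_le_mul_of_nonneg_left hrB hr0.le
  have h8 : r * c1 ≤ r * (η / 4 + η / 8) := by
    have : r ^ 2 * (8 * (23 * m ^ 3)) ≤ r * η := by rw [pow_two, mul_assoc]; exact h7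
    nlinarith
  have h9 := le_of_mul_le_mul_left h8 hr0
  have h10 : ψ ^ 2 + 2 * U * ψ ≤ 3 * M ^ 2 := by
    have a1 : ψ ^ 2 ≤ M ^ 2 := sq_le_sq' (abs_le.1 hψ).1 (abs_le.1 hψ).2
    have a2 : U * ψ ≤ M ^ 2 := by
      refine (le_abs_self _).trans ?_
      rw [abs_mul, pow_two]
      gcongr
    linarith
  have h11 := mul_le_mul_of_nonneg_left h10 hη₁.le
  have e2 : c * U * ψ ^ 2 - D * ψ ^ 2 + 2 * U * ψ * q = c1 + η₀ * (ψ ^ 2 + 2 * U * ψ) := by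
    rw [hc1]; ring
  linarith

end NearMaximum

section Paths
variable {n : ℕ} {g : (Fin n → ℝ) → ℝ → Matrix (Fin n) (Fin n) ℝ} {T t ℓ : ℝ} {x₀ x : Fin n → ℝ}

theorem continuous_metricForm_comp (hg : SmoothMetricFamily g (Icc 0 T)) {X : Type*}
    [TopologicalSpace X] {f V W : X → Fin n → ℝ} {τ : X → ℝ} (hf : Continuous f)
    (hτ : Continuous τ) (hτI : ∀ a, τ a ∈ Icc 0 T) (hV : Continuous V) (hW : Continuous W) :
    Continuous fun a => metricForm g (f a, τ a) (V a) (W a) := by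
  simp only [metricForm_apply]
  have h : ∀ i j, Continuous fun a => g (f a) (τ a) i j := fun i j =>
    (hg.1 i j).continuousOn.comp_continuous (hf.prodMk hτ) fun a => ⟨mem_univ _, hτI a⟩
  exact continuous_finsetSum _ fun i _ => continuous_finsetSum _ fun j _ =>
    ((h i j).mul ((continuous_apply i).comp hV)).mul ((continuous_apply j).comp hW)

theorem metricForm_nonneg (hg : SmoothMetricFamily g (Icc 0 T)) (ht : t ∈ Icc 0 T)
    (y X : Fin n → ℝ) : 0 ≤ metricForm g (y, t) X X := by
  by_cases h : X = 0
  · simp [h]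
  · exact (metricForm_pos (z := (y, t)) hg ht h).le

theorem pathLength_eq {γ v : ℝ → Fin n → ℝ} (hγ : ∀ s ∈ Ioo (0 : ℝ) 1, HasDerivAt γ (v s) s) :
    pathLength (fun y => g y t) γ = ∫ s in (0 : ℝ)..1, √(metricForm g (γ s, t) (v s) (v s)) := by
  rw [pathLength]
  simp only [intervalIntegral.integral_of_le zero_le_one, integral_Ioc_eq_integral_Ioo]
  refine setIntegral_congr_fun measurableSet_Ioo fun s hs => ?_
  simp only [metricForm_apply, (hγ s hs).deriv]

theorem pathLength_nonneg (G : (Fin n → ℝ) → Matrix (Fin n) (Fin n) ℝ) (γ : ℝ → Fin n → ℝ) :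
    0 ≤ pathLength G γ :=
  intervalIntegral.integral_nonneg zero_le_one fun _ _ => Real.sqrt_nonneg _

theorem riemDist_nonneg (G : (Fin n → ℝ) → Matrix (Fin n) (Fin n) ℝ) (x y : Fin n → ℝ) :
    0 ≤ riemDist G x y :=
  Real.sInf_nonneg (by rintro _ ⟨γ, -, -, -, rfl⟩; exact pathLength_nonneg G γ)

theorem riemDist_le_integral {γ v : ℝ → Fin n → ℝ} (hv : Continuous v)
    (hγ : ∀ s, HasDerivAt γ (v s) s) (h0 : γ 0 = x₀) :
    riemDist (fun y => g y t) x₀ (γ 1) ≤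
      ∫ s in (0 : ℝ)..1, √(metricForm g (γ s, t) (v s) (v s)) := by
  refine csInf_le ⟨0, by rintro _ ⟨γ, -, -, -, rfl⟩; exact pathLength_nonneg _ γ⟩
    ⟨γ, ContDiff.contDiffOn ?_, h0, rfl, (pathLength_eq fun s _ => hγ s).symm⟩
  rw [contDiff_one_iff_deriv]
  refine ⟨fun s => (hγ s).differentiableAt, ?_⟩
  rwa [show deriv γ = v from funext fun s => (hγ s).deriv]

theorem sq_integral_sqrt_le {f : ℝ → ℝ} (hf : Continuous f) (h0 : ∀ s, 0 ≤ f s) :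
    (∫ s in (0 : ℝ)..1, √(f s)) ^ 2 ≤ ∫ s in (0 : ℝ)..1, f s := by
  set c := ∫ s in (0 : ℝ)..1, √(f s) with hc
  have h1 : 0 ≤ ∫ s in (0 : ℝ)..1, (√(f s) - c) ^ 2 :=
    intervalIntegral.integral_nonneg zero_le_one fun _ _ => sq_nonneg _
  have e : ∀ s, (√(f s) - c) ^ 2 = f s - 2 * c * √(f s) + c ^ 2 := fun s => by
    rw [sub_sq, Real.sq_sqrt (h0 s)]; ring
  simp only [e] at h1
  have hs : Continuous fun s => √(f s) := hf.sqrt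
  rw [intervalIntegral.integral_add (f := fun s => f s - 2 * c * √(f s)) (g := fun _ => c ^ 2)
    ((by fun_prop : Continuous fun s => f s - 2 * c * √(f s)).intervalIntegrable _ _) (by simp), intervalIntegral.integral_sub (hf.intervalIntegrable _ _)
    ((by fun_prop : Continuous fun s => 2 * c * √(f s)).intervalIntegrable _ _),
    intervalIntegral.integral_const_mul, ← hc] at h1
  simp at h1
  nlinarith

theorem riemDist_sq_le_energy (hg : SmoothMetricFamily g (Icc 0 T)) (ht : t ∈ Icc 0 T)
    {γ v : ℝ → Fin n → ℝ} (hv : Continuous v) (hγ : ∀ s, HasDerivAt γ (v s) s) (h0 : γ 0 = x₀) :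
    riemDist (fun y => g y t) x₀ (γ 1) ^ 2 ≤
      ∫ s in (0 : ℝ)..1, metricForm g (γ s, t) (v s) (v s) := by
  have hc : Continuous γ := continuous_iff_continuousAt.2 fun s => (hγ s).continuousAt
  refine le_trans ?_ (sq_integral_sqrt_le
    (continuous_metricForm_comp hg hc continuous_const (fun _ => ht) hv hv)
    fun s => metricForm_nonneg hg ht _ _)
  gcongr
  · exact riemDist_nonneg _ _ _
  · exact riemDist_le_integral hv hγ h0

theorem riemDist_le_of_speed (hg : SmoothMetricFamily g (Icc 0 T)) (ht : t ∈ Icc 0 T)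
    {γ v : ℝ → Fin n → ℝ} (hv : Continuous v) (hγ : ∀ s, HasDerivAt γ (v s) s) (h0 : γ 0 = x₀)
    (hℓ : 0 ≤ ℓ) {s : ℝ} (hs : s ∈ Icc (0 : ℝ) 1)
    (hb : ∀ u ∈ Icc 0 s, metricForm g (γ u, t) (v u) (v u) ≤ ℓ ^ 2) :
    riemDist (fun y => g y t) x₀ (γ s) ≤ ℓ := by
  have h1 : ∀ u, HasDerivAt (fun u => γ (u * s)) (s • v (u * s)) u := fun u =>
    (hγ (u * s)).scomp u (hasDerivAt_mul_const s)
  have h2 := riemDist_le_integral (g := g) (t := t) (γ := fun u => γ (u * s))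
    (v := fun u => s • v (u * s)) (by fun_prop) h1 (by simpa using h0)
  rw [one_mul] at h2
  have hc : Continuous γ := continuous_iff_continuousAt.2 fun s => (hγ s).continuousAt
  refine h2.trans ?_
  have h3 := intervalIntegral.integral_mono_on (μ := volume) (a := 0) (b := 1)
    (f := fun u => √(metricForm g (γ (u * s), t) (s • v (u * s)) (s • v (u * s))))
    (g := fun _ => ℓ) zero_le_one (Continuous.intervalIntegrable (Continuous.sqrt
      (continuous_metricForm_comp hg (by fun_prop) continuous_const (fun _ => ht) (by fun_prop)
      (by fun_prop))) _ _) (by simp) (fun u hu => ?_)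
  · simpa using h3
  · rw [Real.sqrt_le_left hℓ]
    have hus : u * s ∈ Icc 0 s := ⟨mul_nonneg hu.1 hs.1, mul_le_of_le_one_left hs.1 hu.2⟩
    have := hb _ hus
    have h4 := metricForm_nonneg hg ht (γ (u * s)) (v (u * s))
    simp only [map_smul, Hom.smul_apply, smul_eq_mul]
    have h5 : s * s ≤ 1 := mul_le_one₀ hs.2 hs.1 hs.2
    nlinarith

/-- A `C¹` path defined on `[0, 1]` can be replaced by one on the line, with the same values on
`[0, 1]`. -/
theorem exists_extension {γ : ℝ → Fin n → ℝ} (hγ : ContDiffOn ℝ 1 γ (Icc 0 1)) :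
    ∃ σ v : ℝ → Fin n → ℝ, Continuous v ∧ (∀ s, HasDerivAt σ (v s) s) ∧
      ∀ s ∈ Icc (0 : ℝ) 1, σ s = γ s := by
  have hu : UniqueDiffOn ℝ (Icc (0 : ℝ) 1) := uniqueDiffOn_Icc one_pos
  have hd : ContinuousOn (derivWithin γ (Icc 0 1)) (Icc 0 1) :=
    hγ.continuousOn_derivWithin hu le_rfl
  set v : ℝ → Fin n → ℝ := fun s => derivWithin γ (Icc 0 1) (projIcc (0 : ℝ) 1 zero_le_one s) with hv
  have hvc : Continuous v := hd.comp_continuous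
    (continuous_subtype_val.comp continuous_projIcc) fun s => (projIcc _ _ _ s).2
  refine ⟨fun s => γ 0 + ∫ u in (0 : ℝ)..s, v u, v, hvc, fun s => ?_, fun s hs => ?_⟩
  · exact (intervalIntegral.integral_hasDerivAt_right (hvc.intervalIntegrable _ _)
      (hvc.stronglyMeasurableAtFilter _ _) hvc.continuousAt).const_add _
  · have h1 : ∫ u in (0 : ℝ)..s, v u = γ s - γ 0 := by
      refine intervalIntegral.integral_eq_sub_of_hasDerivAt_of_le hs.1
        (hγ.continuousOn.mono (Icc_subset_Icc_right hs.2)) (fun u hu => ?_)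
        (hvc.intervalIntegrable _ _)
      have hu' : u ∈ Ioo (0 : ℝ) 1 := ⟨hu.1, hu.2.trans_le hs.2⟩
      have h2 := (hγ.differentiableOn (by simp) u (Ioo_subset_Icc_self hu')).hasDerivWithinAt
      have h3 : v u = derivWithin γ (Icc 0 1) u := by
        simp only [hv]; rw [projIcc_of_mem _ (Ioo_subset_Icc_self hu')]
      rw [h3]
      exact h2.hasDerivAt (Icc_mem_nhds hu'.1 hu'.2)
    simp only [h1]; abel

/-- Reparametrisation with speed at most `ℓ`. -/
theorem exists_reparam (hg : SmoothMetricFamily g (Icc 0 T)) (ht : t ∈ Icc 0 T)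
    {γ v : ℝ → Fin n → ℝ} (hv : Continuous v) (hγ : ∀ s, HasDerivAt γ (v s) s)
    (hℓ : ∫ s in (0 : ℝ)..1, √(metricForm g (γ s, t) (v s) (v s)) < ℓ) :
    ∃ σ w : ℝ → Fin n → ℝ, Continuous w ∧ (∀ s, HasDerivAt σ (w s) s) ∧ σ 0 = γ 0 ∧ σ 1 = γ 1 ∧
      ∀ s, metricForm g (σ s, t) (w s) (w s) ≤ ℓ ^ 2 := by
  have hc : Continuous γ := continuous_iff_continuousAt.2 fun s => (hγ s).continuousAt
  set m : ℝ → ℝ := fun s => √(metricForm g (γ s, t) (v s) (v s)) with hm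
  have hmc : Continuous m := Continuous.sqrt
    (continuous_metricForm_comp hg hc continuous_const (fun _ => ht) hv hv)
  have hm0 : ∀ s, 0 ≤ m s := fun s => Real.sqrt_nonneg _
  set δ := ℓ - ∫ s in (0 : ℝ)..1, m s with hδ
  have hδ0 : 0 < δ := sub_pos.2 hℓ
  have hI0 : 0 ≤ ∫ s in (0 : ℝ)..1, m s :=
    intervalIntegral.integral_nonneg zero_le_one fun s _ => hm0 s
  have hl0 : 0 < ℓ := by linarith
  set Λ : ℝ → ℝ := fun s => (∫ u in (0 : ℝ)..s, m u) + s * δ with hΛ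
  have hd : ∀ s, HasDerivAt Λ (m s + δ) s := fun s =>
    (intervalIntegral.integral_hasDerivAt_right (hmc.intervalIntegrable _ _)
      (hmc.stronglyMeasurableAtFilter _ _) hmc.continuousAt).add (hasDerivAt_mul_const δ)
  have hpos : ∀ s, 0 < m s + δ := fun s => by linarith [hm0 s]
  have hmono : StrictMono Λ := strictMono_of_deriv_pos fun s => by
    rw [(hd s).deriv]; exact hpos s
  have hcont : Continuous Λ := continuous_iff_continuousAt.2 fun s => (hd s).continuousAt
  have htop : Filter.Tendsto Λ Filter.atTop Filter.atTop := by
    refine Filter.tendsto_atTop_mono' _ ?_ (Filter.tendsto_id.atTop_mul_const hδ0)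
    filter_upwards [Filter.eventually_ge_atTop 0] with s hs
    simp only [hΛ, id]
    have := intervalIntegral.integral_nonneg (μ := volume) hs fun u _ => hm0 u
    linarith
  have hbot : Filter.Tendsto Λ Filter.atBot Filter.atBot := by
    refine Filter.tendsto_atBot_mono' _ ?_ (Filter.tendsto_id.atBot_mul_const hδ0)
    filter_upwards [Filter.eventually_le_atBot 0] with s hs
    simp only [hΛ, id]
    have := intervalIntegral.integral_nonneg (μ := volume) hs fun u _ => hm0 u
    rw [intervalIntegral.integral_symm] at this
    linarith
  have hsurj : Function.Surjective Λ := hcont.surjective htop hbot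
  set φ := hmono.orderIsoOfSurjective Λ hsurj with hφ
  have hφΛ : ∀ s, φ s = Λ s := fun s => rfl
  have hsc : Continuous φ.symm := φ.symm.continuous
  have hsd : ∀ s, HasDerivAt φ.symm (m (φ.symm s) + δ)⁻¹ s := fun s =>
    (hd (φ.symm s)).of_local_left_inverse hsc.continuousAt (hpos _).ne'
      (Filter.Eventually.of_forall fun y => φ.apply_symm_apply y)
  refine ⟨fun s => γ (φ.symm (s * ℓ)),
    fun s => (((m (φ.symm (s * ℓ)) + δ)⁻¹) * ℓ) • v (φ.symm (s * ℓ)), ?_, fun s => ?_, ?_, ?_,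
    fun s => ?_⟩
  · exact Continuous.smul (Continuous.mul (Continuous.inv₀ (by fun_prop) fun s => (hpos _).ne')
      continuous_const) (by fun_prop)
  · exact (hγ _).scomp s ((hsd (s * ℓ)).comp s (hasDerivAt_mul_const ℓ))
  · have : φ.symm 0 = 0 := by rw [OrderIso.symm_apply_eq, hφΛ]; simp [hΛ]
    simp [this]
  · have : φ.symm ℓ = 1 := by rw [OrderIso.symm_apply_eq, hφΛ]; simp [hΛ, hδ]
    simp [this]
  · set u := φ.symm (s * ℓ)
    simp only [map_smul, Hom.smul_apply, smul_eq_mul]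
    have h1 : metricForm g (γ u, t) (v u) (v u) = m u ^ 2 :=
      (Real.sq_sqrt (metricForm_nonneg hg ht _ _)).symm
    rw [h1]
    have h2 : (m u + δ)⁻¹ * m u ≤ 1 := by
      rw [inv_mul_le_iff₀ (hpos u)]; linarith
    have h3 : 0 ≤ (m u + δ)⁻¹ * m u := mul_nonneg (inv_pos.2 (hpos u)).le (hm0 u)
    have h4 : ((m u + δ)⁻¹ * m u) ^ 2 ≤ 1 := pow_le_one₀ h3 h2
    have := mul_le_mul_of_nonneg_right h4 (sq_nonneg ℓ)
    calc _ = ((m u + δ)⁻¹ * m u) ^ 2 * ℓ ^ 2 := by ring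
      _ ≤ _ := by linarith

/-- A point at distance less than `ℓ` is the endpoint of a path of speed at most `ℓ`. -/
theorem exists_path_of_riemDist_lt (hg : SmoothMetricFamily g (Icc 0 T)) (ht : t ∈ Icc 0 T)
    (hd : riemDist (fun y => g y t) x₀ x < ℓ) :
    ∃ σ w : ℝ → Fin n → ℝ, Continuous w ∧ (∀ s, HasDerivAt σ (w s) s) ∧ σ 0 = x₀ ∧ σ 1 = x ∧
      ∀ s, metricForm g (σ s, t) (w s) (w s) ≤ ℓ ^ 2 := by
  obtain ⟨_, ⟨γ, h1, h2, h3, rfl⟩, h4⟩ := exists_lt_of_csInf_lt (by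
    refine ⟨_, fun s => x₀ + s • (x - x₀), ?_, by simp, by simp, rfl⟩
    exact ContDiff.contDiffOn (by fun_prop)) hd
  obtain ⟨σ, v, hv, hσ, heq⟩ := exists_extension h1
  have h5 : ∀ s ∈ Ioo (0 : ℝ) 1, HasDerivAt γ (v s) s := fun s hs =>
    (hσ s).congr_of_eventuallyEq (by
      filter_upwards [Icc_mem_nhds hs.1 hs.2] with u hu using (heq u hu).symm)
  rw [pathLength_eq h5] at h4
  have h6 : ∫ s in (0 : ℝ)..1, √(metricForm g (σ s, t) (v s) (v s)) < ℓ := by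
    refine lt_of_eq_of_lt (intervalIntegral.integral_congr fun s hs => ?_) h4
    rw [uIcc_of_le zero_le_one] at hs
    simp only [heq s hs]
  obtain ⟨σ', w, hw, hσ', e0, e1, hb⟩ := exists_reparam hg ht hv hσ h6
  exact ⟨σ', w, hw, hσ', by rw [e0, heq 0 (by simp), h2], by rw [e1, heq 1 (by simp), h3], hb⟩

end Paths

section Compactness
variable {n : ℕ} {g : (Fin n → ℝ) → ℝ → Matrix (Fin n) (Fin n) ℝ} {T t t₀ ℓ r r₀ : ℝ}
  {x₀ x : Fin n → ℝ}

/-- A `C¹` path `γ` with velocity `v`, from `x₀`, of `g(t)`-speed at most `ℓ` on `[0, 1]`. -/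
structure SlowPath (g : (Fin n → ℝ) → ℝ → Matrix (Fin n) (Fin n) ℝ) (t ℓ : ℝ) (x₀ : Fin n → ℝ)
    (γ v : ℝ → Fin n → ℝ) : Prop where
  continuous_vel : Continuous v
  hasDerivAt : ∀ s, HasDerivAt γ (v s) s
  zero : γ 0 = x₀
  speed_le : ∀ s ∈ Icc (0 : ℝ) 1, metricForm g (γ s, t) (v s) (v s) ≤ ℓ ^ 2

theorem SlowPath.continuous {γ v : ℝ → Fin n → ℝ} (h : SlowPath g t ℓ x₀ γ v) : Continuous γ :=
  continuous_iff_continuousAt.2 fun s => (h.hasDerivAt s).continuousAt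

theorem SlowPath.mono {γ v : ℝ → Fin n → ℝ} (h : SlowPath g t ℓ x₀ γ v) (h0 : 0 ≤ ℓ) (hr : ℓ ≤ r) :
    SlowPath g t r x₀ γ v :=
  ⟨h.1, h.2, h.3, fun s hs => (h.4 s hs).trans (pow_le_pow_left₀ h0 hr 2)⟩

theorem exists_slowPath (hg : SmoothMetricFamily g (Icc 0 T)) (ht : t ∈ Icc 0 T)
    (hd : riemDist (fun y => g y t) x₀ x < ℓ) : ∃ γ v, SlowPath g t ℓ x₀ γ v ∧ γ 1 = x := by
  obtain ⟨σ, w, h1, h2, h3, h4, h5⟩ := exists_path_of_riemDist_lt hg ht hd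
  exact ⟨σ, w, ⟨h1, h2, h3, fun s _ => h5 s⟩, h4⟩

theorem riemDist_self (hg : SmoothMetricFamily g (Icc 0 T)) (ht : t ∈ Icc 0 T) :
    riemDist (fun y => g y t) x₀ x₀ = 0 := by
  refine le_antisymm ?_ (riemDist_nonneg _ _ _)
  exact riemDist_le_of_speed (γ := fun _ => x₀) (v := fun _ => 0) hg ht continuous_const
    (fun s => hasDerivAt_const s x₀) rfl le_rfl (s := 0) (by simp) (by simp)

theorem eventually_metric_le (hg : SmoothMetricFamily g (Icc 0 T)) (ht : t₀ ∈ Icc 0 T)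
    {S : Set (Fin n → ℝ)} (hS : IsCompact S) {μ : ℝ} (hμ : 0 < μ) :
    ∀ᶠ t in 𝓝[Icc 0 T] t₀, ∀ y ∈ S, ∀ v,
      metricForm g (y, t₀) v v ≤ (1 + μ) * metricForm g (y, t) v v ∧
      metricForm g (y, t) v v ≤ (1 + μ) * metricForm g (y, t₀) v v := by
  have hT : 0 ≤ T := ht.1.trans ht.2
  set cl : ℝ → ℝ := fun s => projIcc 0 T hT s with hcl
  have hclc : Continuous cl := continuous_subtype_val.comp continuous_projIcc
  have hclI : ∀ s, cl s ∈ Icc 0 T := fun s => (projIcc 0 T hT s).2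
  have hcle : ∀ s ∈ Icc 0 T, cl s = s := fun s hs => by simp [hcl, projIcc_of_mem hT hs]
  have key : ∀ᶠ t in 𝓝 t₀, ∀ q ∈ S ×ˢ Metric.sphere (0 : Fin n → ℝ) 1,
      metricForm g (q.1, t₀) q.2 q.2 ≤ (1 + μ) * metricForm g (q.1, cl t) q.2 q.2 ∧
      metricForm g (q.1, cl t) q.2 q.2 ≤ (1 + μ) * metricForm g (q.1, t₀) q.2 q.2 := by
    refine (hS.prod (isCompact_sphere _ _)).eventually_forall_of_forall_eventually
      (P := fun t q => metricForm g (q.1, t₀) q.2 q.2 ≤ (1 + μ) * metricForm g (q.1, cl t) q.2 q.2 ∧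
      metricForm g (q.1, cl t) q.2 q.2 ≤ (1 + μ) * metricForm g (q.1, t₀) q.2 q.2) fun q hq => ?_
    have hq0 : q.2 ≠ 0 := by
      intro h; have := hq.2; rw [h] at this; simp at this
    have hpos := metricForm_pos (z := (q.1, t₀)) hg ht hq0
    have c1 : Continuous fun z : ℝ × ((Fin n → ℝ) × (Fin n → ℝ)) =>
        metricForm g (z.2.1, t₀) z.2.2 z.2.2 :=
      continuous_metricForm_comp hg (by fun_prop) continuous_const (fun _ => ht) (by fun_prop)
        (by fun_prop)
    have c2 : Continuous fun z : ℝ × ((Fin n → ℝ) × (Fin n → ℝ)) =>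
        metricForm g (z.2.1, cl z.1) z.2.2 z.2.2 :=
      continuous_metricForm_comp hg (by fun_prop) (by fun_prop) (fun _ => hclI _) (by fun_prop)
        (by fun_prop)
    refine (((c1.tendsto (t₀, q)).eventually_lt ((continuous_const.mul c2).tendsto (t₀, q)) ?_).and
      ((c2.tendsto (t₀, q)).eventually_lt ((continuous_const.mul c1).tendsto (t₀, q)) ?_)).mono
      fun z hz => ⟨hz.1.le, hz.2.le⟩
    · simp only [Pi.mul_apply, hcle t₀ ht]; nlinarith
    · simp only [Pi.mul_apply, hcle t₀ ht]; nlinarith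
  filter_upwards [nhdsWithin_le_nhds key, self_mem_nhdsWithin] with t h1 h2 y hy v
  by_cases hv : v = 0
  · simp [hv]
  · have hv' : 0 < ‖v‖ := norm_pos_iff.2 hv
    obtain ⟨h3, h4⟩ := h1 (y, ‖v‖⁻¹ • v) ⟨hy, by simp [norm_smul, hv'.ne']⟩
    simp only [map_smul, Hom.smul_apply, smul_eq_mul, hcle t h2] at h3 h4
    have e : ∀ a : ℝ, ‖v‖ * (‖v‖ * (‖v‖⁻¹ * (‖v‖⁻¹ * a))) = a := fun a => by field_simp
    have h5 := mul_le_mul_of_nonneg_left (mul_le_mul_of_nonneg_left h3 hv'.le) hv'.le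
    have h6 := mul_le_mul_of_nonneg_left (mul_le_mul_of_nonneg_left h4 hv'.le) hv'.le
    constructor
    · rw [← e (metricForm g (y, t₀) v v), ← e (metricForm g (y, t) v v)]; linarith
    · rw [← e (metricForm g (y, t₀) v v), ← e (metricForm g (y, t) v v)]; linarith

/-- For `t` close to `t₀`, the slow `g(t)`-paths stay in a slightly larger `g(t₀)`-ball. -/
theorem eventually_slowPath_mem (hg : SmoothMetricFamily g (Icc 0 T)) (ht : t₀ ∈ Icc 0 T)
    (hr : 0 ≤ r) (hr₀ : r < r₀) (hS : IsCompact (closure (rBall (fun y => g y t₀) x₀ r₀))) :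
    ∀ᶠ t in 𝓝[Icc 0 T] t₀, ∀ γ v, SlowPath g t r x₀ γ v → ∀ s ∈ Icc (0 : ℝ) 1,
      γ s ∈ closure (rBall (fun y => g y t₀) x₀ r₀) := by
  obtain ⟨r₁, h1, h2⟩ := exists_between hr₀
  have h0 : r ^ 2 < r₁ ^ 2 := pow_lt_pow_left₀ h1 hr two_ne_zero
  obtain ⟨μ, hμ, hμ'⟩ : ∃ μ > 0, (1 + μ) * r ^ 2 < r₁ ^ 2 := by
    refine ⟨(r₁ ^ 2 - r ^ 2) / (2 * (r ^ 2 + 1)), by apply div_pos <;> nlinarith, ?_⟩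
    have : (r₁ ^ 2 - r ^ 2) / (2 * (r ^ 2 + 1)) * r ^ 2 < r₁ ^ 2 - r ^ 2 := by
      rw [div_mul_eq_mul_div, div_lt_iff₀ (by positivity)]
      nlinarith [sq_nonneg r]
    nlinarith
  filter_upwards [eventually_metric_le hg ht hS hμ, self_mem_nhdsWithin] with t hcmp htI γ v hγ
  set w : ℝ → ℝ := fun s => metricForm g (γ s, t₀) (v s) (v s) with hw
  have hwc : Continuous w := continuous_metricForm_comp hg hγ.continuous continuous_const
    (fun _ => ht) hγ.1 hγ.1
  have hball : ∀ s ∈ Icc (0 : ℝ) 1, (∀ u ∈ Icc 0 s, w u ≤ r₁ ^ 2) →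
      γ s ∈ rBall (fun y => g y t₀) x₀ r₀ := fun s hs hb =>
    (riemDist_le_of_speed hg ht hγ.1 hγ.2 hγ.3 (hr.trans h1.le) hs hb).trans_lt h2
  have hlt : ∀ s ∈ Icc (0 : ℝ) 1, γ s ∈ closure (rBall (fun y => g y t₀) x₀ r₀) →
      w s < r₁ ^ 2 := fun s hs hm => by
    have := (hcmp _ hm (v s)).1
    have h3 := hγ.4 s hs
    have : w s ≤ (1 + μ) * r ^ 2 := this.trans (by gcongr)
    linarith
  have hall : ∀ s ∈ Icc (0 : ℝ) 1, w s < r₁ ^ 2 := by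
    by_contra! hne
    obtain ⟨s₁, hs₁, hws₁⟩ := hne
    have hcomp : IsCompact (Icc (0 : ℝ) 1 ∩ {s | r₁ ^ 2 ≤ w s}) :=
      isCompact_Icc.inter_right (isClosed_le continuous_const hwc)
    obtain ⟨s, ⟨hs, hws⟩, hmin⟩ := hcomp.exists_isLeast ⟨s₁, hs₁, hws₁⟩
    refine absurd (hlt s hs ?_) (not_lt.2 hws)
    rcases hs.1.eq_or_lt with h | h
    · rw [← h, hγ.3]
      refine subset_closure ?_
      change riemDist _ _ _ < _
      rw [riemDist_self hg ht]; linarith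
    · refine mem_closure_of_tendsto (f := γ) (b := 𝓝[<] s)
        (hγ.continuous.continuousAt.mono_left nhdsWithin_le_nhds) ?_
      filter_upwards [Ioo_mem_nhdsLT h] with u hu
      refine hball u ⟨hu.1.le, hu.2.le.trans hs.2⟩ fun u' hu' => ?_
      by_contra! hc
      have h5 := hmin ⟨⟨hu'.1, hu'.2.trans (hu.2.le.trans hs.2)⟩, hc.le⟩
      exact absurd (hu'.2.trans_lt hu.2) (not_lt.2 h5)
  intro s hs
  exact subset_closure (hball s hs fun u hu => (hall u ⟨hu.1, hu.2.trans hs.2⟩).le)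

/-- All slow paths stay in a common compact set. -/
theorem exists_compact_slowPath (hg : SmoothMetricFamily g (Icc 0 T))
    (hr : 0 ≤ r) (hr₀ : r < r₀)
    (hS : ∀ t ∈ Icc (0 : ℝ) T, IsCompact (closure (rBall (fun y => g y t) x₀ r₀))) :
    ∃ S : Set (Fin n → ℝ), IsCompact S ∧ ∀ t ∈ Icc 0 T, ∀ γ v, SlowPath g t r x₀ γ v →
      ∀ s ∈ Icc (0 : ℝ) 1, γ s ∈ S := by
  refine (isCompact_Icc (a := (0 : ℝ)) (b := T)).induction_on
    (p := fun J => ∃ S : Set (Fin n → ℝ), IsCompact S ∧ ∀ t ∈ J, ∀ γ v, SlowPath g t r x₀ γ v →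
      ∀ s ∈ Icc (0 : ℝ) 1, γ s ∈ S) ⟨∅, isCompact_empty, by simp⟩ ?_ ?_ ?_
  · rintro J J' hJ ⟨S, h1, h2⟩
    exact ⟨S, h1, fun t ht => h2 t (hJ ht)⟩
  · rintro J J' ⟨S, h1, h2⟩ ⟨S', h1', h2'⟩
    refine ⟨S ∪ S', h1.union h1', fun t ht γ v hγ s hs => ?_⟩
    rcases ht with ht | ht
    exacts [Or.inl (h2 t ht γ v hγ s hs), Or.inr (h2' t ht γ v hγ s hs)]
  · intro t₀ ht₀
    exact ⟨_, eventually_slowPath_mem hg ht₀ hr hr₀ (hS t₀ ht₀), _, hS t₀ ht₀, fun t ht => ht⟩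

theorem continuousOn_riemNorm (hT : 0 < T) (hg : SmoothMetricFamily g (Icc 0 T)) :
    ContinuousOn (fun z : (Fin n → ℝ) × ℝ => riemNorm (fun y => g y z.2) z.1)
      (univ ×ˢ Icc 0 T) := by
  simp only [riemNorm_eq]
  exact (contDiffOn_riemNormSq hT hg).continuousOn.sqrt

/-- Near the initial time the curvature bound is nearly preserved. -/
theorem exists_initial_bound (hT : 0 < T) (hg : SmoothMetricFamily g (Icc 0 T))
    (hr : 0 ≤ r) (hr₀ : r < r₀) (hS : IsCompact (closure (rBall (fun y => g y 0) x₀ r₀)))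
    (hb : ∀ x ∈ rBall (fun y => g y 0) x₀ r₀, riemNorm (fun y => g y 0) x ≤ 1 / r₀ ^ 2) :
    ∃ τ₀ > 0, ∀ t ∈ Icc 0 T, t < τ₀ → ∀ x, riemDist (fun y => g y t) x₀ x < r →
      riemNorm (fun y => g y t) x ≤ 2 / r₀ ^ 2 := by
  have h0T : (0 : ℝ) ∈ Icc 0 T := ⟨le_rfl, hT.le⟩
  set cl : ℝ → ℝ := fun s => projIcc 0 T hT.le s with hcl
  have hclc : Continuous cl := continuous_subtype_val.comp continuous_projIcc
  have hclI : ∀ s, cl s ∈ Icc 0 T := fun s => (projIcc 0 T hT.le s).2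
  have hcle : ∀ s ∈ Icc 0 T, cl s = s := fun s hs => by simp [hcl, projIcc_of_mem hT.le hs]
  have huc : Continuous fun z : ℝ × (Fin n → ℝ) => riemNorm (fun y => g y (cl z.1)) z.2 :=
    (continuousOn_riemNorm hT hg).comp_continuous (f := fun z : ℝ × (Fin n → ℝ) => (z.2, cl z.1))
      (by fun_prop) fun z => ⟨mem_univ _, hclI _⟩
  have hr0 : 0 < r₀ := hr.trans_lt hr₀
  have hcl0 : ∀ y ∈ closure (rBall (fun y => g y 0) x₀ r₀),
      riemNorm (fun y => g y 0) y ≤ 1 / r₀ ^ 2 := by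
    have hc0 : Continuous fun y => riemNorm (fun y => g y 0) y := by
      have := huc.comp (Continuous.prodMk_right (0 : ℝ))
      simpa [Function.comp_def, hcle 0 h0T] using this
    exact closure_minimal hb (isClosed_le hc0 continuous_const)
  have hev : ∀ᶠ t in 𝓝 (0 : ℝ), ∀ y ∈ closure (rBall (fun y => g y 0) x₀ r₀),
      riemNorm (fun y => g y (cl t)) y ≤ 2 / r₀ ^ 2 := by
    refine hS.eventually_forall_of_forall_eventually
      (P := fun t y => riemNorm (fun y => g y (cl t)) y ≤ 2 / r₀ ^ 2) fun y hy => ?_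
    refine ((huc.tendsto (0, y)).eventually_lt_const ?_).mono fun z hz => hz.le
    have h1 : riemNorm (fun y => g y (cl 0)) y ≤ 1 / r₀ ^ 2 := by
      rw [hcle 0 h0T]; exact hcl0 y hy
    refine h1.trans_lt ?_
    gcongr; norm_num
  have h2 := eventually_slowPath_mem hg h0T hr hr₀ hS
  obtain ⟨τ₀, hτ₀, h3⟩ := Metric.mem_nhdsWithin_iff.1
    (Filter.inter_mem h2 (nhdsWithin_le_nhds (s := Icc 0 T) hev))
  refine ⟨τ₀, hτ₀, fun t ht htτ x hx => ?_⟩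
  obtain ⟨h4, h5⟩ := h3 ⟨by
    rw [Metric.mem_ball, Real.dist_eq, sub_zero, abs_of_nonneg ht.1]; exact htτ, ht⟩
  obtain ⟨γ, v, hγ, rfl⟩ := exists_slowPath hg ht hx
  have := h5 _ (h4 γ v hγ 1 (by simp))
  rwa [hcle t ht] at this

theorem eventually_riemDist_le (hg : SmoothMetricFamily g (Icc 0 T)) (ht : t₀ ∈ Icc 0 T)
    (hd : riemDist (fun y => g y t₀) x₀ x < ℓ) :
    ∀ᶠ t in 𝓝[Icc 0 T] t₀, riemDist (fun y => g y t) x₀ x ≤ ℓ := by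
  obtain ⟨ℓ₁, h1, h2⟩ := exists_between hd
  have h0 : 0 ≤ ℓ₁ := (riemDist_nonneg _ _ _).trans h1.le
  obtain ⟨γ, v, hγ, rfl⟩ := exists_slowPath hg ht h1
  obtain ⟨μ, hμ, hμ'⟩ : ∃ μ > 0, (1 + μ) * ℓ₁ ^ 2 ≤ ℓ ^ 2 := by
    have h3 : ℓ₁ ^ 2 < ℓ ^ 2 := pow_lt_pow_left₀ h2 h0 two_ne_zero
    refine ⟨(ℓ ^ 2 - ℓ₁ ^ 2) / (ℓ₁ ^ 2 + 1), by apply div_pos <;> nlinarith, ?_⟩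
    have : (ℓ ^ 2 - ℓ₁ ^ 2) / (ℓ₁ ^ 2 + 1) * ℓ₁ ^ 2 ≤ ℓ ^ 2 - ℓ₁ ^ 2 := by
      rw [div_mul_eq_mul_div, div_le_iff₀ (by positivity)]
      nlinarith [sq_nonneg ℓ₁]
    nlinarith
  filter_upwards [eventually_metric_le hg ht ((isCompact_Icc (a := (0 : ℝ)) (b := 1)).image
    hγ.continuous) hμ, self_mem_nhdsWithin] with t hcmp htI
  refine riemDist_le_of_speed hg htI hγ.1 hγ.2 hγ.3 (h0.trans h2.le) (by simp) fun u hu => ?_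
  have h3 := (hcmp _ (mem_image_of_mem γ hu) (v u)).2
  have h4 := hγ.4 u hu
  refine h3.trans (le_trans ?_ hμ')
  gcongr

end Compactness

section Uniform

theorem Hom.contDiffAt_apply {P E W : Type*} [NormedAddCommGroup P] [NormedSpace ℝ P]
    [NormedAddCommGroup E] [NormedSpace ℝ E] [NormedAddCommGroup W] [NormedSpace ℝ W]
    {F : P → Hom E W} {v : P → E} {q : P} (hF : ContDiffAt ℝ ∞ F q) (hv : ContDiffAt ℝ ∞ v q) :
    ContDiffAt ℝ ∞ (fun p => F p (v p)) q :=
  ((Hom.clm (E := E) (W := W)).contDiff.contDiffAt.comp q hF).clm_apply hv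

theorem contDiffAt_fderiv_apply_fst {P E W : Type*} [NormedAddCommGroup P] [NormedSpace ℝ P]
    [NormedAddCommGroup E] [NormedSpace ℝ E] [NormedAddCommGroup W] [NormedSpace ℝ W]
    {f : E × ℝ → W} {x v : P → E} {t : P → ℝ} {q : P} (hf : ContDiffAt ℝ ∞ f (x q, t q))
    (hx : ContDiffAt ℝ ∞ x q) (ht : ContDiffAt ℝ ∞ t q) (hv : ContDiffAt ℝ ∞ v q) :
    ContDiffAt ℝ ∞ (fun p => fderiv ℝ f (x p, t p) (v p, 0)) q :=
  (ContDiffAt.comp q (f := fun p => (x p, t p)) (hf.fderiv_right (m := ∞) (by simp))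
    (hx.prodMk ht)).clm_apply (hv.prodMk contDiffAt_const)

theorem exists_bound_lastDeriv {Z : Type*} [NormedAddCommGroup Z] [NormedSpace ℝ Z]
    {k : Z × ℝ → ℝ} {P : Set Z} (hP : IsCompact P) (hk : ∀ z ∈ P, ContDiffAt ℝ ∞ k (z, 0)) :
    ∃ B : ℝ, ∀ z ∈ P, |k (z, 0)| ≤ B ∧ |lastDeriv k (z, 0)| ≤ B ∧
      |lastDeriv (lastDeriv k) (z, 0)| ≤ B := by
  have key : ∀ f : Z × ℝ → ℝ, (∀ z ∈ P, ContDiffAt ℝ ∞ f (z, 0)) → ∃ B : ℝ, ∀ z ∈ P,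
      |f (z, 0)| ≤ B := fun f hf =>
    hP.exists_bound_of_continuousOn (f := fun z => f (z, 0)) fun z hz =>
      ((hf z hz).continuousAt.comp (f := fun z : Z => (z, (0 : ℝ)))
        (Continuous.prodMk_left (0 : ℝ)).continuousAt).continuousWithinAt
  obtain ⟨B₁, h1⟩ := key k hk
  obtain ⟨B₂, h2⟩ := key _ fun z hz => contDiffAt_lastDeriv (hk z hz)
  obtain ⟨B₃, h3⟩ := key _ fun z hz => contDiffAt_lastDeriv (contDiffAt_lastDeriv (hk z hz))
  exact ⟨max B₁ (max B₂ B₃), fun z hz => ⟨(h1 z hz).trans (le_max_left _ _),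
    (h2 z hz).trans ((le_max_left _ _).trans (le_max_right _ _)),
    (h3 z hz).trans ((le_max_right _ _).trans (le_max_right _ _))⟩⟩

variable {ι : Type*} [Fintype ι] [DecidableEq ι] {T ta tb R m η : ℝ}
variable {g : (ι → ℝ) × ℝ → Form (ι → ℝ)}
  {Γ : (ι → ℝ) × ℝ → (ι → ℝ) →L[ℝ] (ι → ℝ) →L[ℝ] (ι → ℝ)} {U : (ι → ℝ) × ℝ → ℝ}
  {S : Set (ι → ℝ)}

theorem contDiffAt_geo {P : Type*} [NormedAddCommGroup P] [NormedSpace ℝ P] {x V : P → ι → ℝ}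
    {t h : P → ℝ} {q : P} (hΓ : ContDiffAt ℝ ∞ Γ (x q, t q)) (hx : ContDiffAt ℝ ∞ x q)
    (ht : ContDiffAt ℝ ∞ t q) (hV : ContDiffAt ℝ ∞ V q) (hh : ContDiffAt ℝ ∞ h q) :
    ContDiffAt ℝ ∞ (fun p => geo Γ (x p) (t p) (V p) (h p)) q := by
  have h1 : ContDiffAt ℝ ∞ (fun p => Γ (x p, t p)) q :=
    hΓ.comp q (f := fun p => (x p, t p)) (hx.prodMk ht)
  exact (hx.add (hh.smul hV)).sub (((hh.pow 2).div_const 2).smul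
    ((h1.clm_apply hV).clm_apply hV))

theorem contDiffAt_geoVel {P : Type*} [NormedAddCommGroup P] [NormedSpace ℝ P]
    {x v V W : P → ι → ℝ} {t h : P → ℝ} {q : P} (hΓ : ContDiffAt ℝ ∞ Γ (x q, t q))
    (hx : ContDiffAt ℝ ∞ x q) (ht : ContDiffAt ℝ ∞ t q) (hv : ContDiffAt ℝ ∞ v q)
    (hV : ContDiffAt ℝ ∞ V q) (hW : ContDiffAt ℝ ∞ W q) (hh : ContDiffAt ℝ ∞ h q) :
    ContDiffAt ℝ ∞ (fun p => geoVel Γ (x p) (t p) (v p) (V p) (W p) (h p)) q := by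
  have h1 : ContDiffAt ℝ ∞ (fun p => Γ (x p, t p)) q :=
    hΓ.comp q (f := fun p => (x p, t p)) (hx.prodMk ht)
  have h3 := contDiffAt_fderiv_apply_fst hΓ hx ht hv
  exact (hv.add (hh.smul hW)).sub (((hh.pow 2).div_const 2).smul
    ((((h3.clm_apply hV).clm_apply hV).add ((h1.clm_apply hW).clm_apply hV)).add
      ((h1.clm_apply hV).clm_apply hW)))

theorem energy_taylor (M : MetricOn ((univ : Set (ι → ℝ)) ×ˢ Ioo 0 T) g Γ) (hS : IsCompact S)
    (hta : 0 < ta) (htb : tb < T) (hη : 0 < η) :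
    ∃ ρ > 0, ∀ x ∈ S, ∀ t ∈ Icc ta tb, ∀ v e : ι → ℝ, ‖v‖ ≤ R → ‖e‖ ≤ R →
      ∀ a ∈ Icc (0 : ℝ) 1, ∀ b ∈ Icc 0 m, ∀ h : ℝ, |h| ≤ ρ →
      g (geo Γ x t (a • e) h, t) (geoVel Γ x t v (a • e) (b • e - a • Γ (x, t) v e) h)
        (geoVel Γ x t v (a • e) (b • e - a • Γ (x, t) v e) h) ≤
      g (x, t) v v + h * (2 * b * g (x, t) e v) + h ^ 2 * (b ^ 2 * g (x, t) e e
        - a ^ 2 * g (x, t) (curv Γ (x, t) e v v) e) + η * h ^ 2 := by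
  set P : Set ((ι → ℝ) × ℝ × (ι → ℝ) × (ι → ℝ) × ℝ × ℝ) :=
    S ×ˢ Icc ta tb ×ˢ Metric.closedBall 0 R ×ˢ Metric.closedBall 0 R ×ˢ Icc 0 1 ×ˢ Icc 0 m with hP
  have hPc : IsCompact P := hS.prod (isCompact_Icc.prod ((isCompact_closedBall _ _).prod
    ((isCompact_closedBall _ _).prod (isCompact_Icc.prod isCompact_Icc))))
  set k : ((ι → ℝ) × ℝ × (ι → ℝ) × (ι → ℝ) × ℝ × ℝ) × ℝ → ℝ := fun p =>
    g (geo Γ p.1.1 p.1.2.1 (p.1.2.2.2.2.1 • p.1.2.2.2.1) p.2, p.1.2.1)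
      (geoVel Γ p.1.1 p.1.2.1 p.1.2.2.1 (p.1.2.2.2.2.1 • p.1.2.2.2.1)
        (p.1.2.2.2.2.2 • p.1.2.2.2.1 - p.1.2.2.2.2.1 • Γ (p.1.1, p.1.2.1) p.1.2.2.1 p.1.2.2.2.1) p.2)
      (geoVel Γ p.1.1 p.1.2.1 p.1.2.2.1 (p.1.2.2.2.2.1 • p.1.2.2.2.1)
        (p.1.2.2.2.2.2 • p.1.2.2.2.1 - p.1.2.2.2.2.1 • Γ (p.1.1, p.1.2.1) p.1.2.2.1 p.1.2.2.2.1) p.2)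
    with hk
  have hks : ∀ z ∈ P, ContDiffAt ℝ ∞ k (z, 0) := by
    rintro ⟨x, t, v, e, a, b⟩ ⟨hx, ht, -⟩
    have hΩ : ∀ y, (y, t) ∈ (univ : Set (ι → ℝ)) ×ˢ Ioo 0 T := fun y =>
      ⟨mem_univ _, hta.trans_le ht.1, ht.2.trans_lt htb⟩
    have hΓ : ContDiffAt ℝ ∞ Γ (x, t) := M.smooth_conn _ (hΩ x)
    have h1 : ContDiffAt ℝ ∞ (fun p : ((ι → ℝ) × ℝ × (ι → ℝ) × (ι → ℝ) × ℝ × ℝ) × ℝ =>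
        Γ (p.1.1, p.1.2.1)) ((x, t, v, e, a, b), 0) :=
      hΓ.comp _ (f := fun p : ((ι → ℝ) × ℝ × (ι → ℝ) × (ι → ℝ) × ℝ × ℝ) × ℝ => (p.1.1, p.1.2.1))
        (by fun_prop)
    have h2 : ContDiffAt ℝ ∞ (fun p : ((ι → ℝ) × ℝ × (ι → ℝ) × (ι → ℝ) × ℝ × ℝ) × ℝ =>
        Γ (p.1.1, p.1.2.1) p.1.2.2.1 p.1.2.2.2.1) ((x, t, v, e, a, b), 0) :=
      (h1.clm_apply (by fun_prop)).clm_apply (by fun_prop)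
    have h3 := contDiffAt_geo (Γ := Γ)
      (x := fun p : ((ι → ℝ) × ℝ × (ι → ℝ) × (ι → ℝ) × ℝ × ℝ) × ℝ => p.1.1)
      (t := fun p => p.1.2.1) (V := fun p => p.1.2.2.2.2.1 • p.1.2.2.2.1) (h := fun p => p.2)
      (q := ((x, t, v, e, a, b), 0)) hΓ (by fun_prop) (by fun_prop) (by fun_prop) (by fun_prop)
    have h4 := contDiffAt_geoVel (Γ := Γ)
      (x := fun p : ((ι → ℝ) × ℝ × (ι → ℝ) × (ι → ℝ) × ℝ × ℝ) × ℝ => p.1.1)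
      (t := fun p => p.1.2.1) (v := fun p => p.1.2.2.1) (V := fun p => p.1.2.2.2.2.1 • p.1.2.2.2.1)
      (W := fun p => p.1.2.2.2.2.2 • p.1.2.2.2.1
        - p.1.2.2.2.2.1 • Γ (p.1.1, p.1.2.1) p.1.2.2.1 p.1.2.2.2.1) (h := fun p => p.2)
      (q := ((x, t, v, e, a, b), 0)) hΓ (by fun_prop) (by fun_prop) (by fun_prop) (by fun_prop)
      (ContDiffAt.sub (f := fun p : ((ι → ℝ) × ℝ × (ι → ℝ) × (ι → ℝ) × ℝ × ℝ) × ℝ =>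
        p.1.2.2.2.2.2 • p.1.2.2.2.1) (by fun_prop) (ContDiffAt.smul
        (f := fun p : ((ι → ℝ) × ℝ × (ι → ℝ) × (ι → ℝ) × ℝ × ℝ) × ℝ => p.1.2.2.2.2.1)
        (by fun_prop) h2)) (by fun_prop)
    have h5 : ContDiffAt ℝ ∞ (fun p : ((ι → ℝ) × ℝ × (ι → ℝ) × (ι → ℝ) × ℝ × ℝ) × ℝ =>
        g (geo Γ p.1.1 p.1.2.1 (p.1.2.2.2.2.1 • p.1.2.2.2.1) p.2, p.1.2.1))
        ((x, t, v, e, a, b), 0) :=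
      ContDiffAt.comp (g := g) (f := fun p :
        ((ι → ℝ) × ℝ × (ι → ℝ) × (ι → ℝ) × ℝ × ℝ) × ℝ =>
          (geo Γ p.1.1 p.1.2.1 (p.1.2.2.2.2.1 • p.1.2.2.2.1) p.2, p.1.2.1)) _
        (M.smooth_metric _ (hΩ _)) (h3.prodMk
        (by fun_prop : ContDiffAt ℝ ∞ (fun p :
          ((ι → ℝ) × ℝ × (ι → ℝ) × (ι → ℝ) × ℝ × ℝ) × ℝ => p.1.2.1) _))
    exact Hom.contDiffAt_apply (Hom.contDiffAt_apply h5 h4) h4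
  obtain ⟨ρ, hρ, H⟩ := exists_uniform_taylor_two hPc hks hη
  refine ⟨ρ, hρ, fun x hx t ht v e hv he a ha b hb h hh => ?_⟩
  have hz : (x, t, v, e, a, b) ∈ P :=
    ⟨hx, ht, by simpa using hv, by simpa using he, ha, hb⟩
  have hΩ : ∀ y, (y, t) ∈ (univ : Set (ι → ℝ)) ×ˢ Ioo 0 T := fun y =>
    ⟨mem_univ _, hta.trans_le ht.1, ht.2.trans_lt htb⟩
  have hW : b • e - a • Γ (x, t) v e + Γ (x, t) (a • e) v = b • e := by
    rw [M.torsion _ (hΩ x) (a • e) v, map_smul]; abel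
  have h1 := lastDeriv_eq_deriv (hks _ hz)
  have h2 := lastDeriv_lastDeriv_eq (hks _ hz)
  have e1 := M.deriv_energy_zero (x := x) hΩ v (a • e) (b • e - a • Γ (x, t) v e)
  have e2 := M.deriv_deriv_energy_zero (x := x) hΩ v (a • e) (b • e - a • Γ (x, t) v e)
  rw [hW] at e1 e2
  have h3 := (abs_le.1 (H _ hz h hh)).2
  rw [h1, h2] at h3
  simp only [hk] at h3
  rw [e1, e2] at h3
  have e0 : geo Γ x t (a • e) 0 = x := by simp [geo]
  have e0' : geoVel Γ x t v (a • e) (b • e - a • Γ (x, t) v e) 0 = v := by simp [geoVel]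
  rw [e0, e0'] at h3
  simp only [map_smul, Hom.smul_apply, smul_eq_mul, _root_.smul_apply] at h3 ⊢
  nlinarith [h3]

theorem metric_time_taylor (M : MetricOn ((univ : Set (ι → ℝ)) ×ˢ Ioo 0 T) g Γ)
    (hfl : ∀ z ∈ (univ : Set (ι → ℝ)) ×ˢ Ioo 0 T,
      fderiv ℝ g z (0, 1) = (-2 : ℝ) • traceTen (curv Γ z))
    (hS : IsCompact S) (hta : 0 < ta) (htb : tb < T) (hη : 0 < η) :
    ∃ ρ > 0, ∀ x ∈ S, ∀ t ∈ Icc ta tb, ∀ v : ι → ℝ, ‖v‖ ≤ R → ∀ h : ℝ, 0 ≤ h → h ≤ ρ →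
      g (x, t - h) v v ≤ g (x, t) v v + h * (2 * traceTen (curv Γ (x, t)) v v) + η * h := by
  set P : Set ((ι → ℝ) × ℝ × (ι → ℝ)) := S ×ˢ Icc ta tb ×ˢ Metric.closedBall 0 R with hP
  have hPc : IsCompact P := hS.prod (isCompact_Icc.prod (isCompact_closedBall _ _))
  set k : ((ι → ℝ) × ℝ × (ι → ℝ)) × ℝ → ℝ := fun p => g (p.1.1, p.1.2.1 - p.2) p.1.2.2 p.1.2.2
    with hk
  have hks : ∀ z ∈ P, ContDiffAt ℝ ∞ k (z, 0) := by
    rintro ⟨x, t, v⟩ ⟨hx, ht, -⟩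
    have hΩ : (x, t - 0) ∈ (univ : Set (ι → ℝ)) ×ˢ Ioo 0 T :=
      ⟨mem_univ _, by simpa using hta.trans_le ht.1, by simpa using ht.2.trans_lt htb⟩
    have h5 : ContDiffAt ℝ ∞ (fun p : ((ι → ℝ) × ℝ × (ι → ℝ)) × ℝ => g (p.1.1, p.1.2.1 - p.2))
        ((x, t, v), 0) := ContDiffAt.comp (g := g) _ (M.smooth_metric _ hΩ) (by fun_prop)
    exact Hom.contDiffAt_apply (Hom.contDiffAt_apply h5 (by fun_prop)) (by fun_prop)
  obtain ⟨ρ, hρ, H⟩ := exists_uniform_taylor_one hPc hks hη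
  refine ⟨ρ, hρ, fun x hx t ht v hv h h0 hh => ?_⟩
  have hz : (x, t, v) ∈ P := ⟨hx, ht, by simpa using hv⟩
  have hΩ : (x, t) ∈ (univ : Set (ι → ℝ)) ×ˢ Ioo 0 T :=
    ⟨mem_univ _, hta.trans_le ht.1, ht.2.trans_lt htb⟩
  have h1 : HasDerivAt (fun h => k ((x, t, v), h)) (2 * traceTen (curv Γ (x, t)) v v) 0 := by
    have hc : HasDerivAt (fun h : ℝ => (x, t - h)) (-(0, 1) : (ι → ℝ) × ℝ) 0 := by
      refine ((hasDerivAt_const (0 : ℝ) x).prodMk ((hasDerivAt_id (0 : ℝ)).const_sub t)).congr_deriv ?_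
      simp
    have hg' : HasFDerivAt g (fderiv ℝ g (x, t)) (x, t - 0) := by
      rw [sub_zero]; exact ((M.smooth_metric _ hΩ).differentiableAt (by simp)).hasFDerivAt
    have h2 := hg'.comp_hasDerivAt (0 : ℝ) hc
    rw [map_neg, hfl _ hΩ] at h2
    have h3 := Hom.hasDerivAt_apply (Hom.hasDerivAt_apply h2 (hasDerivAt_const (0 : ℝ) v))
      (hasDerivAt_const (0 : ℝ) v)
    refine h3.congr_deriv ?_
    simp
  have h3 := (abs_le.1 (H _ hz h (by rwa [abs_of_nonneg h0]))).2
  rw [lastDeriv_eq_deriv (hks _ hz), h1.deriv, abs_of_nonneg h0] at h3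
  simp only [hk, sub_zero] at h3
  linarith

theorem contDiffAt_comp_geo (M : MetricOn ((univ : Set (ι → ℝ)) ×ˢ Ioo 0 T) g Γ)
    (hU : ∀ z ∈ (univ : Set (ι → ℝ)) ×ˢ Ioo 0 T, ContDiffAt ℝ ∞ U z)
    (hta : 0 < ta) (htb : tb < T) :
    ∀ z ∈ S ×ˢ Icc ta tb ×ˢ Metric.closedBall (0 : ι → ℝ) R,
      ContDiffAt ℝ ∞ (fun p : ((ι → ℝ) × ℝ × (ι → ℝ)) × ℝ =>
        U (geo Γ p.1.1 p.1.2.1 p.1.2.2 p.2, p.1.2.1)) (z, 0) := by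
  rintro ⟨x, t, v⟩ ⟨hx, ht, -⟩
  have hΩ : ∀ y, (y, t) ∈ (univ : Set (ι → ℝ)) ×ˢ Ioo 0 T := fun y =>
    ⟨mem_univ _, hta.trans_le ht.1, ht.2.trans_lt htb⟩
  have h3 := contDiffAt_geo (Γ := Γ) (x := fun p : ((ι → ℝ) × ℝ × (ι → ℝ)) × ℝ => p.1.1)
      (t := fun p => p.1.2.1) (V := fun p => p.1.2.2) (h := fun p => p.2)
      (q := ((x, t, v), 0)) (M.smooth_conn _ (hΩ x)) (by fun_prop) (by fun_prop) (by fun_prop)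
      (by fun_prop)
  exact ContDiffAt.comp (g := U) _ (hU _ (hΩ _)) (h3.prodMk
    (by fun_prop : ContDiffAt ℝ ∞ (fun p : ((ι → ℝ) × ℝ × (ι → ℝ)) × ℝ => p.1.2.1) _))

theorem contDiffAt_comp_time
    (hU : ∀ z ∈ (univ : Set (ι → ℝ)) ×ˢ Ioo 0 T, ContDiffAt ℝ ∞ U z)
    (hta : 0 < ta) (htb : tb < T) :
    ∀ z ∈ S ×ˢ Icc ta tb, ContDiffAt ℝ ∞ (fun p : ((ι → ℝ) × ℝ) × ℝ => U (p.1.1, p.1.2 - p.2))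
      (z, 0) := by
  rintro ⟨x, t⟩ ⟨hx, ht⟩
  refine ContDiffAt.comp (g := U) _ (hU _ ?_) (by fun_prop)
  exact ⟨mem_univ _, by simpa using hta.trans_le ht.1, by simpa using ht.2.trans_lt htb⟩

theorem deriv_comp_time (f : ℝ → ℝ) (t : ℝ) : deriv (fun h => f (t - h)) 0 = -deriv f t := by
  rw [deriv_comp_const_sub]; simp

theorem space_taylor (M : MetricOn ((univ : Set (ι → ℝ)) ×ˢ Ioo 0 T) g Γ)
    (hU : ∀ z ∈ (univ : Set (ι → ℝ)) ×ˢ Ioo 0 T, ContDiffAt ℝ ∞ U z) (hS : IsCompact S)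
    (hta : 0 < ta) (htb : tb < T) (hη : 0 < η) :
    ∃ ρ > 0, ∀ x ∈ S, ∀ t ∈ Icc ta tb, ∀ e : ι → ℝ, ‖e‖ ≤ R → ∀ h : ℝ, |h| ≤ ρ →
      U (x, t) + h * deriv (fun h => U (geo Γ x t e h, t)) 0
        + h ^ 2 / 2 * deriv (deriv fun h => U (geo Γ x t e h, t)) 0 - η * h ^ 2 ≤
      U (geo Γ x t e h, t) := by
  have hks := contDiffAt_comp_geo (S := S) (R := R) M hU hta htb
  obtain ⟨ρ, hρ, H⟩ := exists_uniform_taylor_two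
    (hS.prod (isCompact_Icc.prod (isCompact_closedBall _ _))) hks hη
  refine ⟨ρ, hρ, fun x hx t ht e he h hh => ?_⟩
  have hz : (x, t, e) ∈ S ×ˢ Icc ta tb ×ˢ Metric.closedBall (0 : ι → ℝ) R :=
    ⟨hx, ht, by simpa using he⟩
  have h3 := (abs_le.1 (H _ hz h hh)).1
  rw [lastDeriv_eq_deriv (hks _ hz), lastDeriv_lastDeriv_eq (hks _ hz)] at h3
  have e0 : geo Γ x t e 0 = x := by simp [geo]
  simp only [e0] at h3
  linarith

theorem time_taylor (hU : ∀ z ∈ (univ : Set (ι → ℝ)) ×ˢ Ioo 0 T, ContDiffAt ℝ ∞ U z)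
    (hS : IsCompact S) (hta : 0 < ta) (htb : tb < T) (hη : 0 < η) :
    ∃ ρ > 0, ∀ x ∈ S, ∀ t ∈ Icc ta tb, ∀ h : ℝ, 0 ≤ h → h ≤ ρ →
      U (x, t) - h * deriv (fun s => U (x, s)) t - η * h ≤ U (x, t - h) := by
  have hks := contDiffAt_comp_time (S := S) hU hta htb
  obtain ⟨ρ, hρ, H⟩ := exists_uniform_taylor_one (hS.prod isCompact_Icc) hks hη
  refine ⟨ρ, hρ, fun x hx t ht h h0 hh => ?_⟩
  have hz : (x, t) ∈ S ×ˢ Icc ta tb := ⟨hx, ht⟩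
  have h3 := (abs_le.1 (H _ hz h (by rwa [abs_of_nonneg h0]))).1
  rw [lastDeriv_eq_deriv (hks _ hz), deriv_comp_time (fun s => U (x, s)), abs_of_nonneg h0] at h3
  simp only [sub_zero] at h3
  linarith

theorem exists_jet_bound (M : MetricOn ((univ : Set (ι → ℝ)) ×ˢ Ioo 0 T) g Γ)
    (hU : ∀ z ∈ (univ : Set (ι → ℝ)) ×ˢ Ioo 0 T, ContDiffAt ℝ ∞ U z) (hS : IsCompact S)
    (hta : 0 < ta) (htb : tb < T) :
    ∃ B : ℝ, ∀ x ∈ S, ∀ t ∈ Icc ta tb, |U (x, t)| ≤ B ∧ |deriv (fun s => U (x, s)) t| ≤ B ∧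
      ∀ e : ι → ℝ, ‖e‖ ≤ R → |deriv (fun h => U (geo Γ x t e h, t)) 0| ≤ B ∧
        |deriv (deriv fun h => U (geo Γ x t e h, t)) 0| ≤ B := by
  have hks := contDiffAt_comp_geo (S := S) (R := R) M hU hta htb
  have hks' := contDiffAt_comp_time (S := S) hU hta htb
  obtain ⟨B, hB⟩ := exists_bound_lastDeriv
    (hS.prod (isCompact_Icc.prod (isCompact_closedBall _ _))) hks
  obtain ⟨B', hB'⟩ := exists_bound_lastDeriv (hS.prod isCompact_Icc) hks'
  refine ⟨max B B', fun x hx t ht => ?_⟩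
  have hz' : (x, t) ∈ S ×ˢ Icc ta tb := ⟨hx, ht⟩
  obtain ⟨a1, a2, -⟩ := hB' _ hz'
  rw [lastDeriv_eq_deriv (hks' _ hz'), deriv_comp_time (fun s => U (x, s)), abs_neg] at a2
  simp only [sub_zero] at a1
  refine ⟨a1.trans (le_max_right _ _), a2.trans (le_max_right _ _), fun e he => ?_⟩
  have hz : (x, t, e) ∈ S ×ˢ Icc ta tb ×ˢ Metric.closedBall (0 : ι → ℝ) R :=
    ⟨hx, ht, by simpa using he⟩
  obtain ⟨-, b1, b2⟩ := hB _ hz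
  rw [lastDeriv_eq_deriv (hks _ hz)] at b1
  rw [lastDeriv_lastDeriv_eq (hks _ hz)] at b2
  exact ⟨b1.trans (le_max_left _ _), b2.trans (le_max_left _ _)⟩

end Uniform

section PointwiseBounds

theorem Hom.continuousAt_apply {P E W : Type*} [TopologicalSpace P]
    [NormedAddCommGroup E] [NormedSpace ℝ E] [NormedAddCommGroup W] [NormedSpace ℝ W]
    {F : P → Hom E W} {v : P → E} {q : P} (hF : ContinuousAt F q) (hv : ContinuousAt v q) :
    ContinuousAt (fun p => F p (v p)) q :=
  (((Hom.clm (E := E) (W := W)).continuous.continuousAt.comp hF)).clm_apply hv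

variable {ι : Type*} [Fintype ι] [DecidableEq ι] {T ta tb : ℝ}
variable {Ω : Set ((ι → ℝ) × ℝ)} {g : (ι → ℝ) × ℝ → Form (ι → ℝ)}
  {Γ : (ι → ℝ) × ℝ → (ι → ℝ) →L[ℝ] (ι → ℝ) →L[ℝ] (ι → ℝ)} {U : (ι → ℝ) × ℝ → ℝ}
  {S : Set (ι → ℝ)} {z : (ι → ℝ) × ℝ}

theorem MetricOn.exists_le_metric (M : MetricOn ((univ : Set (ι → ℝ)) ×ˢ Ioo 0 T) g Γ)
    (hS : IsCompact S) (hta : 0 < ta) (htb : tb < T) :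
    ∃ c > 0, ∀ x ∈ S, ∀ t ∈ Icc ta tb, ∀ v, c * ‖v‖ ^ 2 ≤ g (x, t) v v := by
  have hP := hS.prod ((isCompact_Icc (a := ta) (b := tb)).prod (isCompact_sphere (0 : ι → ℝ) 1))
  have hΩ : ∀ x, ∀ t ∈ Icc ta tb, (x, t) ∈ (univ : Set (ι → ℝ)) ×ˢ Ioo 0 T := fun x t ht =>
    ⟨mem_univ _, hta.trans_le ht.1, ht.2.trans_lt htb⟩
  have hc : ContinuousOn (fun q : (ι → ℝ) × ℝ × (ι → ℝ) => g (q.1, q.2.1) q.2.2 q.2.2)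
      (S ×ˢ Icc ta tb ×ˢ Metric.sphere (0 : ι → ℝ) 1) := by
    rintro ⟨x, t, v⟩ ⟨-, ht, -⟩
    have h1 : ContinuousAt (fun q : (ι → ℝ) × ℝ × (ι → ℝ) => g (q.1, q.2.1)) (x, t, v) :=
      ContinuousAt.comp (f := fun q : (ι → ℝ) × ℝ × (ι → ℝ) => (q.1, q.2.1))
        (M.smooth_metric _ (hΩ x t ht)).continuousAt (by fun_prop)
    exact (Hom.continuousAt_apply (Hom.continuousAt_apply h1 (by fun_prop))
      (by fun_prop)).continuousWithinAt
  have hc' : ∃ c > 0, ∀ q ∈ S ×ˢ Icc ta tb ×ˢ Metric.sphere (0 : ι → ℝ) 1,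
      c ≤ g (q.1, q.2.1) q.2.2 q.2.2 := by
    rcases (S ×ˢ Icc ta tb ×ˢ Metric.sphere (0 : ι → ℝ) 1).eq_empty_or_nonempty with he | hne
    · exact ⟨1, one_pos, by simp [he]⟩
    · obtain ⟨q, hq, hmin⟩ := hP.exists_isMinOn hne hc
      refine ⟨_, M.pos _ (hΩ q.1 q.2.1 hq.2.1) q.2.2 ?_, fun q' hq' => hmin hq'⟩
      intro h; have := hq.2.2; rw [h] at this; simp at this
  obtain ⟨c, hc0, H⟩ := hc'
  refine ⟨c, hc0, fun x hx t ht v => ?_⟩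
  by_cases hv : v = 0
  · simp [hv]
  have hn : ‖v‖ ≠ 0 := norm_ne_zero_iff.2 hv
  have h1 := H (x, t, ‖v‖⁻¹ • v) ⟨hx, ht, by simp [norm_smul, hn]⟩
  simp only [map_smul, Hom.smul_apply, smul_eq_mul] at h1
  have h2 : 0 < ‖v‖ ^ 2 := by positivity
  calc c * ‖v‖ ^ 2 ≤ (‖v‖⁻¹ * (‖v‖⁻¹ * g (x, t) v v)) * ‖v‖ ^ 2 := by gcongr
    _ = g (x, t) v v := by field_simp

variable {e : Module.Basis ι ℝ (ι → ℝ)}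

theorem IsONB.sum_sq {G : Form (ι → ℝ)} (he : IsONB G e) (v : ι → ℝ) :
    ∑ b, G v (e b) ^ 2 = G v v := by
  have h := congrArg (G v) (he.sum_eq v)
  simp only [map_sum, map_smul, smul_eq_mul] at h
  simp only [sq, h]

theorem MetricOn.abs_apply_le (M : MetricOn Ω g Γ) (hz : z ∈ Ω) (he : IsONB (g z) e) (v : ι → ℝ)
    (a : ι) : |g z (e a) v| ≤ √(g z v v) := by
  rw [M.symm z hz]
  exact abs_le_sqrt_sum_sq (fun b => g z v (e b)) (he.sum_sq v).symm a

theorem IsCurvNormSq.abs_curv_le (hU : IsCurvNormSq g Γ Ω U) (hz : z ∈ Ω)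
    (he : IsONB (g z) e) (v : ι → ℝ) (a : ι) :
    |g z (curv Γ z (e a) v v) (e a)| ≤ Fintype.card ι * √(U z) * g z v v := by
  set w : ι → ℝ := fun b => g z v (e b) with hw
  have hv : v = ∑ b, w b • e b := (he.sum_eq v).symm
  have hs : ∑ b, w b ^ 2 = g z v v := he.sum_sq v
  have h1 : g z (curv Γ z (e a) v v) (e a) =
      ∑ b, ∑ c, w b * w c * g z (curv Γ z (e a) (e b) (e c)) (e a) := by
    conv_lhs => rw [hv]
    simp only [map_sum, map_smul, Hom.sum_apply, Hom.smul_apply, _root_.sum_apply,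
      _root_.smul_apply, smul_eq_mul, Finset.mul_sum]
    rw [Finset.sum_comm]
    refine Finset.sum_congr rfl fun b _ => Finset.sum_congr rfl fun c _ => by ring
  have h2 : ∀ b c, |g z (curv Γ z (e a) (e b) (e c)) (e a)| ≤ √(U z) := fun b c =>
    abs_le_sqrt_sum_sq (fun I : ι × ι × ι × ι =>
      g z (curv Γ z (e I.1) (e I.2.1) (e I.2.2.1)) (e I.2.2.2)) (hU z hz e he) (a, b, c, a)
  rw [h1]
  calc |∑ b, ∑ c, w b * w c * g z (curv Γ z (e a) (e b) (e c)) (e a)|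
      ≤ ∑ b, ∑ c, |w b| * |w c| * √(U z) := by
        refine (Finset.abs_sum_le_sum_abs _ _).trans (Finset.sum_le_sum fun b _ =>
          (Finset.abs_sum_le_sum_abs _ _).trans (Finset.sum_le_sum fun c _ => ?_))
        rw [abs_mul, abs_mul]
        exact mul_le_mul_of_nonneg_left (h2 b c) (by positivity)
    _ = (∑ b, |w b|) ^ 2 * √(U z) := by
        rw [sq, Finset.sum_mul_sum, Finset.sum_mul]; simp only [Finset.sum_mul]
    _ ≤ (Fintype.card ι * g z v v) * √(U z) := by
        gcongr
        rw [← hs]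
        have := sq_sum_le_card_mul_sum_sq (s := Finset.univ) (f := fun b => |w b|)
        simpa [sq_abs] using this
    _ = _ := by ring

end PointwiseBounds

section Distance
variable {n : ℕ} {g : (Fin n → ℝ) → ℝ → Matrix (Fin n) (Fin n) ℝ} {T t : ℝ} {x₀ : Fin n → ℝ}

theorem riemDist_sq_le_of_bound (hg : SmoothMetricFamily g (Icc 0 T)) (ht : t ∈ Icc 0 T)
    {σ w : ℝ → Fin n → ℝ} {b : ℝ → ℝ} (hw : ContinuousOn w (Icc 0 1))
    (hσ : ∀ s ∈ Icc (0 : ℝ) 1, HasDerivAt σ (w s) s) (h0 : σ 0 = x₀)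
    (hb : ContinuousOn b (Icc 0 1))
    (hle : ∀ s ∈ Icc (0 : ℝ) 1, metricForm g (σ s, t) (w s) (w s) ≤ b s) :
    riemDist (fun y => g y t) x₀ (σ 1) ^ 2 ≤ ∫ s in (0 : ℝ)..1, b s := by
  have hu : UniqueDiffOn ℝ (Icc (0 : ℝ) 1) := uniqueDiffOn_Icc one_pos
  have h1 : ContDiffOn ℝ 1 σ (Icc 0 1) := by
    rw [contDiffOn_one_iff_derivWithin hu]
    exact ⟨fun s hs => (hσ s hs).differentiableAt.differentiableWithinAt,
      hw.congr fun s hs => (hσ s hs).hasDerivWithinAt.derivWithin (hu s hs)⟩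
  obtain ⟨γ, v, hv, hγ, heq⟩ := exists_extension h1
  have h2 := riemDist_sq_le_energy hg ht hv hγ ((heq 0 (by simp)).trans h0)
  rw [heq 1 (by simp)] at h2
  have hγc : Continuous γ := continuous_iff_continuousAt.2 fun s => (hγ s).continuousAt
  refine h2.trans (intervalIntegral.integral_mono_on_of_le_Ioo zero_le_one
    ((continuous_metricForm_comp hg hγc continuous_const (fun _ => ht) hv hv).intervalIntegrable
      _ _) (by
      apply ContinuousOn.intervalIntegrable; rwa [uIcc_of_le zero_le_one]) fun s hs => ?_)
  have hsI := Ioo_subset_Icc_self hs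
  have h3 : v s = w s := (hγ s).unique ((hσ s hsI).congr_of_eventuallyEq (by
    filter_upwards [Icc_mem_nhds hs.1 hs.2] with u hu using heq u hu))
  rw [h3, heq s hsI]
  exact hle s hsI

end Distance

section Cutoff

/-- The cutoff used to vary the end point of a path. -/
def cutoff (j : ℕ) (s : ℝ) : ℝ := 1 - (1 - s) ^ (j + 1)

/-- The derivative of `cutoff`. -/
def cutoffDeriv (j : ℕ) (s : ℝ) : ℝ := (j + 1) * (1 - s) ^ j

theorem hasDerivAt_cutoff (j : ℕ) (s : ℝ) : HasDerivAt (cutoff j) (cutoffDeriv j s) s := by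
  refine ((((hasDerivAt_id s).const_sub 1).pow (j + 1)).const_sub 1).congr_deriv ?_
  simp [cutoffDeriv]

theorem cutoff_mem (j : ℕ) {s : ℝ} (hs : s ∈ Icc (0 : ℝ) 1) : cutoff j s ∈ Icc (0 : ℝ) 1 := by
  have h1 : 0 ≤ 1 - s := by linarith [hs.2]
  have h2 : (1 - s) ^ (j + 1) ≤ 1 := pow_le_one₀ h1 (by linarith [hs.1])
  have h3 : 0 ≤ (1 - s) ^ (j + 1) := by positivity
  exact ⟨by unfold cutoff; linarith, by unfold cutoff; linarith⟩

theorem cutoffDeriv_mem (j : ℕ) {s : ℝ} (hs : s ∈ Icc (0 : ℝ) 1) :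
    cutoffDeriv j s ∈ Icc (0 : ℝ) (j + 1) := by
  have h1 : 0 ≤ 1 - s := by linarith [hs.2]
  have h2 : (1 - s) ^ j ≤ 1 := pow_le_one₀ h1 (by linarith [hs.1])
  exact ⟨by unfold cutoffDeriv; positivity, by unfold cutoffDeriv; nlinarith⟩

theorem continuous_cutoff (j : ℕ) : Continuous (cutoff j) := by unfold cutoff; fun_prop

theorem continuous_cutoffDeriv (j : ℕ) : Continuous (cutoffDeriv j) := by
  unfold cutoffDeriv; fun_prop

theorem integral_one_sub_pow (j : ℕ) : ∫ s in (0 : ℝ)..1, (1 - s) ^ j = 1 / (j + 1) := by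
  rw [intervalIntegral.integral_comp_sub_left (fun s => s ^ j)]; simp

theorem integral_cutoffDeriv (j : ℕ) : ∫ s in (0 : ℝ)..1, cutoffDeriv j s = 1 := by
  simp only [cutoffDeriv]
  rw [intervalIntegral.integral_const_mul, integral_one_sub_pow]
  field_simp

theorem integral_cutoffDeriv_sq_le (j : ℕ) : ∫ s in (0 : ℝ)..1, cutoffDeriv j s ^ 2 ≤ j + 1 := by
  have h : ∀ s, cutoffDeriv j s ^ 2 = (j + 1) ^ 2 * (1 - s) ^ (2 * j) := fun s => by
    unfold cutoffDeriv; ring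
  simp only [h]
  rw [intervalIntegral.integral_const_mul, integral_one_sub_pow]
  push_cast
  rw [mul_one_div, div_le_iff₀ (by positivity)]
  nlinarith [(Nat.cast_nonneg j : (0 : ℝ) ≤ j)]

theorem integral_one_sub_cutoff_sq_le (j : ℕ) :
    ∫ s in (0 : ℝ)..1, ((1 : ℝ) - cutoff j s ^ 2) ≤ 2 / (j + 2) := by
  have h : ∀ s ∈ Icc (0 : ℝ) 1, 1 - cutoff j s ^ 2 ≤ 2 * (1 - s) ^ (j + 1) := fun s _ => by
    unfold cutoff; nlinarith [sq_nonneg ((1 - s) ^ (j + 1))]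
  have hc := continuous_cutoff j
  refine (intervalIntegral.integral_mono_on zero_le_one
    ((by fun_prop : Continuous fun s => 1 - cutoff j s ^ 2).intervalIntegrable _ _)
    ((by fun_prop : Continuous fun s : ℝ => 2 * (1 - s) ^ (j + 1)).intervalIntegrable _ _)
    h).trans ?_
  rw [intervalIntegral.integral_const_mul, integral_one_sub_pow]
  push_cast
  exact le_of_eq (by rw [mul_one_div]; ring_nf)

end Cutoff

section Variation
variable {n : ℕ} {g : (Fin n → ℝ) → ℝ → Matrix (Fin n) (Fin n) ℝ} {T t ta tb m ℓ η R : ℝ}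
  {x₀ : Fin n → ℝ} {γ v : ℝ → Fin n → ℝ}

theorem continuousAt_fderiv_apply_fst {P E W : Type*} [TopologicalSpace P]
    [NormedAddCommGroup E] [NormedSpace ℝ E] [NormedAddCommGroup W] [NormedSpace ℝ W]
    {f : E × ℝ → W} {x v : P → E} {t : ℝ} {q : P} (hf : ContDiffAt ℝ ∞ f (x q, t))
    (hx : ContinuousAt x q) (hv : ContinuousAt v q) :
    ContinuousAt (fun p => fderiv ℝ f (x p, t) (v p, 0)) q :=
  (ContinuousAt.comp (f := fun p => (x p, t)) (hf.fderiv_right (m := ∞) (by simp)).continuousAt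
    (hx.prodMk continuousAt_const)).clm_apply (hv.prodMk continuousAt_const)

/-- Second order expansion of the distance to the end point, moved along a geodesic direction. -/
theorem riemDist_geo_le (hT : 0 < T) (hg : SmoothMetricFamily g (Icc 0 T)) (ht : t ∈ Ioo 0 T)
    (hp : SlowPath g t ℓ x₀ γ v) {X : ℝ → Fin n → ℝ}
    (hX : ∀ s ∈ Icc (0 : ℝ) 1, HasDerivAt X (-conn g (γ s, t) (v s) (X s)) s)
    (hX1 : ∀ s ∈ Icc (0 : ℝ) 1, metricForm g (γ s, t) (X s) (X s) = 1) (j : ℕ) {h : ℝ}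
    (H : ∀ s ∈ Icc (0 : ℝ) 1, ∀ a ∈ Icc (0 : ℝ) 1, ∀ b ∈ Icc (0 : ℝ) (j + 1),
      metricForm g (geo (conn g) (γ s) t (a • X s) h, t)
        (geoVel (conn g) (γ s) t (v s) (a • X s) (b • X s - a • conn g (γ s, t) (v s) (X s)) h)
        (geoVel (conn g) (γ s) t (v s) (a • X s) (b • X s - a • conn g (γ s, t) (v s) (X s)) h) ≤
      metricForm g (γ s, t) (v s) (v s) + h * (2 * b * metricForm g (γ s, t) (X s) (v s))
        + h ^ 2 * (b ^ 2 * metricForm g (γ s, t) (X s) (X s) - a ^ 2 *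
          metricForm g (γ s, t) (curv (conn g) (γ s, t) (X s) (v s) (v s)) (X s)) + η * h ^ 2) :
    riemDist (fun y => g y t) x₀ (geo (conn g) (γ 1) t (X 1) h) ^ 2 ≤ ℓ ^ 2 +
      h * (∫ s in (0 : ℝ)..1, 2 * cutoffDeriv j s * metricForm g (γ s, t) (X s) (v s)) +
      h ^ 2 / 2 * (∫ s in (0 : ℝ)..1, 2 * (cutoffDeriv j s ^ 2 - cutoff j s ^ 2 *
        metricForm g (γ s, t) (curv (conn g) (γ s, t) (X s) (v s) (v s)) (X s))) + η * h ^ 2 := by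
  have M := metricOn_conn hT hg
  have hΩ : ∀ y, (y, t) ∈ (univ : Set (Fin n → ℝ)) ×ˢ Ioo 0 T := fun y => ⟨mem_univ _, ht⟩
  have hγc := hp.continuous
  have hvc := hp.continuous_vel
  have hXc : ContinuousOn X (Icc 0 1) := fun s hs => (hX s hs).continuousAt.continuousWithinAt
  have hgc : Continuous fun s => metricForm g (γ s, t) := continuous_iff_continuousAt.2 fun s =>
    ContinuousAt.comp (f := fun s => (γ s, t)) (M.smooth_metric _ (hΩ (γ s))).continuousAt
      (by fun_prop)
  have hΓc : Continuous fun s => conn g (γ s, t) := continuous_iff_continuousAt.2 fun s =>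
    ContinuousAt.comp (f := fun s => (γ s, t)) (M.smooth_conn _ (hΩ (γ s))).continuousAt
      (by fun_prop)
  have hcc : Continuous fun s => curv (conn g) (γ s, t) := continuous_iff_continuousAt.2 fun s =>
    ContinuousAt.comp (f := fun s => (γ s, t))
      (contDiffAt_curv (M.smooth_conn _ (hΩ (γ s)))).continuousAt (by fun_prop)
  have hB : ContinuousOn (fun s => metricForm g (γ s, t) (X s) (v s)) (Icc 0 1) := fun s hs =>
    (Hom.continuousAt_apply (Hom.continuousAt_apply hgc.continuousAt (hX s hs).continuousAt)
      hvc.continuousAt).continuousWithinAt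
  have hC : ContinuousOn (fun s => metricForm g (γ s, t)
      (curv (conn g) (γ s, t) (X s) (v s) (v s)) (X s)) (Icc 0 1) := fun s hs =>
    (Hom.continuousAt_apply (Hom.continuousAt_apply hgc.continuousAt
      ((Hom.continuousAt_apply (Hom.continuousAt_apply hcc.continuousAt (hX s hs).continuousAt)
        hvc.continuousAt).clm_apply hvc.continuousAt)) (hX s hs).continuousAt).continuousWithinAt
  have hk := (continuous_cutoff j).continuousOn (s := Icc 0 1)
  have hk' := (continuous_cutoffDeriv j).continuousOn (s := Icc 0 1)
  have hE1 : ContinuousOn (fun s => 2 * cutoffDeriv j s * metricForm g (γ s, t) (X s) (v s))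
      (Icc 0 1) := (hk'.const_mul 2).mul hB
  have hE2 : ContinuousOn (fun s => 2 * (cutoffDeriv j s ^ 2 - cutoff j s ^ 2 *
      metricForm g (γ s, t) (curv (conn g) (γ s, t) (X s) (v s) (v s)) (X s))) (Icc 0 1) :=
    ((hk'.pow 2).sub ((hk.pow 2).mul hC)).const_mul 2
  set A := fun s => 2 * cutoffDeriv j s * metricForm g (γ s, t) (X s) (v s) with hA
  set B := fun s => 2 * (cutoffDeriv j s ^ 2 - cutoff j s ^ 2 *
      metricForm g (γ s, t) (curv (conn g) (γ s, t) (X s) (v s) (v s)) (X s)) with hB'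
  have hV : ∀ s ∈ Icc (0 : ℝ) 1, HasDerivAt (fun s => cutoff j s • X s)
      (cutoffDeriv j s • X s - cutoff j s • conn g (γ s, t) (v s) (X s)) s := fun s hs => by
    refine ((hasDerivAt_cutoff j s).smul (hX s hs)).congr_deriv ?_
    rw [smul_neg]; abel
  have key := riemDist_sq_le_of_bound (x₀ := x₀) hg (Ioo_subset_Icc_self ht)
    (σ := fun s => geo (conn g) (γ s) t (cutoff j s • X s) h)
    (w := fun s => geoVel (conn g) (γ s) t (v s) (cutoff j s • X s)
      (cutoffDeriv j s • X s - cutoff j s • conn g (γ s, t) (v s) (X s)) h)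
    (b := fun s => ℓ ^ 2 + h * A s + h ^ 2 / 2 * B s + η * h ^ 2) ?_
    (fun s hs => hasDerivAt_geo_path (M.smooth_conn _ (hΩ _)) (hp.hasDerivAt s) (hV s hs))
    (by simp [geo, cutoff, hp.zero])
    (((continuousOn_const.add (hE1.const_mul h)).add (hE2.const_mul _)).add continuousOn_const) ?_
  · have e1 : cutoff j 1 • X 1 = X 1 := by simp [cutoff]
    simp only [e1] at key
    refine key.trans (le_of_eq ?_)
    have i1 : IntervalIntegrable A volume 0 1 := by
      apply ContinuousOn.intervalIntegrable; rwa [uIcc_of_le zero_le_one]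
    have i2 : IntervalIntegrable B volume 0 1 := by
      apply ContinuousOn.intervalIntegrable; rwa [uIcc_of_le zero_le_one]
    rw [intervalIntegral.integral_add ((((intervalIntegrable_const).add (i1.const_mul h))).add
      (i2.const_mul _)) intervalIntegrable_const, intervalIntegral.integral_add
      ((intervalIntegrable_const).add (i1.const_mul h)) (i2.const_mul _),
      intervalIntegral.integral_add intervalIntegrable_const (i1.const_mul h)]
    simp
  · have hVc : ∀ s ∈ Icc (0 : ℝ) 1, ContinuousAt (fun s => cutoff j s • X s) s := fun s hs =>
      (continuous_cutoff j).continuousAt.smul (hX s hs).continuousAt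
    have hWc : ∀ s ∈ Icc (0 : ℝ) 1, ContinuousAt (fun s => cutoffDeriv j s • X s
        - cutoff j s • conn g (γ s, t) (v s) (X s)) s := fun s hs =>
      ((continuous_cutoffDeriv j).continuousAt.smul (hX s hs).continuousAt).sub
        ((continuous_cutoff j).continuousAt.smul
          ((hΓc.continuousAt.clm_apply hvc.continuousAt).clm_apply (hX s hs).continuousAt))
    intro s hs
    have c1 := continuousAt_fderiv_apply_fst (M.smooth_conn _ (hΩ (γ s))) hγc.continuousAt
      hvc.continuousAt
    exact ((hvc.continuousAt.add ((hWc s hs).const_smul h)).sub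
      (((((c1.clm_apply (hVc s hs)).clm_apply (hVc s hs)).add
        ((hΓc.continuousAt.clm_apply (hWc s hs)).clm_apply (hVc s hs))).add
        ((hΓc.continuousAt.clm_apply (hVc s hs)).clm_apply (hWc s hs))).const_smul
          (h ^ 2 / 2))).continuousWithinAt
  · intro s hs
    refine (H s hs _ (cutoff_mem j hs) _ (cutoffDeriv_mem j hs)).trans ?_
    have := hp.speed_le s hs
    rw [hX1 s hs]
    simp only [hA, hB']
    linarith

end Variation

section FirstSecondVariation
variable {n : ℕ} {g : (Fin n → ℝ) → ℝ → Matrix (Fin n) (Fin n) ℝ} {T t ta tb ℓ η r c A : ℝ}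
  {x₀ : Fin n → ℝ} {γ v : ℝ → Fin n → ℝ} {S : Set (Fin n → ℝ)}

theorem intervalIntegrable_of_continuousOn {f : ℝ → ℝ} (hf : ContinuousOn f (Icc 0 1)) :
    IntervalIntegrable f volume 0 1 := by
  apply ContinuousOn.intervalIntegrable; rwa [uIcc_of_le zero_le_one]

theorem abs_integral_le {f : ℝ → ℝ} {B : ℝ} (h : ∀ s ∈ Icc (0 : ℝ) 1, |f s| ≤ B) :
    |∫ s in (0 : ℝ)..1, f s| ≤ B := by
  have := intervalIntegral.norm_integral_le_of_norm_le_const (f := f) (C := B) (a := 0) (b := 1)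
    fun s hs => by
      rw [uIoc_of_le zero_le_one] at hs; exact h s (Ioc_subset_Icc_self hs)
  simpa using this

/-- Velocity of a slow path is bounded by a multiple of the length. -/
theorem norm_le_of_metric_le {c : ℝ} (hc : 0 < c) {w : Fin n → ℝ} {q a : ℝ}
    (h1 : c * ‖w‖ ^ 2 ≤ q) (h2 : q ≤ a ^ 2) (ha : 0 ≤ a) : ‖w‖ ≤ a / √c := by
  rw [le_div_iff₀ (Real.sqrt_pos.2 hc)]
  refine le_of_sq_le_sq ?_ ha
  rw [mul_pow, Real.sq_sqrt hc.le]; linarith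

/-- Along a slow path, the curvature terms of the variation formulas in a parallel frame. -/
theorem exists_frame_variation (hT : 0 < T) (hg : SmoothMetricFamily g (Icc 0 T))
    (ht : t ∈ Ioo 0 T) (hp : SlowPath g t ℓ x₀ γ v) (hℓ : 0 ≤ ℓ)
    (hA : ∀ s ∈ Icc (0 : ℝ) 1, riemNorm (fun y => g y t) (γ s) ≤ A) (j : ℕ) :
    ∃ X : Fin n → ℝ → Fin n → ℝ,
      (∀ a, ∀ s ∈ Icc (0 : ℝ) 1, HasDerivAt (X a) (-conn g (γ s, t) (v s) (X a s)) s) ∧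
      (∀ s ∈ Icc (0 : ℝ) 1, ∀ a b, metricForm g (γ s, t) (X a s) (X b s) = if a = b then 1 else 0) ∧
      (∀ a, |∫ s in (0 : ℝ)..1, 2 * cutoffDeriv j s * metricForm g (γ s, t) (X a s) (v s)|
        ≤ 2 * ℓ) ∧
      (∀ a, |∫ s in (0 : ℝ)..1, 2 * (cutoffDeriv j s ^ 2 - cutoff j s ^ 2 *
        metricForm g (γ s, t) (curv (conn g) (γ s, t) (X a s) (v s) (v s)) (X a s))|
        ≤ 2 * ((j + 1) ^ 2 + n * A * ℓ ^ 2)) ∧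
      |∫ s in (0 : ℝ)..1, traceTen (curv (conn g) (γ s, t)) (v s) (v s)| ≤ n ^ 2 * A * ℓ ^ 2 ∧
      ∑ a, (∫ s in (0 : ℝ)..1, 2 * (cutoffDeriv j s ^ 2 - cutoff j s ^ 2 *
        metricForm g (γ s, t) (curv (conn g) (γ s, t) (X a s) (v s) (v s)) (X a s)))
        + 2 * (∫ s in (0 : ℝ)..1, traceTen (curv (conn g) (γ s, t)) (v s) (v s)) ≤
        2 * n * (j + 1) + 4 * n ^ 2 * A * ℓ ^ 2 / (j + 2) := by
  have M := metricOn_conn hT hg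
  have hU := isCurvNormSq_riemNormSq hT hg
  have hΩ : ∀ y, (y, t) ∈ (univ : Set (Fin n → ℝ)) ×ˢ Ioo 0 T := fun y => ⟨mem_univ _, ht⟩
  have hγc := hp.continuous
  have hvc := hp.continuous_vel
  obtain ⟨e, he⟩ : ∃ e : Module.Basis (Fin n) ℝ (Fin n → ℝ), IsONB (metricForm g (γ 1, t)) e :=
    IsONB.exists (M.symm _ (hΩ _)) (M.pos _ (hΩ _)) (by simp)
  obtain ⟨X, -, hX, hXo⟩ := M.exists_parallel (s₀ := 1) two_pos hp.hasDerivAt hvc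
    (fun s => hΩ (γ s)) he
  have hI : Icc (0 : ℝ) 1 ⊆ Ioo (1 - 2) (1 + 2) := fun s hs =>
    ⟨by linarith [hs.1], by linarith [hs.2]⟩
  have hgc : Continuous fun s => metricForm g (γ s, t) := continuous_iff_continuousAt.2 fun s =>
    ContinuousAt.comp (f := fun s => (γ s, t)) (M.smooth_metric _ (hΩ (γ s))).continuousAt
      (by fun_prop)
  have hcc : Continuous fun s => curv (conn g) (γ s, t) := continuous_iff_continuousAt.2 fun s =>
    ContinuousAt.comp (f := fun s => (γ s, t))
      (contDiffAt_curv (M.smooth_conn _ (hΩ (γ s)))).continuousAt (by fun_prop)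
  set K : Fin n → ℝ → ℝ := fun a s =>
    metricForm g (γ s, t) (curv (conn g) (γ s, t) (X a s) (v s) (v s)) (X a s) with hK
  have hKc : ∀ a, ContinuousOn (K a) (Icc 0 1) := fun a s hs =>
    (Hom.continuousAt_apply (Hom.continuousAt_apply hgc.continuousAt
      ((Hom.continuousAt_apply (Hom.continuousAt_apply hcc.continuousAt
        (hX a s (hI hs)).continuousAt) hvc.continuousAt).clm_apply hvc.continuousAt))
          (hX a s (hI hs)).continuousAt).continuousWithinAt
  have hframe : ∀ s ∈ Icc (0 : ℝ) 1, ∃ e : Module.Basis (Fin n) ℝ (Fin n → ℝ),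
      (∀ a, e a = X a s) ∧ IsONB (metricForm g (γ s, t)) e := fun s hs =>
    IsONB.exists_of_family (hXo s (hI hs)) (by simp)
  have hv0 : ∀ s, 0 ≤ metricForm g (γ s, t) (v s) (v s) := fun s =>
    metricForm_nonneg hg (Ioo_subset_Icc_self ht) _ _
  have hA0 : 0 ≤ A := (Real.sqrt_nonneg _).trans (hA 0 (by simp))
  have hspeed := hp.speed_le
  have hB : ∀ a, ∀ s ∈ Icc (0 : ℝ) 1, |metricForm g (γ s, t) (X a s) (v s)| ≤ ℓ := by
    intro a s hs
    obtain ⟨e, h1, h2⟩ := hframe s hs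
    rw [← h1]
    exact (M.abs_apply_le (hΩ _) h2 _ _).trans (Real.sqrt_le_iff.2 ⟨hℓ, hspeed s hs⟩)
  have hKle : ∀ a, ∀ s ∈ Icc (0 : ℝ) 1, |K a s| ≤ n * A * ℓ ^ 2 := by
    intro a s hs
    obtain ⟨e, h1, h2⟩ := hframe s hs
    have h3 := hU.abs_curv_le (hΩ (γ s)) h2 (v s) a
    rw [h1, Fintype.card_fin] at h3
    refine h3.trans ?_
    have h4 := hA s hs
    rw [riemNorm_eq] at h4
    have := hv0 s
    have := hspeed s hs
    gcongr
  have htr : ∀ s ∈ Icc (0 : ℝ) 1,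
      traceTen (curv (conn g) (γ s, t)) (v s) (v s) = ∑ a, K a s := by
    intro s hs
    obtain ⟨e, h1, h2⟩ := hframe s hs
    rw [h2.traceTen_eq]; simp only [h1, hK]
  have hsum : ∀ s ∈ Icc (0 : ℝ) 1, |∑ a, K a s| ≤ n ^ 2 * A * ℓ ^ 2 := by
    intro s hs
    refine (Finset.abs_sum_le_sum_abs _ _).trans
      ((Finset.sum_le_sum fun a _ => hKle a s hs).trans (le_of_eq ?_))
    simp; ring
  have hk := continuous_cutoff j
  have hk' := continuous_cutoffDeriv j
  have htr' : ∫ s in (0 : ℝ)..1, traceTen (curv (conn g) (γ s, t)) (v s) (v s) =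
      ∫ s in (0 : ℝ)..1, ∑ a, K a s := by
    refine intervalIntegral.integral_congr fun s hs => ?_
    rw [uIcc_of_le zero_le_one] at hs
    exact htr s hs
  have hKs : ContinuousOn (fun s => ∑ a, K a s) (Icc 0 1) :=
    continuousOn_finsetSum _ fun a _ => hKc a
  refine ⟨X, fun a s hs => hX a s (hI hs), fun s hs => hXo s (hI hs), fun a => ?_, fun a => ?_,
    ?_, ?_⟩
  · have h1 := intervalIntegral.norm_integral_le_of_norm_le (μ := volume) (a := 0) (b := 1)
      (f := fun s => 2 * cutoffDeriv j s * metricForm g (γ s, t) (X a s) (v s))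
      (g := fun s => 2 * cutoffDeriv j s * ℓ) zero_le_one (Filter.Eventually.of_forall fun s hs => ?_)
      ((by fun_prop : Continuous fun s => 2 * cutoffDeriv j s * ℓ).intervalIntegrable _ _)
    · rw [intervalIntegral.integral_mul_const, intervalIntegral.integral_const_mul,
        integral_cutoffDeriv] at h1
      simpa using h1
    · have hs' := Ioc_subset_Icc_self hs
      have h2 := (cutoffDeriv_mem j hs').1
      rw [Real.norm_eq_abs, abs_mul, abs_of_nonneg (by positivity)]
      exact mul_le_mul_of_nonneg_left (hB a s hs') (by positivity)
  · refine abs_integral_le fun s hs => ?_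
    obtain ⟨h1, h2⟩ := cutoff_mem j hs
    obtain ⟨h3, h4⟩ := cutoffDeriv_mem j hs
    rw [abs_mul, abs_two]
    refine mul_le_mul_of_nonneg_left ((abs_sub _ _).trans (add_le_add ?_ ?_)) two_pos.le
    · rw [abs_of_nonneg (by positivity)]; exact pow_le_pow_left₀ h3 h4 2
    · rw [abs_mul, abs_of_nonneg (by positivity)]
      exact (mul_le_of_le_one_left (abs_nonneg _) (pow_le_one₀ h1 h2)).trans (hKle a s hs)
  · rw [htr']; exact abs_integral_le hsum
  · rw [htr', ← intervalIntegral.integral_finsetSum, ← intervalIntegral.integral_const_mul,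
      ← intervalIntegral.integral_add]
    · have h1 : ∫ s in (0 : ℝ)..1, (∑ a, 2 * (cutoffDeriv j s ^ 2 - cutoff j s ^ 2 * K a s)
          + 2 * ∑ a, K a s) ≤ ∫ s in (0 : ℝ)..1, (2 * n * cutoffDeriv j s ^ 2
            + 2 * (n ^ 2 * A * ℓ ^ 2) * (1 - cutoff j s ^ 2)) := by
        refine intervalIntegral.integral_mono_on zero_le_one (intervalIntegrable_of_continuousOn ?_)
          ((by fun_prop : Continuous fun s => 2 * n * cutoffDeriv j s ^ 2
            + 2 * (n ^ 2 * A * ℓ ^ 2) * (1 - cutoff j s ^ 2)).intervalIntegrable _ _) fun s hs => ?_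
        · exact (continuousOn_finsetSum _ fun a _ => (((hk'.continuousOn).pow 2).sub
            ((hk.continuousOn.pow 2).mul (hKc a))).const_mul 2).add (hKs.const_mul 2)
        · obtain ⟨h1, h2⟩ := cutoff_mem j hs
          have h3 := (abs_le.1 (hsum s hs)).2
          have h4 : 0 ≤ 1 - cutoff j s ^ 2 := by nlinarith
          rw [← Finset.mul_sum, Finset.sum_sub_distrib, ← Finset.mul_sum]
          simp only [Finset.sum_const, Finset.card_univ, Fintype.card_fin, nsmul_eq_mul]
          nlinarith [mul_le_mul_of_nonneg_left h3 h4]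
      refine h1.trans ?_
      rw [intervalIntegral.integral_add ((by fun_prop : Continuous fun s =>
          2 * n * cutoffDeriv j s ^ 2).intervalIntegrable _ _) ((by fun_prop : Continuous fun s =>
          2 * (n ^ 2 * A * ℓ ^ 2) * (1 - cutoff j s ^ 2)).intervalIntegrable _ _),
        intervalIntegral.integral_const_mul, intervalIntegral.integral_const_mul]
      have h5 := integral_cutoffDeriv_sq_le j
      have h6 := integral_one_sub_cutoff_sq_le j
      calc _ ≤ 2 * n * ((j : ℝ) + 1) + 2 * (n ^ 2 * A * ℓ ^ 2) * (2 / (j + 2)) := by gcongr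
        _ = _ := by ring
    · exact intervalIntegrable_of_continuousOn (continuousOn_finsetSum _ fun a _ =>
        (((hk'.continuousOn).pow 2).sub ((hk.continuousOn.pow 2).mul (hKc a))).const_mul 2)
    · exact (intervalIntegrable_of_continuousOn hKs).const_mul 2
    · exact fun a _ => intervalIntegrable_of_continuousOn
        ((((hk'.continuousOn).pow 2).sub ((hk.continuousOn.pow 2).mul (hKc a))).const_mul 2)

end FirstSecondVariation

section UniformVariation
variable {n : ℕ} {g : (Fin n → ℝ) → ℝ → Matrix (Fin n) (Fin n) ℝ} {T t ta tb ℓ η r c A : ℝ}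
  {x₀ : Fin n → ℝ} {γ v : ℝ → Fin n → ℝ} {S : Set (Fin n → ℝ)}

/-- First and second variation of the distance to the end point of a slow path, and its first
variation in time, with uniform errors. -/
theorem exists_uniform_variation (hT : 0 < T) (hg : SmoothMetricFamily g (Icc 0 T))
    (hfl : IsRicciFlow g (Icc 0 T)) (hS : IsCompact S) (hta : 0 < ta) (htb : tb < T)
    (hc : 0 < c) (hcS : ∀ x ∈ S, ∀ t ∈ Icc ta tb, ∀ v, c * ‖v‖ ^ 2 ≤ metricForm g (x, t) v v)
    (r : ℝ) (J : ℕ) (hη : 0 < η) :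
    ∃ ρ > 0, ∀ t ∈ Icc ta tb, ∀ ℓ ∈ Icc 0 r, ∀ γ v : ℝ → Fin n → ℝ, SlowPath g t ℓ x₀ γ v →
      (∀ s ∈ Icc (0 : ℝ) 1, γ s ∈ S) → ∀ A : ℝ,
      (∀ s ∈ Icc (0 : ℝ) 1, riemNorm (fun y => g y t) (γ s) ≤ A) → ∀ j ≤ J,
      ∃ e : Module.Basis (Fin n) ℝ (Fin n → ℝ), IsONB (metricForm g (γ 1, t)) e ∧
      ∃ (E₁ E₂ : Fin n → ℝ) (D : ℝ), (∀ a, |E₁ a| ≤ 2 * ℓ) ∧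
        (∀ a, |E₂ a| ≤ 2 * ((j + 1) ^ 2 + n * A * ℓ ^ 2)) ∧ |D| ≤ n ^ 2 * A * ℓ ^ 2 ∧
        ∑ a, E₂ a + 2 * D ≤ 2 * n * (j + 1) + 4 * n ^ 2 * A * ℓ ^ 2 / (j + 2) ∧
        (∀ a, ∀ h : ℝ, |h| ≤ ρ →
          riemDist (fun y => g y t) x₀ (geo (conn g) (γ 1) t (e a) h) ^ 2 ≤
            ℓ ^ 2 + h * E₁ a + h ^ 2 / 2 * E₂ a + η * h ^ 2) ∧
        ∀ h : ℝ, 0 ≤ h → h ≤ ρ → riemDist (fun y => g y (t - h)) x₀ (γ 1) ^ 2 ≤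
          ℓ ^ 2 + 2 * h * D + η * h := by
  have M := metricOn_conn hT hg
  set R := max r 1 / √c with hR
  obtain ⟨ρ₁, hρ₁, H₁⟩ := energy_taylor (R := R) (m := J + 1) M hS hta htb hη
  obtain ⟨ρ₂, hρ₂, H₂⟩ := metric_time_taylor (R := R) M
    (fun z hz => flow_metricForm hT hg hz hfl) hS hta htb hη
  refine ⟨min ta (min ρ₁ ρ₂), by positivity, fun t ht ℓ hℓ γ v hp hγS A hA j hj => ?_⟩
  have ht' : t ∈ Ioo 0 T := ⟨hta.trans_le ht.1, ht.2.trans_lt htb⟩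
  have hΩ : ∀ y, (y, t) ∈ (univ : Set (Fin n → ℝ)) ×ˢ Ioo 0 T := fun y => ⟨mem_univ _, ht'⟩
  have hγc := hp.continuous
  have hvc := hp.continuous_vel
  obtain ⟨X, hX, hXo, h1, h2, h3, h4⟩ := exists_frame_variation hT hg ht' hp hℓ.1 hA j
  obtain ⟨e, he, heo⟩ := IsONB.exists_of_family (hXo 1 (by simp)) (by simp)
  have hvR : ∀ s ∈ Icc (0 : ℝ) 1, ‖v s‖ ≤ R := fun s hs =>
    (norm_le_of_metric_le hc (hcS _ (hγS s hs) t ht _) (hp.speed_le s hs) hℓ.1).trans (by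
      rw [hR]; gcongr; exact hℓ.2.trans (le_max_left _ _))
  have hXR : ∀ a, ∀ s ∈ Icc (0 : ℝ) 1, ‖X a s‖ ≤ R := fun a s hs =>
    (norm_le_of_metric_le hc (hcS _ (hγS s hs) t ht _) (a := 1) (by simp [hXo s hs a a])
      zero_le_one).trans (by rw [hR]; gcongr; exact le_max_right _ _)
  have hjJ : (j : ℝ) + 1 ≤ J + 1 := by exact_mod_cast Nat.succ_le_succ hj
  refine ⟨e, heo, _, _, _, h1, h2, h3, h4, fun a h hh => ?_, fun h h0 hh => ?_⟩
  · rw [he]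
    refine riemDist_geo_le hT hg ht' hp (hX a) (fun s hs => by simpa using hXo s hs a a) j
      fun s hs b hb b' hb' => ?_
    exact H₁ _ (hγS s hs) t ht _ _ (hvR s hs) (hXR a s hs) b hb b' ⟨hb'.1, hb'.2.trans hjJ⟩ h
      (hh.trans ((min_le_right _ _).trans (min_le_left _ _)))
  · have hth : t - h ∈ Icc 0 T :=
      ⟨by linarith [ht.1, hh.trans (min_le_left _ _)], by linarith [ht.2]⟩
    have hcc : Continuous fun s => curv (conn g) (γ s, t) := continuous_iff_continuousAt.2 fun s =>
      ContinuousAt.comp (f := fun s => (γ s, t))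
        (contDiffAt_curv (M.smooth_conn _ (hΩ (γ s)))).continuousAt (by fun_prop)
    have hR' : Continuous fun s => traceTen (curv (conn g) (γ s, t)) (v s) (v s) :=
      continuous_iff_continuousAt.2 fun s => Hom.continuousAt_apply (Hom.continuousAt_apply
        ((traceTen (E := Fin n → ℝ)).continuous.continuousAt.comp hcc.continuousAt)
        hvc.continuousAt) hvc.continuousAt
    generalize hfd : (fun s => traceTen (curv (conn g) (γ s, t)) (v s) (v s)) = f at hR' ⊢
    have hfs : ∀ s, traceTen (curv (conn g) (γ s, t)) (v s) (v s) = f s := fun s =>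
      congrFun hfd s
    have h5 := riemDist_sq_le_of_bound hg hth hvc.continuousOn (fun s _ => hp.hasDerivAt s) hp.zero
      (b := fun s => ℓ ^ 2 + 2 * h * f s + η * h) (by fun_prop) fun s hs => by
        have h6 := H₂ _ (hγS s hs) t ht _ (hvR s hs) h h0
          (hh.trans ((min_le_right _ _).trans (min_le_right _ _)))
        have := hp.speed_le s hs
        rw [hfs] at h6
        linarith
    refine h5.trans (le_of_eq ?_)
    rw [intervalIntegral.integral_add ((by fun_prop : Continuous fun s => ℓ ^ 2
        + 2 * h * f s).intervalIntegrable _ _)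
        intervalIntegrable_const, intervalIntegral.integral_add intervalIntegrable_const
        ((by fun_prop : Continuous fun s => 2 * h * f s).intervalIntegrable _ _),
      intervalIntegral.integral_const_mul]
    simp

end UniformVariation

section NearMaximumInequality

theorem mul_sq_le_of_lower_bounds {a b u ψ X : ℝ} (hX : 0 ≤ X) (hb : 0 < b) (hau : a ≤ u)
    (hbψ : b ≤ ψ) (h : 0 < ψ → u * ψ ^ 2 ≤ X) : a * b ^ 2 ≤ X := by
  rcases le_or_gt a 0 with ha | ha
  · nlinarith [mul_nonneg_of_nonpos_of_nonpos ha (neg_nonpos.2 (sq_nonneg b))]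
  · refine le_trans ?_ (h (hb.trans_le hbψ))
    have hu : 0 ≤ u := ha.le.trans hau
    gcongr

set_option maxHeartbeats 800000 in
/-- The differential inequality at an approximate maximum of `e^{-ct} U ψ²`, from one-sided
second order bounds in space and first order bounds in time. -/
theorem near_max_inequality (n : ℕ) {M η ψm : ℝ} (hM : 1 ≤ M) (hη : 0 < η) (hψm : 0 < ψm) :
    ∃ η₀ > 0, ∀ ρ > 0, ∃ ε > 0, ∀ (c U D ψ q w Z : ℝ) (β κ p s : Fin n → ℝ),
      0 ≤ c → c ≤ M → 0 ≤ U → U ≤ M → |D| ≤ M → ψm ≤ ψ → ψ ≤ M → |q| ≤ M →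
      (∀ a, |β a| ≤ M) → (∀ a, |κ a| ≤ M) → (∀ a, |p a| ≤ M) → (∀ a, |s a| ≤ M) →
      (∀ a, |p a| ≤ w) →
      (∀ a, ∀ h : ℝ, |h| ≤ ρ → ∃ u ψ', U + h * β a + h ^ 2 / 2 * κ a - η₀ * h ^ 2 ≤ u ∧
        ψ + h * p a + h ^ 2 / 2 * s a - η₀ * h ^ 2 ≤ ψ' ∧ (0 < ψ' → u * ψ' ^ 2 ≤ U * ψ ^ 2 + ε)) →
      (∀ h : ℝ, 0 ≤ h → h ≤ ρ → ∃ u ψ', U - h * D - η₀ * h ≤ u ∧ ψ + h * q - η₀ * h ≤ ψ' ∧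
        (0 < ψ' → (1 + c * h) * u * ψ' ^ 2 ≤ U * ψ ^ 2 + ε)) →
      0 ≤ q + ∑ a, s a → D ≤ ∑ a, κ a + Z →
      c * (U * ψ ^ 2) ≤ 6 * n * w ^ 2 * U + Z * ψ ^ 2 + η := by
  set η₁ := η / (1 + n * (2 + 4 * M / ψm)) with hη₁
  have hη₁0 : 0 < η₁ := by positivity
  obtain ⟨a₀, ha₀, Ha⟩ := near_max_test hM hη₁0
  obtain ⟨b₀, hb₀, Hb⟩ := near_max_test_one hM hη₁0
  refine ⟨min a₀ b₀, by positivity, fun ρ hρ => ?_⟩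
  set ρ' := min ρ (min 1 (ψm / (2 * (2 * M + a₀ + b₀)))) with hρ'
  have hρ'0 : 0 < ρ' := by positivity
  have hρρ : ρ' ≤ ρ := min_le_left _ _
  have hρ1 : ρ' ≤ 1 := (min_le_right _ _).trans (min_le_left _ _)
  have hρψ : ρ' * (2 * M + a₀ + b₀) < ψm := by
    have : ρ' * (2 * (2 * M + a₀ + b₀)) ≤ ψm := by
      rw [← le_div_iff₀ (by positivity)]
      exact (min_le_right _ _).trans (min_le_right _ _)
    linarith
  obtain ⟨ε₁, hε₁, Ha⟩ := Ha ρ' hρ'0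
  obtain ⟨ε₂, hε₂, Hb⟩ := Hb ρ' hρ'0
  refine ⟨min ε₁ ε₂, by positivity, fun c U D ψ q w Z β κ p s hc hcM hU hUM hD hψ hψM hq hβ hκ hp
    hs hpw H₁ H₂ hqs hDκ => ?_⟩
  have hψ0 : 0 < ψ := hψm.trans_le hψ
  have hψM' : |ψ| ≤ M := by rwa [abs_of_pos hψ0]
  have hUM' : |U| ≤ M := by rwa [abs_of_nonneg hU]
  have time : c * U * ψ ^ 2 - D * ψ ^ 2 + 2 * U * ψ * q ≤ η₁ := by
    refine Hb c U D ψ q (by rwa [abs_of_nonneg hc]) hUM' hD hψM' hq fun h h0 hh => ?_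
    obtain ⟨u, ψ', h1, h2, h3⟩ := H₂ h h0 (hh.trans hρρ)
    have hh' : h * (M + b₀) < ψm :=
      lt_of_le_of_lt (mul_le_mul hh (by linarith) (by positivity) hρ'0.le) hρψ
    have hqh : -(h * M) ≤ h * q := by nlinarith [(abs_le.1 hq).1]
    have hab : min a₀ b₀ * h ≤ b₀ * h := by gcongr; exact min_le_right _ _
    have hch : 0 ≤ 1 + c * h := by positivity
    refine mul_sq_le_of_lower_bounds (u := (1 + c * h) * u) (ψ := ψ') (by positivity)
      (by nlinarith) (by gcongr; linarith) (by linarith) fun hψ' => (h3 hψ').trans ?_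
    gcongr; exact min_le_right _ _
  have space : ∀ a, κ a * ψ ^ 2 ≤ 6 * U * w ^ 2 - 2 * U * ψ * s a + η₁ * (2 + 4 * M / ψm) := by
    intro a
    obtain ⟨h4, h5⟩ := Ha U (β a) (κ a) ψ (p a) (s a) hUM' (hβ a) (hκ a) hψM' (hp a) (hs a)
      fun h hh => by
        obtain ⟨u, ψ', h1, h2, h3⟩ := H₁ a h (hh.trans hρρ)
        have hh1 : |h| ≤ 1 := hh.trans hρ1
        have hsq : h ^ 2 ≤ |h| := by
          rw [← sq_abs]; nlinarith [abs_nonneg h]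
        have hh' : |h| * (2 * M + a₀) < ψm :=
          lt_of_le_of_lt (mul_le_mul hh (by linarith) (by positivity) hρ'0.le) hρψ
        have hpa : -(|h| * M) ≤ h * p a := by
          have : |h * p a| ≤ |h| * M := by rw [abs_mul]; gcongr; exact hp a
          linarith [(abs_le.1 this).1]
        have hsa : -(|h| * M) ≤ h ^ 2 / 2 * s a := by
          have h6 := (abs_le.1 (hs a)).1
          have : h ^ 2 * M ≤ |h| * M := by gcongr
          nlinarith [sq_nonneg h]
        have hah : a₀ * h ^ 2 ≤ a₀ * |h| := by gcongr
        have hab : min a₀ b₀ * h ^ 2 ≤ a₀ * h ^ 2 := by gcongr; exact min_le_left _ _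
        refine mul_sq_le_of_lower_bounds (u := u) (ψ := ψ') (by positivity)
          (by nlinarith) (by linarith) (by linarith) fun hψ' => (h3 hψ').trans ?_
        gcongr; exact min_le_left _ _
    set δ := β a * ψ ^ 2 + 2 * U * ψ * p a with hδ
    have h6 : β a * ψ = δ / ψ - 2 * U * p a := by field_simp; rw [hδ]; ring
    have h7 : -(p a * (δ / ψ)) ≤ M * η₁ / ψm := by
      refine (neg_le_abs _).trans ?_
      rw [abs_mul, abs_div, abs_of_pos hψ0, ← mul_div_assoc]
      gcongr
      exact hp a
    have h8 : p a ^ 2 ≤ w ^ 2 := by rw [← sq_abs]; gcongr; exact hpw a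
    have h9 : κ a / 2 * ψ ^ 2 + 2 * (β a * ψ) * p a + U * (p a ^ 2 + ψ * s a) ≤ η₁ := by linarith
    rw [h6] at h9
    have h10 : U * p a ^ 2 ≤ U * w ^ 2 := by gcongr
    have h11 : η₁ * (2 + 4 * M / ψm) = 2 * η₁ + 4 * (M * η₁ / ψm) := by ring
    rw [h11]
    nlinarith
  have hsum := Finset.sum_le_sum fun a (_ : a ∈ Finset.univ) => space a
  rw [← Finset.sum_mul, Finset.sum_add_distrib, Finset.sum_sub_distrib, ← Finset.mul_sum,
    ← Finset.mul_sum] at hsum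
  simp only [Finset.sum_const, Finset.card_univ, Fintype.card_fin, nsmul_eq_mul] at hsum
  have h12 : η₁ + n * (η₁ * (2 + 4 * M / ψm)) = η := by
    rw [hη₁]; field_simp
  have h13 : 0 ≤ 2 * U * ψ * (q + ∑ a, s a) := by positivity
  have h14 : D * ψ ^ 2 ≤ (∑ a, κ a + Z) * ψ ^ 2 := by gcongr
  nlinarith

end NearMaximumInequality

section Weight
variable {n : ℕ} {g : (Fin n → ℝ) → ℝ → Matrix (Fin n) (Fin n) ℝ} {T t ta tb ℓ η r r₀ c A K w L : ℝ}
  {x₀ : Fin n → ℝ}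

/-- The spatial weight of the maximum principle, as a function of the distance to the centre. -/
def weight (w r L d t : ℝ) : ℝ := w * (r - √(d ^ 2 + t) - L * √t) - 1 / 2

theorem sqrt_le_tangent {a b : ℝ} (ha : 0 < a) (hb : 0 ≤ b) : √b ≤ √a + (b - a) / (2 * √a) := by
  have h := Real.sqrt_pos.2 ha
  have h1 : (b - a) / (2 * √a) * (2 * √a) = b - a := div_mul_cancel₀ _ (by positivity)
  nlinarith [sq_nonneg (√b - √a), Real.sq_sqrt ha.le, Real.sq_sqrt hb]

theorem weight_lower {d t' X : ℝ} (hw : 0 ≤ w) (hL : 0 ≤ L) (ht : 0 < t) (ht' : 0 ≤ t')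
    (hX : d ^ 2 ≤ X) :
    weight w r L ℓ t - w * ((X + t' - ℓ ^ 2 - t) / (2 * √(ℓ ^ 2 + t)) + L * ((t' - t) / (2 * √t)))
      ≤ weight w r L d t' := by
  have h1 : √(d ^ 2 + t') ≤ √(ℓ ^ 2 + t) + (X + t' - ℓ ^ 2 - t) / (2 * √(ℓ ^ 2 + t)) :=
    (Real.sqrt_le_sqrt (by linarith)).trans ((sqrt_le_tangent (a := ℓ ^ 2 + t) (b := X + t')
      (by positivity) (by linarith [sq_nonneg d])).trans (le_of_eq (by ring)))
  have h2 := mul_le_mul_of_nonneg_left (sqrt_le_tangent ht ht') hL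
  have h3 := mul_le_mul_of_nonneg_left (add_le_add h1 h2) hw
  unfold weight
  linarith

theorem lt_of_weight_pos {d : ℝ} (hw : 0 < w) (hL : 0 ≤ L) (ht : 0 ≤ t)
    (h : 0 < weight w r L d t) : d < r ∧ weight w r L d t ≤ w * r := by
  have h1 : d ≤ √(d ^ 2 + t) := Real.le_sqrt_of_sq_le (by linarith)
  have h2 : 0 ≤ L * √t := by positivity
  unfold weight at h ⊢
  have h3 : 0 < r - √(d ^ 2 + t) - L * √t := by
    by_contra hc
    have := mul_nonpos_of_nonneg_of_nonpos hw.le (not_lt.1 hc)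
    linarith
  refine ⟨by linarith, ?_⟩
  have := mul_le_mul_of_nonneg_left (show r - √(d ^ 2 + t) - L * √t ≤ r by
    linarith [Real.sqrt_nonneg (d ^ 2 + t)]) hw.le
  linarith

theorem slope_sum_nonneg {E D : ℝ} {j : ℕ} (hn : 1 ≤ n) (hK : 1 ≤ K) (hw : 0 ≤ w) (ht : 0 < t)
    (hℓ : 0 ≤ ℓ) (hj : (j : ℝ) ≤ ℓ / √t) (hj' : ℓ / √t < j + 1)
    (hE : E + 2 * D ≤ 2 * n * (j + 1) + 4 * n ^ 2 * (K / t) * ℓ ^ 2 / (j + 2)) :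
    0 ≤ w * ((1 - 2 * D) / (2 * √(ℓ ^ 2 + t)) + 8 * n ^ 2 * K / (2 * √t))
      - w * E / (2 * √(ℓ ^ 2 + t)) := by
  set σ := √t with hσ
  set H := √(ℓ ^ 2 + t) with hH
  have hσ0 : 0 < σ := Real.sqrt_pos.2 ht
  have hσt : σ ^ 2 = t := Real.sq_sqrt ht.le
  have hH0 : 0 < H := Real.sqrt_pos.2 (by positivity)
  have hσH : σ ≤ H := Real.sqrt_le_sqrt (by linarith [sq_nonneg ℓ])
  have hℓH : ℓ ≤ H := Real.le_sqrt_of_sq_le (by linarith)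
  have hn' : (1 : ℝ) ≤ n := by exact_mod_cast hn
  have hn2 : (n : ℝ) ≤ n ^ 2 * K := by nlinarith
  rw [le_div_iff₀ hσ0] at hj
  rw [div_lt_iff₀ hσ0] at hj'
  have h1 : ((j : ℝ) + 1) * σ ≤ 2 * H := by linarith
  have h2 : K / t * ℓ ^ 2 / (j + 2) * σ ≤ K * H := by
    rw [div_mul_eq_mul_div, div_le_iff₀ (by positivity), div_mul_eq_mul_div, div_mul_eq_mul_div,
      div_le_iff₀ ht, ← hσt]
    have h3 : ℓ * ℓ ≤ H * (σ * (j + 2)) := mul_le_mul hℓH (by linarith) hℓ hH0.le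
    have h4 := mul_le_mul_of_nonneg_left h3 (by positivity : 0 ≤ K * σ)
    nlinarith
  have h5 : (E + 2 * D) * σ ≤ 8 * n ^ 2 * K * H := by
    calc (E + 2 * D) * σ ≤ (2 * n * (j + 1) + 4 * n ^ 2 * (K / t) * ℓ ^ 2 / (j + 2)) * σ := by
          gcongr
      _ = 2 * n * ((j + 1) * σ) + 4 * n ^ 2 * (K / t * ℓ ^ 2 / (j + 2) * σ) := by ring
      _ ≤ 2 * n * (2 * H) + 4 * n ^ 2 * (K * H) := by gcongr
      _ ≤ 8 * n ^ 2 * K * H := by nlinarith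
  have h6 : w * ((1 - 2 * D) / (2 * H) + 8 * n ^ 2 * K / (2 * σ)) - w * E / (2 * H)
      = w * (σ + (8 * n ^ 2 * K * H - (E + 2 * D) * σ)) / (2 * H * σ) := by
    field_simp; ring
  rw [h6]
  have h7 : 0 ≤ 8 * n ^ 2 * K * H - (E + 2 * D) * σ := by linarith
  positivity

end Weight

section MaximumPrinciple
variable {n : ℕ} {g : (Fin n → ℝ) → ℝ → Matrix (Fin n) (Fin n) ℝ} {T t ta tb ℓ η r r₀ c A K w L τ θ : ℝ}
  {x₀ : Fin n → ℝ}

theorem exists_weight_near {d U a : ℝ} (hpos : 0 < weight w r L d t)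
    (h : a < U * weight w r L d t ^ 2) :
    ∃ ℓ > d, 0 < weight w r L ℓ t ∧ a < U * weight w r L ℓ t ^ 2 := by
  have hc : Continuous fun d => weight w r L d t := by unfold weight; fun_prop
  have h1 : ∀ᶠ ℓ in 𝓝[>] d, 0 < weight w r L ℓ t :=
    nhdsWithin_le_nhds (hc.continuousAt.eventually (lt_mem_nhds hpos))
  have h2 : ∀ᶠ ℓ in 𝓝[>] d, a < U * weight w r L ℓ t ^ 2 :=
    nhdsWithin_le_nhds (((continuous_const.mul (hc.pow 2)).continuousAt
      (x := d)).eventually (lt_mem_nhds h))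
  obtain ⟨ℓ, h3, h4, h5⟩ := (h1.and (h2.and self_mem_nhdsWithin)).exists
  exact ⟨ℓ, h5, h3, h4⟩

theorem weight_antitone {d d' : ℝ} (hw : 0 ≤ w) (hd : 0 ≤ d) (h : d ≤ d') :
    weight w r L d' t ≤ weight w r L d t := by
  unfold weight
  have : √(d ^ 2 + t) ≤ √(d' ^ 2 + t) := Real.sqrt_le_sqrt (by gcongr)
  gcongr

set_option maxHeartbeats 800000 in
/-- An approximate maximum of `e^{-ct} |Rm|² ψ²`, at which the maximum principle gives a
differential inequality without derivatives. -/
theorem exists_near_max (hT : 0 < T) (hg : SmoothMetricFamily g (Icc 0 T))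
    (hfl : IsRicciFlow g (Icc 0 T)) (hr : 0 ≤ r) (hr₀ : r < r₀)
    (hcpt : ∀ t ∈ Icc (0 : ℝ) T, IsCompact (closure (rBall (fun y => g y t) x₀ r₀)))
    (hK : 1 ≤ K) (hKt : ∀ t, 0 < t → t ≤ T → ∀ x, riemDist (fun y => g y t) x₀ x < r₀ →
      riemNorm (fun y => g y t) x ≤ K / t)
    (hn : 1 ≤ n) (hw : 0 < w) (hτ : 0 < τ) (htb : tb < T) (hc : 0 ≤ c) (hθ : 0 < θ)
    (hinit : ∀ t, 0 < t → t < τ → ∀ x,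
      0 < weight w r (8 * n ^ 2 * K) (riemDist (fun y => g y t) x₀ x) t →
      Real.exp (-(c * t)) * (riemNormSq (fun y => g y t) x *
        weight w r (8 * n ^ 2 * K) (riemDist (fun y => g y t) x₀ x) t ^ 2) ≤ θ)
    (hmax : ∃ t ∈ Icc τ tb, ∃ x,
      0 < weight w r (8 * n ^ 2 * K) (riemDist (fun y => g y t) x₀ x) t ∧
      θ ≤ Real.exp (-(c * t)) * (riemNormSq (fun y => g y t) x *
        weight w r (8 * n ^ 2 * K) (riemDist (fun y => g y t) x₀ x) t ^ 2))
    (hη : 0 < η) :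
    ∃ t ∈ Icc τ tb, ∃ x ψ, 0 < ψ ∧
      ψ ≤ weight w r (8 * n ^ 2 * K) (riemDist (fun y => g y t) x₀ x) t ∧
      θ / 2 ≤ riemNormSq (fun y => g y t) x * ψ ^ 2 ∧
      c * (riemNormSq (fun y => g y t) x * ψ ^ 2) ≤ 6 * n * w ^ 2 * riemNormSq (fun y => g y t) x
        + 32 * n ^ 6 * (riemNormSq (fun y => g y t) x * riemNorm (fun y => g y t) x) * ψ ^ 2
        + η := by
  set L : ℝ := 8 * n ^ 2 * K with hL
  have hL0 : 0 ≤ L := by positivity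
  have hK0 : 0 < K := by linarith
  have hvar := fun {S ta tb c η} hS hta htb hc hcS r J hη => exists_uniform_variation (S := S)
    (ta := ta) (tb := tb) (c := c) (η := η) (x₀ := x₀) hT hg hfl hS hta htb hc hcS r J hη
  set U : (Fin n → ℝ) × ℝ → ℝ := fun z => riemNormSq (fun y => g y z.2) z.1 with hUdef
  set d : ℝ → (Fin n → ℝ) → ℝ := fun t x => riemDist (fun y => g y t) x₀ x with hd
  have hUe : ∀ x t, riemNormSq (fun y => g y t) x = U (x, t) := fun _ _ => rfl
  have hde : ∀ x t, riemDist (fun y => g y t) x₀ x = d t x := fun _ _ => rfl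
  simp only [hUe, hde, riemNorm_eq] at hinit hmax hKt ⊢
  have hd0 : ∀ t x, 0 ≤ d t x := fun t x => riemDist_nonneg _ _ _
  have hM := metricOn_conn hT hg
  have hsub : (univ : Set (Fin n → ℝ)) ×ˢ Ioo 0 T ⊆ univ ×ˢ Icc 0 T :=
    prod_mono_right Ioo_subset_Icc_self
  have hUs : ∀ z ∈ (univ : Set (Fin n → ℝ)) ×ˢ Ioo 0 T, ContDiffAt ℝ ∞ U z := fun z hz =>
    (contDiffOn_riemNormSq hT hg).contDiffAt (slab_mem_nhds hz)
  have hU0 : ∀ x t, t ∈ Icc 0 T → 0 ≤ U (x, t) := fun x t ht =>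
    riemNormSq_nonneg hg (z := (x, t)) ht
  have hUn : IsCurvNormSq (metricForm g) (conn g) (univ ×ˢ Ioo 0 T) U :=
    isCurvNormSq_riemNormSq hT hg
  have hpath : ∀ t ∈ Icc 0 T, ∀ x ℓ, d t x < ℓ → ∃ γ v, SlowPath g t ℓ x₀ γ v ∧ γ 1 = x :=
    fun t ht x ℓ h => exists_slowPath hg ht h
  have hspeed : ∀ t ∈ Icc 0 T, ∀ ℓ γ v, SlowPath g t ℓ x₀ γ v → 0 ≤ ℓ → ∀ s ∈ Icc (0 : ℝ) 1,
      d t (γ s) ≤ ℓ := fun t ht ℓ γ v hγ hℓ s hs =>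
    riemDist_le_of_speed hg ht hγ.continuous_vel hγ.hasDerivAt hγ.zero hℓ hs
      fun u hu => hγ.speed_le u ⟨hu.1, hu.2.trans hs.2⟩
  have hUr : ∀ x t, riemNorm (fun y => g y t) x = √(U (x, t)) := fun x t => riemNorm_eq _ _
  simp only [hde] at hvar
  clear_value U d
  clear hUe hde hUdef hd
  obtain ⟨S, hS, hSm⟩ := exists_compact_slowPath hg hr hr₀ hcpt
  obtain ⟨c', hc', hcS⟩ := hM.exists_le_metric hS hτ htb
  obtain ⟨B, hB⟩ := exists_jet_bound (R := 1 / √c') hM hUs hS hτ htb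
  have hIcc : ∀ {t}, t ∈ Icc τ tb → t ∈ Icc 0 T := fun ht =>
    ⟨hτ.le.trans ht.1, ht.2.trans htb.le⟩
  have hmem : ∀ {t x}, t ∈ Icc 0 T → 0 < weight w r L (d t x) t → x ∈ S := by
    intro t x ht h
    obtain ⟨γ, v, h1, h2⟩ := hpath t ht x r (lt_of_weight_pos hw hL0 ht.1 h).1
    rw [← h2]
    exact hSm t ht γ v h1 1 (by simp)
  set F : (Fin n → ℝ) → ℝ → ℝ := fun x t =>
    Real.exp (-(c * t)) * (U (x, t) * weight w r L (d t x) t ^ 2) with hF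
  set B₁ := max B 1 with hB₁
  have hB₁0 : 0 < B₁ := by positivity
  have hUB : ∀ {t x}, t ∈ Icc τ tb → x ∈ S → U (x, t) ≤ B₁ := fun ht hx =>
    (le_abs_self _).trans ((hB _ hx _ ht).1.trans (le_max_left _ _))
  set P : Set ℝ := {f | ∃ t ∈ Icc τ tb, ∃ x, 0 < weight w r L (d t x) t ∧ f = F x t} with hP
  have hbdd : BddAbove P := by
    refine ⟨B₁ * (w * r) ^ 2, ?_⟩
    rintro _ ⟨t, ht, x, h, rfl⟩
    have h1 := hUB ht (hmem (hIcc ht) h)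
    have h2 := (lt_of_weight_pos hw hL0 (hIcc ht).1 h).2
    have h3 : Real.exp (-(c * t)) ≤ 1 := Real.exp_le_one_iff.2 (by
      have := mul_nonneg hc (hIcc ht).1; linarith)
    calc F x t ≤ 1 * (B₁ * (w * r) ^ 2) := by
          have := hU0 x t (hIcc ht)
          simp only [hF]; gcongr
      _ = _ := one_mul _
  set Fs := sSup P with hFs
  have hθF : θ ≤ Fs := by
    obtain ⟨t, ht, x, h, h'⟩ := hmax
    exact h'.trans (le_csSup hbdd ⟨t, ht, x, h, rfl⟩)
  have hall : ∀ t, 0 < t → t ≤ tb → ∀ x, 0 < weight w r L (d t x) t → F x t ≤ Fs := by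
    intro t h0 h1 x h
    rcases lt_or_ge t τ with h2 | h2
    · exact (hinit t h0 h2 x h).trans hθF
    · exact le_csSup hbdd ⟨t, ⟨h2, h1⟩, x, h, rfl⟩
  set ψm := √(θ / (2 * B₁)) with hψm
  have hψm0 : 0 < ψm := by positivity
  set J := ⌊r / √τ⌋₊ with hJ
  set Eb : ℝ := 2 * ((J + 1) ^ 2 + n * (K / τ) * r ^ 2) with hEb
  set Db : ℝ := n ^ 2 * (K / τ) * r ^ 2 with hDb
  have hτs : 0 < √τ := Real.sqrt_pos.2 hτ
  set M := 1 + c + B₁ + w * r + w + w * Eb / (2 * √τ)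
    + w * ((1 + 2 * Db) / (2 * √τ) + L / (2 * √τ)) with hMdef
  obtain ⟨m1, m2, m3, m4⟩ : 0 ≤ w * r ∧ 0 ≤ w * Eb / (2 * √τ) ∧
      0 ≤ w * ((1 + 2 * Db) / (2 * √τ) + L / (2 * √τ)) ∧ 1 ≤ B₁ :=
    ⟨by positivity, by positivity, by positivity, le_max_right _ _⟩
  have hM1 : 1 ≤ M := by linarith
  obtain ⟨η₀, hη₀, H⟩ := near_max_inequality n hM1 hη hψm0
  obtain ⟨ρ₁, hρ₁, H₁⟩ := space_taylor (R := 1 / √c') hM hUs hS hτ htb hη₀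
  obtain ⟨ρ₂, hρ₂, H₂⟩ := time_taylor hUs hS hτ htb hη₀
  obtain ⟨ρ₃, hρ₃, H₃⟩ := hvar hS hτ htb hc' hcS r J (show 0 < 2 * √τ * η₀ / w by positivity)
  obtain ⟨ε, hε, H⟩ := H (min (min ρ₁ ρ₂) (min ρ₃ (τ / 2))) (by positivity)
  set ε' := min (θ / 2) (Real.exp (-(c * tb)) * ε) with hε'
  have hε'0 : 0 < ε' := by positivity
  obtain ⟨_, ⟨t, ht, x, hpos, rfl⟩, hlt⟩ := exists_lt_of_lt_csSup (show P.Nonempty by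
    obtain ⟨t, ht, x, h, -⟩ := hmax
    exact ⟨_, t, ht, x, h, rfl⟩) (show Fs - ε' < Fs by linarith)
  have ht0 : 0 < t := hτ.trans_le ht.1
  have hx : 0 < Real.exp (-(c * t)) := Real.exp_pos _
  have hx1 : Real.exp (-(c * t)) ≤ 1 := Real.exp_le_one_iff.2 (by
    have := mul_nonneg hc ht0.le; linarith)
  obtain ⟨ℓ, hℓ, hℓpos, hℓlt⟩ := exists_weight_near (a := Fs - ε')
    (U := Real.exp (-(c * t)) * U (x, t)) hpos
    (by simp only [hF] at hlt; linarith)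
  set ψ := weight w r L ℓ t with hψ
  have hψF : Fs ≤ Real.exp (-(c * t)) * (U (x, t) * ψ ^ 2 + ε) := by
    have h1 : Real.exp (-(c * tb)) * ε ≤ Real.exp (-(c * t)) * ε := by
      gcongr; exact ht.2
    linarith [min_le_right (θ / 2) (Real.exp (-(c * tb)) * ε)]
  have hθψ : θ / 2 ≤ U (x, t) * ψ ^ 2 := by
    have h1 : θ / 2 ≤ Real.exp (-(c * t)) * (U (x, t) * ψ ^ 2) := by
      linarith [min_le_left (θ / 2) (Real.exp (-(c * tb)) * ε)]
    have h2 : 0 ≤ U (x, t) * ψ ^ 2 := mul_nonneg (hU0 x t (hIcc ht)) (sq_nonneg _)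
    exact h1.trans (mul_le_of_le_one_left h2 hx1)
  have hℓ0 : 0 ≤ ℓ := (hd0 t x).trans hℓ.le
  obtain ⟨hℓr, hψr⟩ := lt_of_weight_pos hw hL0 ht0.le hℓpos
  have hxS : x ∈ S := hmem (hIcc ht) hpos
  have hUx := hUB ht hxS
  have hU0x := hU0 x t (hIcc ht)
  have hψmψ : ψm ≤ ψ := by
    refine Real.sqrt_le_iff.2 ⟨hℓpos.le, ?_⟩
    rw [div_le_iff₀ (by positivity)]
    have : U (x, t) * ψ ^ 2 ≤ B₁ * ψ ^ 2 := by gcongr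
    linarith
  refine ⟨t, ht, x, ψ, hℓpos, weight_antitone hw.le (hd0 t x) hℓ.le, hθψ, ?_⟩
  obtain ⟨γ, v, hγ, rfl⟩ := hpath t (hIcc ht) x ℓ hℓ
  have hγS := hSm t (hIcc ht) γ v (hγ.mono hℓ0 hℓr.le)
  have hA : ∀ s ∈ Icc (0 : ℝ) 1, riemNorm (fun y => g y t) (γ s) ≤ K / t := by
    intro s hs
    rw [hUr]
    refine hKt t ht0 (hIcc ht).2 _ (lt_of_le_of_lt ?_ (hℓr.trans hr₀))
    exact hspeed t (hIcc ht) ℓ γ v hγ hℓ0 s hs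
  have hts : √τ ≤ √t := Real.sqrt_le_sqrt ht.1
  have hts0 : 0 < √t := hτs.trans_le hts
  set j := ⌊ℓ / √t⌋₊ with hj
  have hjJ : j ≤ J := Nat.floor_mono (by gcongr)
  obtain ⟨e, he, E₁, E₂, D, hE₁, hE₂, hD, hED, hsp, htm⟩ :=
    H₃ t ht ℓ ⟨hℓ0, hℓr.le⟩ γ v hγ hγS (K / t) hA j hjJ
  have heR : ∀ a, ‖e a‖ ≤ 1 / √c' := fun a =>
    norm_le_of_metric_le hc' (hcS _ hxS t ht _) (by
      have := he a a
      rw [this]; simp) zero_le_one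
  set Hs := √(ℓ ^ 2 + t) with hHs
  have hHt : √t ≤ Hs := Real.sqrt_le_sqrt (by linarith [sq_nonneg ℓ])
  have hHs0 : 0 < Hs := hts0.trans_le hHt
  have hHτ : √τ ≤ Hs := hts.trans hHt
  have hℓH : ℓ ≤ Hs := Real.le_sqrt_of_sq_le (by linarith)
  have hKτ : K / t ≤ K / τ := by gcongr; exact ht.1
  have hEb' : ∀ a, |E₂ a| ≤ Eb := fun a => (hE₂ a).trans (by
    rw [hEb]
    have : (j : ℝ) ≤ J := by exact_mod_cast hjJ
    gcongr)
  have hDb' : |D| ≤ Db := hD.trans (by rw [hDb]; gcongr)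
  have hpw : ∀ a, |-(w * E₁ a / (2 * Hs))| ≤ w := fun a => by
    rw [abs_neg, abs_div, abs_mul, abs_of_pos hw, abs_of_pos (by positivity : 0 < 2 * Hs),
      div_le_iff₀ (by positivity)]
    exact mul_le_mul_of_nonneg_left ((hE₁ a).trans (by linarith)) hw.le
  obtain ⟨-, hBt, hBe⟩ := hB _ hxS t ht
  have hBB : B ≤ B₁ := le_max_left _ _
  have key : ∀ X, 0 < t - X → X ≥ 0 → ∀ y u, u = U (y, t - X) →
      0 < weight w r L (d (t - X) y) (t - X) →
      (1 + c * X) * u * weight w r L (d (t - X) y) (t - X) ^ 2 ≤ U (γ 1, t) * ψ ^ 2 + ε := by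
    intro X hX0 hX y u hu h
    have h1 := hall (t - X) hX0 (by linarith [ht.2]) y h
    have h2 := h1.trans hψF
    have h3 : Real.exp (-(c * (t - X))) = Real.exp (-(c * t)) * Real.exp (c * X) := by
      rw [← Real.exp_add]; ring_nf
    simp only [hF, h3, mul_assoc] at h2
    have h4 := le_of_mul_le_mul_left h2 hx
    refine le_trans ?_ h4
    have h5 : 0 ≤ U (y, t - X) := hU0 _ _ ⟨hX0.le, by linarith [(hIcc ht).2]⟩
    have h6 : 1 + c * X ≤ Real.exp (c * X) := by linarith [Real.add_one_le_exp (c * X)]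
    rw [hu, mul_assoc]
    gcongr
  have hwη : w * (2 * √τ * η₀ / w) / (2 * Hs) ≤ η₀ := by
    rw [mul_div_cancel₀ _ hw.ne', div_le_iff₀ (by positivity)]
    have := mul_le_mul_of_nonneg_left hHτ hη₀.le
    linarith
  have hfin := H c (U (γ 1, t)) (deriv (fun s => U (γ 1, s)) t) ψ
    (w * ((1 - 2 * D) / (2 * Hs) + L / (2 * √t))) w
    (32 * n ^ 6 * (U (γ 1, t) * √(U (γ 1, t))))
    (fun a => deriv (fun h => U (geo (conn g) (γ 1) t (e a) h, t)) 0)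
    (fun a => deriv (deriv fun h => U (geo (conn g) (γ 1) t (e a) h, t)) 0)
    (fun a => -(w * E₁ a / (2 * Hs))) (fun a => -(w * E₂ a / (2 * Hs)))
    hc (by linarith) hU0x (by linarith) (by linarith) hψmψ (by linarith) ?_
    (fun a => by linarith [(hBe _ (heR a)).1]) (fun a => by linarith [(hBe _ (heR a)).2])
    (fun a => by linarith [hpw a]) ?_ hpw ?_ ?_ ?_ ?_
  · exact hfin
  · have h1 : |w * ((1 - 2 * D) / (2 * Hs) + L / (2 * √t))| ≤
        w * ((1 + 2 * Db) / (2 * √τ) + L / (2 * √τ)) := by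
      rw [abs_mul, abs_of_pos hw]
      refine mul_le_mul_of_nonneg_left ((abs_add_le _ _).trans (add_le_add ?_ ?_)) hw.le
      · rw [abs_div, abs_of_pos (by positivity : 0 < 2 * Hs)]
        gcongr
        refine (abs_sub _ _).trans ?_
        rw [abs_one, abs_mul, abs_two]; linarith
      · rw [abs_of_nonneg (by positivity)]; gcongr
    linarith
  · intro a
    have h1 : |-(w * E₂ a / (2 * Hs))| ≤ w * Eb / (2 * √τ) := by
      rw [abs_neg, abs_div, abs_mul, abs_of_pos hw, abs_of_pos (by positivity : 0 < 2 * Hs)]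
      have := hEb' a
      gcongr
    linarith
  · intro a h hh
    simp only [le_min_iff] at hh
    obtain ⟨⟨hh1, -⟩, hh3, -⟩ := hh
    refine ⟨_, weight w r L (d t (geo (conn g) (γ 1) t (e a) h)) t,
      H₁ _ hxS t ht _ (heR a) h hh1, ?_, fun hp => ?_⟩
    · refine le_trans ?_ (weight_lower (ℓ := ℓ) (t := t) hw.le hL0 ht0 ht0.le (hsp a h hh3))
      have h1 : w * (2 * √τ * η₀ / w) / (2 * Hs) * h ^ 2 ≤ η₀ * h ^ 2 := by gcongr
      rw [← hHs, ← hψ]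
      generalize 2 * √τ * η₀ / w = k at h1 ⊢
      have h2 : w * ((ℓ ^ 2 + h * E₁ a + h ^ 2 / 2 * E₂ a + k * h ^ 2 + t - ℓ ^ 2 - t) / (2 * Hs)
          + L * ((t - t) / (2 * √t))) = h * (w * E₁ a / (2 * Hs))
            + h ^ 2 / 2 * (w * E₂ a / (2 * Hs)) + w * k / (2 * Hs) * h ^ 2 := by ring
      rw [h2]
      linarith
    · have := key 0 (by simpa using ht0) le_rfl (geo (conn g) (γ 1) t (e a) h) _ rfl
        (by simpa using hp)
      simpa using this
  · intro h h0 hh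
    simp only [le_min_iff] at hh
    obtain ⟨⟨-, hh2⟩, hh3, hh4⟩ := hh
    have hth : 0 < t - h := by linarith [ht.1]
    refine ⟨_, weight w r L (d (t - h) (γ 1)) (t - h), H₂ _ hxS t ht h h0 hh2, ?_, fun hp =>
      key h hth h0 (γ 1) _ rfl hp⟩
    refine le_trans ?_ (weight_lower (ℓ := ℓ) (t := t) hw.le hL0 ht0 hth.le (htm h h0 hh3))
    have h1 : w * (2 * √τ * η₀ / w) / (2 * Hs) * h ≤ η₀ * h := by gcongr
    rw [← hHs, ← hψ]
    generalize 2 * √τ * η₀ / w = k at h1 ⊢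
    have h2 : w * ((ℓ ^ 2 + 2 * h * D + k * h + (t - h) - ℓ ^ 2 - t) / (2 * Hs)
        + L * ((t - h - t) / (2 * √t))) = w * k / (2 * Hs) * h
          - h * (w * ((1 - 2 * D) / (2 * Hs) + L / (2 * √t))) := by ring
    rw [h2]
    linarith
  · have h1 := slope_sum_nonneg (E := ∑ a, E₂ a) (D := D) (ℓ := ℓ) hn hK hw.le ht0 hℓ0
      (Nat.floor_le (by positivity)) (Nat.lt_floor_add_one _) hED
    rw [Finset.sum_neg_distrib, ← Finset.sum_div, ← Finset.mul_sum, ← sub_eq_add_neg]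
    exact h1
  · have h1 := hM.deriv_normSq_le (fun z hz => flow_metricForm hT hg hz hfl)
      hUn (x := γ 1) (t := t)
      (fun y => ⟨mem_univ _, ht0, ht.2.trans_lt htb⟩) he
    simpa using h1

end MaximumPrinciple

section InteriorEstimate
variable {n : ℕ} {g : (Fin n → ℝ) → ℝ → Matrix (Fin n) (Fin n) ℝ} {T t r r₀ K : ℝ}
  {x₀ x : Fin n → ℝ}

theorem riemNorm_nonneg (G : (Fin n → ℝ) → Matrix (Fin n) (Fin n) ℝ) (x : Fin n → ℝ) :
    0 ≤ riemNorm G x := by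
  rw [riemNorm_eq]; exact Real.sqrt_nonneg _

set_option maxHeartbeats 800000 in
/-- The interior curvature estimate for a parabolic weight vanishing near the boundary. -/
theorem riemNorm_mul_weight_le (hT : 0 < T) (hg : SmoothMetricFamily g (Icc 0 T))
    (hfl : IsRicciFlow g (Icc 0 T)) (hr : 0 ≤ r) (hr₀ : r < r₀)
    (hcpt : ∀ t ∈ Icc (0 : ℝ) T, IsCompact (closure (rBall (fun y => g y t) x₀ r₀)))
    (hK : 1 ≤ K) (hb : ∀ x ∈ rBall (fun y => g y 0) x₀ r₀,
      riemNorm (fun y => g y 0) x ≤ 1 / r₀ ^ 2)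
    (hKt : ∀ t, 0 < t → t ≤ T → ∀ x, riemDist (fun y => g y t) x₀ x < r₀ →
      riemNorm (fun y => g y t) x ≤ K / t)
    (hn : 1 ≤ n) (ht : 0 < t) (htT : t < T)
    (hφ : 0 < r - √(riemDist (fun y => g y t) x₀ x ^ 2 + t) - 8 * n ^ 2 * K * √t) :
    riemNorm (fun y => g y t) x *
      (r - √(riemDist (fun y => g y t) x₀ x ^ 2 + t) - 8 * n ^ 2 * K * √t) ^ 2 ≤
      16 * Real.exp (512 * n ^ 6 * K) := by
  set L : ℝ := 8 * n ^ 2 * K with hL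
  have hL0 : 0 ≤ L := by positivity
  have hsq : ∀ y s, s ∈ Icc 0 T → riemNormSq (fun y => g y s) y =
      riemNorm (fun y => g y s) y ^ 2 := fun y s hs => by
    rw [riemNorm_eq, Real.sq_sqrt (riemNormSq_nonneg hg (z := (y, s)) hs)]
  have hu0 : ∀ x t, 0 ≤ riemNorm (fun y => g y t) x := fun x t => riemNorm_nonneg _ _
  have hr₀0 : 0 < r₀ := hr.trans_lt hr₀
  obtain ⟨τ₀, hτ₀, hτb⟩ := exists_initial_bound hT hg hr hr₀ (hcpt 0 ⟨le_rfl, hT.le⟩) hb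
  have hnear := fun {w τ tb c θ η} => exists_near_max (w := w) (τ := τ) (tb := tb) (c := c)
    (θ := θ) (η := η) hT hg hfl hr hr₀ hcpt hK hKt hn
  obtain ⟨u, hu⟩ : ∃ u : (Fin n → ℝ) → ℝ → ℝ, ∀ x t, riemNorm (fun y => g y t) x = u x t :=
    ⟨_, fun _ _ => rfl⟩
  obtain ⟨d, hd⟩ : ∃ d : ℝ → (Fin n → ℝ) → ℝ, ∀ t x, riemDist (fun y => g y t) x₀ x = d t x :=
    ⟨_, fun _ _ => rfl⟩
  obtain ⟨U, hU⟩ : ∃ U : (Fin n → ℝ) → ℝ → ℝ, ∀ x t, riemNormSq (fun y => g y t) x = U x t :=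
    ⟨_, fun _ _ => rfl⟩
  simp only [hu, hd, hU, ← hL] at hsq hu0 hτb hnear hKt hφ ⊢
  clear hu hd hU hb hcpt hfl hg
  set φ : (Fin n → ℝ) → ℝ → ℝ := fun x t => r - √(d t x ^ 2 + t) - L * √t with hφd
  set Z := Real.exp (512 * n ^ 6 * K) with hZ
  have hZ1 : 1 ≤ Z := Real.one_le_exp (by positivity)
  have hdr : ∀ {x t}, 0 ≤ t → 0 < φ x t → d t x < r ∧ φ x t ≤ r := by
    intro x t ht h
    have h1 : d t x ≤ √(d t x ^ 2 + t) := Real.le_sqrt_of_sq_le (by linarith)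
    have h2 : 0 ≤ L * √t := by positivity
    have h3 := Real.sqrt_nonneg (d t x ^ 2 + t)
    simp only [hφd] at h ⊢
    constructor <;> linarith
  have hur : ∀ {x t}, 0 < t → t ≤ T → d t x < r → u x t ≤ K / t := fun h1 h2 h3 =>
    hKt _ h1 h2 _ (h3.trans hr₀)
  by_contra! hcon
  set P : Set ℝ := {f | ∃ s, 0 < s ∧ s ≤ t ∧ ∃ y, 0 < φ y s ∧ f = u y s * φ y s ^ 2} with hP
  have hbdd : BddAbove P := by
    refine ⟨(2 / r₀ ^ 2 + K / τ₀) * r ^ 2, ?_⟩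
    rintro _ ⟨s, hs, hst, y, hy, rfl⟩
    obtain ⟨h1, h2⟩ := hdr hs.le hy
    have h3 : 0 < 2 / r₀ ^ 2 := by positivity
    have h4 : 0 < K / τ₀ := by positivity
    have h5 : u y s ≤ 2 / r₀ ^ 2 + K / τ₀ := by
      rcases lt_or_ge s τ₀ with h | h
      · have := hτb s ⟨hs.le, hst.trans htT.le⟩ h y h1
        exact this.trans (by linarith)
      · have : K / s ≤ K / τ₀ := by gcongr
        have := hur hs (hst.trans htT.le) h1
        linarith
    gcongr
  have hS : 16 * Z < sSup P := hcon.trans_le (le_csSup hbdd ⟨t, ht, le_rfl, x, hφ, rfl⟩)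
  obtain ⟨_, ⟨t₁, ht₁, ht₁t, x₁, hφ₁, rfl⟩, hlt⟩ := exists_lt_of_lt_csSup
    (show P.Nonempty from ⟨_, t, ht, le_rfl, x, hφ, rfl⟩)
    (show max (sSup P / 2) (16 * Z) < sSup P from max_lt (by linarith) hS)
  obtain ⟨hlt1, hlt2⟩ := max_lt_iff.1 hlt
  set Q := u x₁ t₁ with hQ
  set f := φ x₁ t₁ with hf
  obtain ⟨hd₁, hfr⟩ := hdr ht₁.le hφ₁
  have hQ0 : 0 < Q := by
    rcases (hu0 x₁ t₁).eq_or_lt with h | h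
    · rw [hQ, ← h] at hlt2; linarith
    · exact h
  have hQK : Q * t₁ ≤ K := by
    have := hur ht₁ (ht₁t.trans htT.le) hd₁
    rwa [le_div_iff₀ ht₁] at this
  have hwt : ∀ y s, weight (1 / f) r L (d s y) s = φ y s / f - 1 / 2 := fun y s => by
    simp only [weight, hφd]; ring
  have hf2 : 0 < f ^ 2 := by positivity
  have hexp : Real.exp (-(512 * n ^ 6 * Q * t₁)) ≥ Z⁻¹ := by
    rw [hZ, ← Real.exp_neg]
    refine Real.exp_le_exp.2 (neg_le_neg ?_)
    rw [mul_assoc]; gcongr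
  have hinit : ∀ s, 0 < s → s < min τ₀ t₁ → ∀ y, 0 < weight (1 / f) r L (d s y) s →
      Real.exp (-(512 * n ^ 6 * Q * s)) * (U y s * weight (1 / f) r L (d s y) s ^ 2) ≤
        Z⁻¹ * Q ^ 2 / 4 := by
    intro s hs hsτ y h
    have hsT : s ∈ Icc 0 T := ⟨hs.le, hsτ.le.trans ((min_le_right _ _).trans
      (ht₁t.trans htT.le))⟩
    obtain ⟨h5, h6⟩ := lt_of_weight_pos (by positivity) hL0 hs.le h
    have h7 := hτb s hsT (hsτ.trans_le (min_le_left _ _)) y h5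
    have h8 : Real.exp (-(512 * n ^ 6 * Q * s)) ≤ 1 := Real.exp_le_one_iff.2 (by
      have : 0 ≤ 512 * n ^ 6 * Q * s := by positivity
      linarith)
    rw [hsq y s hsT]
    have h9 : u y s ≤ 2 / r₀ ^ 2 := h7
    calc _ ≤ 1 * ((2 / r₀ ^ 2) ^ 2 * (1 / f * r₀) ^ 2) := by
          have := hu0 y s
          gcongr
          exact h6.trans (by gcongr)
      _ = 4 / (r₀ ^ 2 * f ^ 2) := by field_simp; norm_num
      _ ≤ Z⁻¹ * Q ^ 2 / 4 := by
          rw [div_le_iff₀ (by positivity)]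
          have h10 : f ^ 2 ≤ r₀ ^ 2 := by gcongr; linarith
          have h11 : Q * f ^ 2 ≤ Q * r₀ ^ 2 := by gcongr
          have h12 : (16 * Z) * (16 * Z) ≤ (Q * r₀ ^ 2) * (Q * f ^ 2) :=
            mul_le_mul (by linarith) hlt2.le (by positivity) (by positivity)
          have h13 := mul_le_mul_of_nonneg_left h12 (show 0 ≤ Z⁻¹ / 4 by positivity)
          have h14 : Z⁻¹ / 4 * ((16 * Z) * (16 * Z)) = 64 * Z := by field_simp; norm_num
          nlinarith
  have hmax : ∃ s ∈ Icc (min τ₀ t₁) t₁, ∃ y, 0 < weight (1 / f) r L (d s y) s ∧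
      Z⁻¹ * Q ^ 2 / 4 ≤
        Real.exp (-(512 * n ^ 6 * Q * s)) * (U y s * weight (1 / f) r L (d s y) s ^ 2) := by
    refine ⟨t₁, ⟨min_le_right _ _, le_rfl⟩, x₁, ?_⟩
    have h5 : weight (1 / f) r L (d t₁ x₁) t₁ = 1 / 2 := by
      rw [hwt, ← hf, div_self hφ₁.ne']; norm_num
    rw [h5, hsq x₁ t₁ ⟨ht₁.le, ht₁t.trans htT.le⟩, ← hQ]
    refine ⟨by norm_num, ?_⟩
    have := mul_le_mul_of_nonneg_right hexp (show 0 ≤ Q ^ 2 * (1 / 2) ^ 2 by positivity)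
    linarith
  have hmain : ∀ η > 0, 32 * n ^ 6 * Q ^ 3 * Z⁻¹ ≤ 384 * n * Q ^ 2 / f ^ 2 + η := by
    intro η hη
    obtain ⟨s, hs, y, ψ, h1, h2, h3, h4⟩ := hnear (tb := t₁) (c := 512 * n ^ 6 * Q)
      (by positivity) (lt_min hτ₀ ht₁) (ht₁t.trans_lt htT) (by positivity) (by positivity)
      hinit hmax hη
    have hs0 : 0 < s := (lt_min hτ₀ ht₁).trans_le hs.1
    have hsT : s ∈ Icc 0 T := ⟨hs0.le, hs.2.trans (ht₁t.trans htT.le)⟩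
    rw [hsq y s hsT] at h3 h4
    have h5 : 0 < weight (1 / f) r L (d s y) s := h1.trans_le h2
    rw [hwt] at h5
    have h6 : f / 2 < φ y s := by
      have : 1 / 2 < φ y s / f := by linarith
      rw [lt_div_iff₀ hφ₁] at this
      linarith
    have h7 : u y s * φ y s ^ 2 ≤ sSup P :=
      le_csSup hbdd ⟨s, hs0, hs.2.trans ht₁t, y, by linarith, rfl⟩
    have h8 : u y s * (f / 2) ^ 2 ≤ u y s * φ y s ^ 2 := by
      have := hu0 y s
      gcongr
    have h9 : u y s ≤ 8 * Q := by
      have : u y s * f ^ 2 ≤ 8 * Q * f ^ 2 := by nlinarith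
      exact le_of_mul_le_mul_right this hf2
    have h10 : u y s ^ 2 * u y s * ψ ^ 2 ≤ 8 * Q * (u y s ^ 2 * ψ ^ 2) := by
      have := mul_le_mul_of_nonneg_left h9 (show 0 ≤ u y s ^ 2 * ψ ^ 2 by positivity)
      linarith
    have h11 : u y s ^ 2 ≤ (8 * Q) ^ 2 := by
      have := hu0 y s
      gcongr
    have h12 : 6 * n * (1 / f) ^ 2 * u y s ^ 2 ≤ 6 * n * (1 / f) ^ 2 * (8 * Q) ^ 2 := by gcongr
    have h13 := mul_le_mul_of_nonneg_left h10 (show 0 ≤ 32 * (n : ℝ) ^ 6 by positivity)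
    have h14 := mul_le_mul_of_nonneg_left h3 (show 0 ≤ 256 * (n : ℝ) ^ 6 * Q by positivity)
    have h15 : 6 * n * (1 / f) ^ 2 * (8 * Q) ^ 2 = 384 * n * Q ^ 2 / f ^ 2 := by
      field_simp; norm_num
    linarith
  have h1 := le_of_forall_pos_le_add hmain
  rw [le_div_iff₀ hf2] at h1
  have h2 : 32 * (n : ℝ) ^ 6 * Q ^ 3 * Z⁻¹ * f ^ 2 = Z⁻¹ * (32 * n ^ 6) * Q ^ 2 * (Q * f ^ 2) := by
    ring
  have hn' : (1 : ℝ) ≤ n := by exact_mod_cast hn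
  have h3 : (n : ℝ) ≤ n ^ 6 := le_self_pow₀ hn' (by norm_num)
  have h4 := mul_le_mul_of_nonneg_left hlt2.le
    (show 0 ≤ Z⁻¹ * (32 * (n : ℝ) ^ 6) * Q ^ 2 by positivity)
  have h5 : Z⁻¹ * (32 * (n : ℝ) ^ 6) * Q ^ 2 * (16 * Z) = 512 * n ^ 6 * Q ^ 2 := by
    field_simp; norm_num
  have h6 : (n : ℝ) * Q ^ 2 ≤ n ^ 6 * Q ^ 2 := by gcongr
  have h7 : 0 < (n : ℝ) * Q ^ 2 := by positivity
  linarith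

end InteriorEstimate

section FinalEstimate
variable {n : ℕ} {g : (Fin n → ℝ) → ℝ → Matrix (Fin n) (Fin n) ℝ} {T t r r₀ K : ℝ}
  {x₀ x : Fin n → ℝ}

theorem cube_le_exp (hK : 1 ≤ K) : K ^ 3 ≤ Real.exp (3 * K) := by
  have h : K ≤ Real.exp K := by linarith [Real.add_one_le_exp K]
  calc K ^ 3 ≤ Real.exp K ^ 3 := by gcongr
    _ = Real.exp (3 * K) := by rw [← Real.exp_nat_mul]; norm_num

theorem le_exp_mul {a : ℝ} (ha : 0 ≤ a) (hK : 1 ≤ K) : a ≤ Real.exp (a * K) := by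
  have := Real.add_one_le_exp (a * K)
  nlinarith

/-- The curvature estimate at times in the interior of the time interval. -/
theorem riemNorm_mul_sq_le (hT : 0 < T) (hg : SmoothMetricFamily g (Icc 0 T))
    (hfl : IsRicciFlow g (Icc 0 T)) (hr₀ : r < r₀)
    (hcpt : ∀ t ∈ Icc (0 : ℝ) T, IsCompact (closure (rBall (fun y => g y t) x₀ r₀)))
    (hK : 1 ≤ K) (hb : ∀ x ∈ rBall (fun y => g y 0) x₀ r₀,
      riemNorm (fun y => g y 0) x ≤ 1 / r₀ ^ 2)
    (hKt : ∀ t, 0 < t → t ≤ T → ∀ x, riemDist (fun y => g y t) x₀ x < r₀ →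
      riemNorm (fun y => g y t) x ≤ K / t)
    (hn : 1 ≤ n) (ht : 0 < t) (htT : t < T) (hd : riemDist (fun y => g y t) x₀ x < r) :
    riemNorm (fun y => g y t) x * (r - riemDist (fun y => g y t) x₀ x) ^ 2 ≤
      Real.exp ((512 * n ^ 6 + 64 + 324 * n ^ 4 + 3) * K) := by
  have hd0 : 0 ≤ riemDist (fun y => g y t) x₀ x := riemDist_nonneg _ _ _
  have hφ := riemNorm_mul_weight_le (x := x) hT hg hfl (hd0.trans hd.le) hr₀ hcpt hK hb hKt hn ht htT
  have hKx := hKt t ht htT.le x (hd.trans hr₀)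
  have hu0 := riemNorm_nonneg (fun y => g y t) x
  generalize riemNorm (fun y => g y t) x = u at *
  generalize riemDist (fun y => g y t) x₀ x = d at *
  have hn1 : (1 : ℝ) ≤ n := by exact_mod_cast hn
  have hs : 0 < √t := Real.sqrt_pos.2 ht
  have hst : √t ^ 2 = t := Real.sq_sqrt ht.le
  have h1 : √(d ^ 2 + t) ≤ d + √t := by
    rw [Real.sqrt_le_left (by positivity)]; nlinarith
  set L : ℝ := 8 * n ^ 2 * K with hL
  have hnK : 1 ≤ (n : ℝ) ^ 2 * K := by nlinarith [one_le_pow₀ hn1 (n := 2)]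
  rcases le_or_gt ((L + 1) * √t) ((r - d) / 2) with h | h
  · have h2 : (r - d) / 2 ≤ r - √(d ^ 2 + t) - L * √t := by linarith
    have h3 : 0 < (r - d) / 2 := by linarith
    have h4 := hφ (h3.trans_le h2)
    have h5 : u * ((r - d) / 2) ^ 2 ≤ u * (r - √(d ^ 2 + t) - L * √t) ^ 2 := by gcongr
    calc u * (r - d) ^ 2 ≤ 64 * Real.exp (512 * n ^ 6 * K) := by linarith
      _ ≤ Real.exp (64 * K) * Real.exp (512 * n ^ 6 * K) := by
          gcongr; exact le_exp_mul (by norm_num) hK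
      _ ≤ _ := by
          rw [← Real.exp_add]
          apply Real.exp_le_exp.2
          have : 0 ≤ (324 * (n : ℝ) ^ 4 + 3) * K := by positivity
          linarith
  · have h2 : (r - d) ^ 2 ≤ (2 * ((9 * (n ^ 2 * K)) * √t)) ^ 2 := by
      have h3 : L + 1 ≤ 9 * (n ^ 2 * K) := by linarith
      have h4 : (L + 1) * √t ≤ 9 * (n ^ 2 * K) * √t := by gcongr
      gcongr
      · linarith
    rw [le_div_iff₀ ht] at hKx
    calc u * (r - d) ^ 2 ≤ u * (2 * ((9 * (n ^ 2 * K)) * √t)) ^ 2 := by gcongr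
      _ = 324 * n ^ 4 * K ^ 2 * (u * √t ^ 2) := by ring
      _ ≤ 324 * n ^ 4 * K ^ 2 * K := by rw [hst]; gcongr
      _ = 324 * n ^ 4 * K ^ 3 := by ring
      _ ≤ Real.exp (324 * n ^ 4 * K) * Real.exp (3 * K) := by
          gcongr
          · exact le_exp_mul (by positivity) hK
          · exact cube_le_exp hK
      _ ≤ _ := by
          rw [← Real.exp_add]
          apply Real.exp_le_exp.2
          have : 0 ≤ (512 * (n : ℝ) ^ 6 + 64) * K := by positivity
          linarith

/-- Passage to the closed time interval. -/
theorem riemNorm_mul_sq_le_of_interior {G : ℝ} (hT : 0 < T)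
    (hg : SmoothMetricFamily g (Icc 0 T))
    (hG : ∀ s, 0 < s → s < T → ∀ r < r₀, riemDist (fun y => g y s) x₀ x < r →
      riemNorm (fun y => g y s) x * (r - riemDist (fun y => g y s) x₀ x) ^ 2 ≤ G)
    (ht : t ∈ Icc 0 T) (hd : riemDist (fun y => g y t) x₀ x < r₀) :
    riemNorm (fun y => g y t) x * (r₀ - riemDist (fun y => g y t) x₀ x) ^ 2 ≤ G := by
  set d := riemDist (fun y => g y t) x₀ x with hdd
  have hcont : ContinuousWithinAt (fun s => riemNorm (fun y => g y s) x) (Icc 0 T) t :=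
    ((continuousOn_riemNorm hT hg).comp (f := fun s => (x, s)) (by fun_prop)
      (fun s hs => ⟨mem_univ _, hs⟩)) t ht
  have hsub : 𝓝[Ioo 0 T] t ≤ 𝓝[Icc 0 T] t := nhdsWithin_mono _ Ioo_subset_Icc_self
  have hne : (𝓝[Ioo 0 T] t).NeBot := by
    rw [← mem_closure_iff_nhdsWithin_neBot, closure_Ioo hT.ne]; exact ht
  have hstep : ∀ ℓ r, d < ℓ → ℓ < r → r < r₀ →
      riemNorm (fun y => g y t) x * (r - ℓ) ^ 2 ≤ G := by
    intro ℓ r h1 h2 h3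
    refine le_of_tendsto ((hcont.mono_left hsub).mul_const ((r - ℓ) ^ 2)) ?_
    filter_upwards [hsub (eventually_riemDist_le hg ht h1), self_mem_nhdsWithin] with s hs hsI
    refine le_trans ?_ (hG s hsI.1 hsI.2 r h3 (hs.trans_lt h2))
    have := riemNorm_nonneg (fun y => g y s) x
    have hs' : riemDist (fun y => g y s) x₀ x ≤ ℓ := hs
    gcongr
  have hlim : Filter.Tendsto (fun δ : ℝ => riemNorm (fun y => g y t) x *
      ((r₀ - δ) - (d + δ)) ^ 2) (𝓝[>] 0) (𝓝 (riemNorm (fun y => g y t) x * (r₀ - d) ^ 2)) := by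
    have : Continuous (fun δ : ℝ => riemNorm (fun y => g y t) x *
      ((r₀ - δ) - (d + δ)) ^ 2) := by fun_prop
    have h := this.tendsto 0
    simp only [sub_zero, add_zero] at h
    exact h.mono_left nhdsWithin_le_nhds
  refine le_of_tendsto hlim ?_
  filter_upwards [Ioo_mem_nhdsGT (show (0 : ℝ) < (r₀ - d) / 2 by linarith)] with δ hδ
  exact hstep _ _ (by linarith [hδ.1]) (by linarith [hδ.2]) (by linarith [hδ.1])

end FinalEstimate

/-- Interior curvature estimate (Theorem 3.1). -/
theorem stmt_8 (n : ℕ) (hn : 2 ≤ n) :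
    ∃ C : ℝ, ∀ (T : ℝ) (g : (Fin n → ℝ) → ℝ → Matrix (Fin n) (Fin n) ℝ)
      (x₀ : Fin n → ℝ) (r₀ K : ℝ), 0 < r₀ → 1 ≤ K →
      SmoothMetricFamily g (Icc 0 T) → IsRicciFlow g (Icc 0 T) →
      (∀ t ∈ Icc (0:ℝ) T, IsCompact (closure (rBall (fun y => g y t) x₀ r₀))) →
      (∀ x ∈ rBall (fun y => g y 0) x₀ r₀, riemNorm (fun y => g y 0) x ≤ 1/r₀^2) →
      (∀ t : ℝ, 0 < t → t ≤ T → ∀ x : Fin n → ℝ, riemDist (fun y => g y t) x₀ x < r₀ →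
        riemNorm (fun y => g y t) x ≤ K/t) →
      ∀ t ∈ Icc (0:ℝ) T, ∀ x : Fin n → ℝ, riemDist (fun y => g y t) x₀ x < r₀ →
        riemNorm (fun y => g y t) x
          ≤ Real.exp (C*K) / (r₀ - riemDist (fun y => g y t) x₀ x)^2 := by
  refine ⟨512 * n ^ 6 + 64 + 324 * n ^ 4 + 3, ?_⟩
  intro T g x₀ r₀ K hr₀ hK hg hfl hcpt hb hKt t ht x hd
  have hd0 : 0 ≤ riemDist (fun y => g y t) x₀ x := riemDist_nonneg _ _ _
  rw [le_div_iff₀ (pow_pos (sub_pos.2 hd) 2)]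
  rcases ht.1.eq_or_lt with rfl | ht0
  · have h1 := hb x hd
    rw [le_div_iff₀ (by positivity)] at h1
    have h2 := riemNorm_nonneg (fun y => g y 0) x
    calc _ ≤ riemNorm (fun y => g y 0) x * r₀ ^ 2 := by
          gcongr
          linarith
      _ ≤ 1 := h1
      _ ≤ _ := Real.one_le_exp (by positivity)
  · have hT : 0 < T := ht0.trans_le ht.2
    exact riemNorm_mul_sq_le_of_interior hT hg (fun s hs hsT r hr h =>
      riemNorm_mul_sq_le hT hg hfl hr hcpt hK hb hKt (by omega) hs hsT h) ht hd

end
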